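/- There exists δ₀ > 0, depending only on γ, m, λ, δ₁, δ₂, such that if 0 < l₊ ≤ δ₀ then there exist a boundary speed Q₊ ∈ C([0,l₊]) with c_* ≤ Q₊ ≤ (c_* + q_max)/2 and a weak solution Q ∈ C^{0,1}([0,ζ₊]×[0,m]) of the sonic–supersonic problem with data Q₊ such that the nonlocal compatibility condition Q₊(x) = A₊⁻¹(Q(Φ₊(x), m)) holds for all x ∈ [0,l₊], and there are constants 0 < C₁ ≤ C₂ depending only on γ, m, λ, δ₁, δ₂ such that for almost every (φ,ψ) ∈ (0,ζ₊)×(0,m): −C₂φ^{λ+2} ≤ Q(φ,ψ) ≤ −C₁φ^{λ+2}; −C₂φ^{λ+1} ≤ Q_φ(φ,ψ) ≤ −C₁φ^{λ+1}; and |Q_ψ(φ,ψ)| ≤ C₂φ^{3λ/2+1}. -/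

import Mathlib

open Real Set MeasureTheory Filter

noncomputable section

/-- The density function `ρ(t) = (1 − ((γ−1)/2) t)^{1/(γ−1)}`. -/
def rhoF (γ t : ℝ) : ℝ := (1 - (γ - 1) / 2 * t) ^ ((1 : ℝ) / (γ - 1))

/-- The critical (sonic) speed `c_* = (2/(γ+1))^{1/2}`. -/
def cstar (γ : ℝ) : ℝ := Real.sqrt (2 / (γ + 1))

/-- The maximal speed `q_max = (2/(γ−1))^{1/2}`. -/
def qmaxF (γ : ℝ) : ℝ := Real.sqrt (2 / (γ - 1))

/-- `A(q) = ∫_{c_*}^q (ρ(s²)+2s²ρ'(s²))/(s ρ(s²)²) ds`. -/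
def Afun (γ q : ℝ) : ℝ :=
  ∫ s in (cstar γ)..q,
    (rhoF γ (s ^ 2) + 2 * s ^ 2 * deriv (rhoF γ) (s ^ 2)) / (s * (rhoF γ (s ^ 2)) ^ 2)

/-- `B(q) = ∫_{c_*}^q ρ(s²)/s ds`. -/
def Bfun (γ q : ℝ) : ℝ := ∫ s in (cstar γ)..q, rhoF γ (s ^ 2) / s

/-- Inverse of `A` restricted to `[c_*, q_max)`. -/
def AplusInv (γ : ℝ) : ℝ → ℝ := Function.invFunOn (Afun γ) (Ico (cstar γ) (qmaxF γ))

/-- `K(s) = B(A₊⁻¹(s))`. -/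
def Kfun (γ s : ℝ) : ℝ := Bfun γ (AplusInv γ s)

/-- `b(s) = −K'(s)`. -/
def bfun (γ s : ℝ) : ℝ := -deriv (Kfun γ) s

/-- `p(s) = −K''(s)`. -/
def pfun (γ s : ℝ) : ℝ := -deriv (deriv (Kfun γ)) s

/-- Partial derivative in the first (potential) variable. -/
def pdx (u : ℝ × ℝ → ℝ) (p : ℝ × ℝ) : ℝ := deriv (fun x => u (x, p.2)) p.1

/-- Partial derivative in the second (stream) variable. -/
def pdy (u : ℝ × ℝ → ℝ) (p : ℝ × ℝ) : ℝ := deriv (fun y => u (p.1, y)) p.2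

/-- The Chaplygin equation (⋆) at a point. -/
def chap (γ : ℝ) (q : ℝ × ℝ → ℝ) (p : ℝ × ℝ) : Prop :=
  pdx (pdx fun z => Afun γ (q z)) p + pdy (pdy fun z => Bfun γ (q z)) p = 0

/-- Flow angle on the upper wall of the divergent part. -/
def ThP (f : ℝ → ℝ) (x : ℝ) : ℝ := Real.arctan (deriv f x)

/-- The potential on the upper wall: `Φ₊(x) = ∫₀ˣ Q₊(s)/cos Θ₊(s) ds`. -/
def PhiP (f Qp : ℝ → ℝ) (x : ℝ) : ℝ := ∫ s in (0 : ℝ)..x, Qp s / Real.cos (ThP f s)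

/-- The potential extent `ζ₊ = Φ₊(l₊)`. -/
def zetaP (f Qp : ℝ → ℝ) (l : ℝ) : ℝ := PhiP f Qp l

/-- `X₊ = Φ₊⁻¹`. -/
def XP (f Qp : ℝ → ℝ) (l : ℝ) : ℝ → ℝ := Function.invFunOn (PhiP f Qp) (Icc 0 l)

/-- The geometric hypotheses on the divergent part of the nozzle wall. -/
def NozzlePlus (lamp δ1 δ2 l : ℝ) (f : ℝ → ℝ) : Prop :=
  ContDiff ℝ 3 f ∧ (∀ x ∈ Icc (0 : ℝ) l, 0 < f x) ∧ deriv f 0 = 0 ∧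
  (∀ x ∈ Icc (0 : ℝ) l,
    δ1 * x ^ lamp ≤ deriv (deriv f) x ∧ deriv (deriv f) x ≤ δ2 * x ^ lamp ∧
    0 ≤ deriv (deriv (deriv f)) x)

/-- A weak solution of the sonic–supersonic problem with boundary speed `Q₊`. -/
def SupersonicWeakSol (γ m l : ℝ) (f Qp : ℝ → ℝ) (Q : ℝ × ℝ → ℝ) : Prop :=
  (∃ L : NNReal, LipschitzOnWith L Q (Icc 0 (zetaP f Qp l) ×ˢ Icc 0 m)) ∧
  (∀ p ∈ Icc (0 : ℝ) (zetaP f Qp l) ×ˢ Icc (0 : ℝ) m, Q p ≤ 0) ∧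
  (∀ ψ ∈ Ioo (0 : ℝ) m, Q (0, ψ) = 0) ∧
  ∀ ξ : ℝ × ℝ → ℝ, ContDiff ℝ 1 ξ →
    (∀ ψ ∈ Ioo (0 : ℝ) m, ξ (zetaP f Qp l, ψ) = 0) →
    (∫ p in Ioo (0 : ℝ) (zetaP f Qp l) ×ˢ Ioo (0 : ℝ) m,
        (pdx Q p * pdx ξ p - bfun γ (Q p) * pdy Q p * pdy ξ p))
    - (∫ φ in Ioo (0 : ℝ) (zetaP f Qp l),
        deriv (ThP f) (XP f Qp l φ) * Real.cos (ThP f (XP f Qp l φ)) /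
          AplusInv γ (Q (φ, m)) * ξ (φ, m)) = 0

section
structure SC where
  (m μ cs A ca cb L Y0 d t1 t2 a b : ℝ)
  hm : 0 < m
  hμ : 1 < μ
  hcs : 0 < cs
  hA : 0 < A
  hca : 0 < ca
  hcb : 0 < cb
  hL : 0 < L
  hY0 : 0 < Y0
  hd : 0 < d
  ht1 : 0 < t1
  ht12 : t1 ≤ t2
  ha : 0 < a
  hab : a ≤ b
  ha4 : 6 * μ * a ^ 4 ≤ cs * (t1 / (2 * m)) * ca
  hb4 : 2 * cs * (2 * t2 / m + 1) * cb ≤ 3 * b ^ 4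

namespace SC
variable (S : SC)
noncomputable def v1 : ℝ := S.t1 / (2 * S.m)
noncomputable def v2 : ℝ := 2 * S.t2 / S.m
noncomputable def c1 : ℝ := S.ca / S.b
noncomputable def c2 : ℝ := S.cb / S.a
noncomputable def Cg : ℝ := (S.d + 1) / (S.c1 * S.cs)
noncomputable def k0 : ℝ := S.cs * S.L * S.v2 / S.a ^ 4
noncomputable def E : ℝ := (4 * S.d * S.A + 2 * S.d + 5) / S.m + 2 * S.k0 * S.Cg + 8 * S.A * S.μ * S.Cg
noncomputable def Gc : ℝ := S.E + 2 * S.Cg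
noncomputable def r0 : ℝ := S.L / S.a ^ 4 * (2 * S.m * S.Gc) / S.c1

lemma hb : 0 < S.b := S.ha.trans_le S.hab
lemma ht2 : 0 < S.t2 := S.ht1.trans_le S.ht12
lemma v1_pos : 0 < S.v1 := div_pos S.ht1 (by linarith [S.hm])
lemma v2_pos : 0 < S.v2 := div_pos (by linarith [S.ht2]) S.hm
lemma c1_pos : 0 < S.c1 := div_pos S.hca S.hb
lemma c2_pos : 0 < S.c2 := div_pos S.hcb S.ha
lemma Cg_pos : 0 < S.Cg := div_pos (by linarith [S.hd]) (mul_pos S.c1_pos S.hcs)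
lemma k0_pos : 0 < S.k0 := by
  have := S.ha; have := S.hcs; have := S.hL; have := S.v2_pos
  unfold k0; positivity
lemma E_pos : 0 < S.E := by
  have := S.hd; have := S.hm; have := S.hA; have := S.k0_pos; have := S.Cg_pos; have := S.hμ
  unfold E
  have : 0 < S.μ := by linarith
  positivity
lemma Gc_pos : 0 < S.Gc := by
  have := S.E_pos; have := S.Cg_pos; unfold Gc; positivity
lemma r0_pos : 0 < S.r0 := by
  have := S.ha; have := S.hL; have := S.hm; have := S.Gc_pos; have := S.c1_pos
  unfold r0; positivity
end SC

/-- properties of the wave speed -/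
structure Gas (S : SC) (C : ℝ → ℝ) : Prop where
  anti : ∀ a b, 0 < a → a ≤ b → b ≤ S.Y0 → C b ≤ C a
  lo : ∀ t, 0 < t → t ^ 3 ≤ S.Y0 → S.ca / t ≤ C (t ^ 3)
  hi : ∀ t, 0 < t → t ^ 3 ≤ S.Y0 → C (t ^ 3) ≤ S.cb / t
  lip : ∀ t a b, 0 < t → t ^ 3 ≤ a → a ≤ b → b ≤ S.Y0 → C a - C b ≤ S.L / t ^ 4 * (b - a)

/-- smallness of the point `x` with `X = x ^ μ` -/
structure SmallPt (S : SC) (x X : ℝ) : Prop where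
  hx : 0 < x
  hx1 : x ≤ 1
  hX : 0 < X
  hXx : X ≤ x
  hAX : S.A * X ≤ 1 / 2
  hr : S.r0 * (X / x) ≤ 1 / 2
  hE : S.Gc * (X / x) ≤ S.t1 / (2 * S.m)
  hY : (S.b * X) ^ 3 ≤ S.Y0
  hW : (S.d + 1) / (S.cs * S.c1) * (X / x) ≤ 1

noncomputable def Yv (R : ℤ → ℝ) (i : ℤ) : ℝ := -(R i + R (-i)) / 2

lemma Yv_neg (R : ℤ → ℝ) (i : ℤ) : Yv R (-i) = Yv R i := by
  simp [Yv]; ring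

lemma Yv_sub (R : ℤ → ℝ) (i : ℤ) :
    Yv R i - Yv R (i - 1) = -((R i - R (i - 1)) - (R (1 - i) - R (1 - i - 1))) / 2 := by
  have e1 : -(i - 1) = 1 - i := by ring
  have e2 : 1 - i - 1 = -i := by ring
  simp only [Yv, e1, e2]; ring

/-- Euler step -/
noncomputable def stepR (N : ℕ) (h σ x : ℝ) (Θ : ℝ → ℝ) (C : ℝ → ℝ) (P : ℝ → ℝ → ℝ) (R : ℤ → ℝ) :
    ℤ → ℝ := fun i =>
  if i = -(N : ℤ) then
    (R N - σ / h * (P x (Yv R N) * C (Yv R N)) * (R N - R (N - 1))) - 2 * Θ (x + σ)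
  else R i - σ / h * (P x (Yv R N) * C (Yv R i)) * (R i - R (i - 1))

noncomputable def wI (N : ℕ) (i : ℤ) : ℝ := ((i : ℝ) - 1 / 2) / N

noncomputable def gU (S : SC) (N : ℕ) (σ x : ℝ) (F C : ℝ → ℝ) (R : ℤ → ℝ) : ℝ :=
  F (x + σ) / (C (Yv R (N - 1)) * S.cs)

noncomputable def gL (S : SC) (N : ℕ) (x X : ℝ) (F C : ℝ → ℝ) (R : ℤ → ℝ) : ℝ :=
  F x * (1 - 2 * S.A * X) / (C (Yv R (N - 1)) * S.cs)

/-- invariant of the scheme -/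
structure InvR (S : SC) (N : ℕ) (h σ x X : ℝ) (Θ F C : ℝ → ℝ) (R : ℤ → ℝ) : Prop where
  bc : R (-N) = R N - 2 * Θ x
  up : ∀ i : ℤ, -(N : ℤ) < i → i ≤ N →
    R i - R (i - 1) ≤ Θ x / N + h * (S.E * (X ^ 5 / x ^ 2) + gU S N σ x F C R * (1 - wI N i))
  dn : ∀ i : ℤ, -(N : ℤ) < i → i ≤ N →
    Θ x / N - h * (S.E * (X ^ 5 / x ^ 2) + gL S N x X F C R * (1 + wI N i)) ≤ R i - R (i - 1)
  Ylo : ∀ i : ℤ, -(N : ℤ) ≤ i → i ≤ N → (S.a * X) ^ 3 ≤ Yv R i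
  Yhi : ∀ i : ℤ, -(N : ℤ) ≤ i → i ≤ N → Yv R i ≤ (S.b * X) ^ 3

/-- local hypotheses on the wall data at `x` with step `σ` -/
structure WallPt (S : SC) (σ x X : ℝ) (Θ F : ℝ → ℝ) (P : ℝ → ℝ → ℝ) : Prop where
  F0 : 0 ≤ F x
  Fmono : F x ≤ F (x + σ)
  Fω : F (x + σ) ≤ F x + X ^ 5 / x ^ 3
  Fhi : F x ≤ S.d * (X ^ 4 / x ^ 2)
  Tlo : S.t1 * (X ^ 4 / x) ≤ Θ x
  Thi : Θ x ≤ S.t2 * (X ^ 4 / x)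
  Plo : ∀ Y, 0 ≤ Y → Y ≤ (S.b * X) ^ 3 → S.cs ≤ P x Y
  Phi : ∀ Y, 0 ≤ Y → Y ≤ (S.b * X) ^ 3 → P x Y ≤ S.cs * (1 + S.A * X)

section cons
variable {S : SC} {N : ℕ} {h σ x X : ℝ} {Θ F C : ℝ → ℝ} {P : ℝ → ℝ → ℝ} {R : ℤ → ℝ}

lemma C_lo (G : Gas S C) (H : SmallPt S x X) {Y : ℝ} (h1 : (S.a * X) ^ 3 ≤ Y) (h2 : Y ≤ (S.b * X) ^ 3) :
    S.c1 / X ≤ C Y := by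
  have hX := H.hX; have ha := S.ha; have hb := S.hb
  have h0 : 0 < Y := lt_of_lt_of_le (by positivity) h1
  have := G.anti Y _ h0 h2 H.hY
  have h3 := G.lo (S.b * X) (by positivity) H.hY
  rw [SC.c1, div_div]; linarith

lemma C_hi (G : Gas S C) (H : SmallPt S x X) {Y : ℝ} (h1 : (S.a * X) ^ 3 ≤ Y) (h2 : Y ≤ (S.b * X) ^ 3) :
    C Y ≤ S.c2 / X := by
  have hX := H.hX; have ha := S.ha; have hb := S.hb
  have h3 : (S.a * X) ^ 3 ≤ S.Y0 := h1.trans (h2.trans H.hY)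
  have := G.anti _ Y (by positivity) h1 (h2.trans H.hY)
  have h4 := G.hi (S.a * X) (by positivity) h3
  rw [SC.c2, div_div]; linarith

/-- divided difference -/
lemma C_dd (G : Gas S C) (H : SmallPt S x X) {Y Z : ℝ} (h1 : (S.a * X) ^ 3 ≤ Y) (h2 : Y ≤ (S.b * X) ^ 3)
    (h3 : (S.a * X) ^ 3 ≤ Z) (h4 : Z ≤ (S.b * X) ^ 3) :
    ∃ D, 0 ≤ D ∧ D ≤ S.L / (S.a * X) ^ 4 ∧ C Y - C Z = -D * (Y - Z) := by
  have hX := H.hX; have ha := S.ha; have hb := S.hb; have hL := S.hL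
  have hY : 0 < Y := lt_of_lt_of_le (by positivity) h1
  have hZ : 0 < Z := lt_of_lt_of_le (by positivity) h3
  rcases lt_trichotomy Y Z with hlt | heq | hlt
  · have e1 := G.anti Y Z hY hlt.le (h4.trans H.hY)
    have e2 := G.lip (S.a * X) Y Z (by positivity) h1 hlt.le (h4.trans H.hY)
    have hp : 0 < Z - Y := by linarith
    refine ⟨(C Y - C Z) / (Z - Y), div_nonneg (by linarith) hp.le, ?_, ?_⟩
    · rwa [div_le_iff₀ hp]
    · field_simp; ring
  · refine ⟨0, le_rfl, by positivity, by simp [heq]⟩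
  · have e1 := G.anti Z Y hZ hlt.le (h2.trans H.hY)
    have e2 := G.lip (S.a * X) Z Y (by positivity) h3 hlt.le (h2.trans H.hY)
    have hp : 0 < Y - Z := by linarith
    refine ⟨(C Z - C Y) / (Y - Z), div_nonneg (by linarith) hp.le, ?_, ?_⟩
    · rwa [div_le_iff₀ hp]
    · field_simp; ring

lemma InvR.hYN1 (hN : 1 ≤ N) (I : InvR S N h σ x X Θ F C R) :
    (S.a * X) ^ 3 ≤ Yv R (N - 1) ∧ Yv R (N - 1) ≤ (S.b * X) ^ 3 :=
  ⟨I.Ylo _ (by omega) (by omega), I.Yhi _ (by omega) (by omega)⟩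

lemma gU_bd (hN : 1 ≤ N) (G : Gas S C) (H : SmallPt S x X) (Wp : WallPt S σ x X Θ F P)
    (I : InvR S N h σ x X Θ F C R) :
    0 ≤ gU S N σ x F C R ∧ gU S N σ x F C R ≤ S.Cg * (X ^ 5 / x ^ 2) := by
  obtain ⟨h1, h2⟩ := I.hYN1 hN
  have hC := C_lo G H h1 h2
  have hX := H.hX; have hx := H.hx; have hc1 := S.c1_pos; have hcs := S.hcs
  have hpos : 0 < S.c1 / X := by positivity
  have hF : F (x + σ) ≤ (S.d + 1) * (X ^ 4 / x ^ 2) := by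
    have e1 := Wp.Fω
    have e2 := Wp.Fhi
    have e3 : X ^ 5 / x ^ 3 ≤ X ^ 4 / x ^ 2 := by
      rw [div_le_div_iff₀ (by positivity) (by positivity)]
      have : X ^ 4 * x ^ 2 * X ≤ X ^ 4 * x ^ 2 * x := by
        apply mul_le_mul_of_nonneg_left H.hXx; positivity
      nlinarith
    linarith
  have hF0 : 0 ≤ F (x + σ) := Wp.F0.trans Wp.Fmono
  refine ⟨div_nonneg hF0 (mul_nonneg (hpos.le.trans hC) hcs.le), ?_⟩
  unfold gU
  calc F (x + σ) / (C (Yv R (N - 1)) * S.cs) ≤ F (x + σ) / (S.c1 / X * S.cs) := by gcongr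
    _ ≤ ((S.d + 1) * (X ^ 4 / x ^ 2)) / (S.c1 / X * S.cs) := by gcongr
    _ = _ := by unfold SC.Cg; field_simp

lemma gL_bd (hN : 1 ≤ N) (G : Gas S C) (H : SmallPt S x X) (Wp : WallPt S σ x X Θ F P)
    (I : InvR S N h σ x X Θ F C R) :
    0 ≤ gL S N x X F C R ∧ gL S N x X F C R ≤ S.Cg * (X ^ 5 / x ^ 2) := by
  have hg := gU_bd hN G H Wp I
  obtain ⟨h1, h2⟩ := I.hYN1 hN
  have hC := C_lo G H h1 h2
  have hX := H.hX; have hx := H.hx; have hc1 := S.c1_pos; have hcs := S.hcs; have hA := S.hA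
  have hpos : 0 < S.c1 / X := by positivity
  have hC0 := hpos.trans_le hC
  have hAX := H.hAX
  have hAX0 : 0 ≤ S.A * X := by positivity
  refine ⟨div_nonneg (mul_nonneg Wp.F0 (by linarith)) (by positivity), le_trans ?_ hg.2⟩
  unfold gL gU
  have : F x * (1 - 2 * S.A * X) ≤ F (x + σ) := by
    have := Wp.F0; have := Wp.Fmono
    nlinarith
  gcongr

lemma wI_bd (hN : 1 ≤ N) {i : ℤ} (h1 : -(N : ℤ) < i) (h2 : i ≤ N) : -1 ≤ wI N i ∧ wI N i ≤ 1 := by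
  have hN' : (0 : ℝ) < N := by exact_mod_cast hN
  have h1' : (-(N : ℤ) + 1 : ℤ) ≤ i := by omega
  have h1'' : (-(N : ℝ) + 1) ≤ i := by exact_mod_cast h1'
  have h2' : (i : ℝ) ≤ N := by exact_mod_cast h2
  unfold wI
  constructor
  · rw [le_div_iff₀ hN']; linarith
  · rw [div_le_iff₀ hN']; linarith

lemma wI_refl (i : ℤ) : wI N (1 - i) = -wI N i := by
  unfold wI; push_cast; ring

lemma wI_pred (i : ℤ) : wI N (i - 1) = wI N i - 1 / N := by
  unfold wI; push_cast; ring

/-- crude bounds on the slopes -/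
lemma slope_bd (hN : 1 ≤ N) (hh : h = S.m / N) (G : Gas S C) (H : SmallPt S x X)
    (Wp : WallPt S σ x X Θ F P)
    (I : InvR S N h σ x X Θ F C R) {i : ℤ} (h1 : -(N : ℤ) < i) (h2 : i ≤ N) :
    S.v1 * (X ^ 4 / x) * h ≤ R i - R (i - 1) ∧ R i - R (i - 1) ≤ S.v2 * (X ^ 4 / x) * h := by
  have hN' : (0 : ℝ) < N := by exact_mod_cast hN
  have hm := S.hm
  have hh0 : 0 < h := by rw [hh]; positivity
  have hw := wI_bd hN h1 h2
  have hgU := gU_bd hN G H Wp I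
  have hgL := gL_bd hN G H Wp I
  have hX := H.hX; have hx := H.hx
  have hq : 0 < X ^ 4 / x := by positivity
  have e0 : X ^ 5 / x ^ 2 = (X / x) * (X ^ 4 / x) := by field_simp
  have eT : Θ x / N = Θ x / S.m * h := by rw [hh]; field_simp
  have hGc : S.Gc * (X ^ 5 / x ^ 2) ≤ S.t1 / (2 * S.m) * (X ^ 4 / x) := by
    rw [e0, ← mul_assoc]; exact mul_le_mul_of_nonneg_right H.hE hq.le
  have hGc' : S.E * (X ^ 5 / x ^ 2) + 2 * (S.Cg * (X ^ 5 / x ^ 2)) = S.Gc * (X ^ 5 / x ^ 2) := by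
    unfold SC.Gc; ring
  have b1 : gU S N σ x F C R * (1 - wI N i) ≤ 2 * (S.Cg * (X ^ 5 / x ^ 2)) := by nlinarith
  have b2 : gL S N x X F C R * (1 + wI N i) ≤ 2 * (S.Cg * (X ^ 5 / x ^ 2)) := by nlinarith
  have T1 : S.t1 / S.m * (X ^ 4 / x) ≤ Θ x / S.m := by
    rw [div_mul_eq_mul_div]; exact div_le_div_of_nonneg_right Wp.Tlo hm.le
  have T2 : Θ x / S.m ≤ S.t2 / S.m * (X ^ 4 / x) := by
    rw [div_mul_eq_mul_div]; exact div_le_div_of_nonneg_right Wp.Thi hm.le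
  have e2 : S.t1 / (2 * S.m) = S.t1 / S.m / 2 := by field_simp
  have ht12 : S.t1 / S.m * (X ^ 4 / x) ≤ S.t2 / S.m * (X ^ 4 / x) := by
    have := S.ht12; gcongr
  have e3 : S.v1 = S.t1 / S.m / 2 := by unfold SC.v1; field_simp
  have e4 : S.v2 = 2 * (S.t2 / S.m) := by unfold SC.v2; field_simp
  have ht1p : 0 ≤ S.t1 / S.m * (X ^ 4 / x) := by have := S.ht1; positivity
  rw [e2] at hGc
  constructor
  · refine le_trans ?_ (I.dn i h1 h2)
    rw [eT, e3]
    have : S.t1 / S.m / 2 * (X ^ 4 / x) ≤ Θ x / S.m -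
      (S.E * (X ^ 5 / x ^ 2) + gL S N x X F C R * (1 + wI N i)) := by nlinarith
    nlinarith
  · refine le_trans (I.up i h1 h2) ?_
    rw [eT, e4]
    have : Θ x / S.m +
      (S.E * (X ^ 5 / x ^ 2) + gU S N σ x F C R * (1 - wI N i)) ≤ 2 * (S.t2 / S.m) * (X ^ 4 / x) := by nlinarith
    nlinarith

/-- difference of Y -/
lemma Ydiff_bd (hN : 1 ≤ N) (hh : h = S.m / N) (G : Gas S C) (H : SmallPt S x X)
    (Wp : WallPt S σ x X Θ F P)
    (I : InvR S N h σ x X Θ F C R) {i : ℤ} (h1 : -(N : ℤ) < i) (h2 : i ≤ N) :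
    |Yv R i - Yv R (i - 1)| ≤ h * (S.Gc * (X ^ 5 / x ^ 2)) := by
  have hN' : (0 : ℝ) < N := by exact_mod_cast hN
  have hm := S.hm
  have hh0 : 0 < h := by rw [hh]; positivity
  have hw := wI_bd hN h1 h2
  have hgU := gU_bd hN G H Wp I
  have hgL := gL_bd hN G H Wp I
  rw [Yv_sub]
  have u1 := I.up i h1 h2
  have u2 := I.up (1 - i) (by omega) (by omega)
  have l1 := I.dn i h1 h2
  have l2 := I.dn (1 - i) (by omega) (by omega)
  rw [wI_refl] at u2 l2
  have b1 : gU S N σ x F C R * (1 - wI N i) ≤ 2 * (S.Cg * (X ^ 5 / x ^ 2)) := by nlinarith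
  have b2 : gL S N x X F C R * (1 + wI N i) ≤ 2 * (S.Cg * (X ^ 5 / x ^ 2)) := by nlinarith
  have b3 : gU S N σ x F C R * (1 - -wI N i) ≤ 2 * (S.Cg * (X ^ 5 / x ^ 2)) := by nlinarith
  have b4 : gL S N x X F C R * (1 + -wI N i) ≤ 2 * (S.Cg * (X ^ 5 / x ^ 2)) := by nlinarith
  have hGc' : S.Gc * (X ^ 5 / x ^ 2) = S.E * (X ^ 5 / x ^ 2) + 2 * (S.Cg * (X ^ 5 / x ^ 2)) := by
    unfold SC.Gc; ring
  rw [hGc', abs_le]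
  generalize S.E * (X ^ 5 / x ^ 2) = e at *
  generalize S.Cg * (X ^ 5 / x ^ 2) = c at *
  have B1 := mul_le_mul_of_nonneg_left b1 hh0.le
  have B2 := mul_le_mul_of_nonneg_left b2 hh0.le
  have B3 := mul_le_mul_of_nonneg_left b3 hh0.le
  have B4 := mul_le_mul_of_nonneg_left b4 hh0.le
  constructor <;> nlinarith

lemma Yosc_bd (hN : 1 ≤ N) (hh : h = S.m / N) (G : Gas S C) (H : SmallPt S x X)
    (Wp : WallPt S σ x X Θ F P)
    (I : InvR S N h σ x X Θ F C R) (i : ℤ) (h1 : -(N : ℤ) ≤ i) (k : ℕ) (h2 : i + k ≤ N) :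
    |Yv R (i + k) - Yv R i| ≤ k * (h * (S.Gc * (X ^ 5 / x ^ 2))) := by
  induction k with
  | zero => simp
  | succ k ih =>
    have a1 := ih (by push_cast at h2; omega)
    have a2 := Ydiff_bd hN hh G H Wp I (i := i + (k + 1 : ℕ)) (by push_cast; omega) h2
    have e : i + ((k + 1 : ℕ) : ℤ) - 1 = i + k := by push_cast; ring
    rw [e] at a2
    have := abs_sub_le (Yv R (i + (k + 1 : ℕ))) (Yv R (i + k)) (Yv R i)
    push_cast at *
    linarith

lemma Yosc (hN : 1 ≤ N) (hh : h = S.m / N) (G : Gas S C) (H : SmallPt S x X)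
    (Wp : WallPt S σ x X Θ F P)
    (I : InvR S N h σ x X Θ F C R) {i j : ℤ} (h1 : -(N : ℤ) ≤ i) (h2 : i ≤ N)
    (h3 : -(N : ℤ) ≤ j) (h4 : j ≤ N) :
    |Yv R i - Yv R j| ≤ 2 * S.m * S.Gc * (X ^ 5 / x ^ 2) := by
  have hN' : (0 : ℝ) < N := by exact_mod_cast hN
  have hm := S.hm
  have hh0 : 0 < h := by rw [hh]; positivity
  have hGc := S.Gc_pos
  have hX := H.hX; have hx := H.hx
  wlog hij : j ≤ i generalizing i j
  · rw [abs_sub_comm]; exact this h3 h4 h1 h2 (by omega)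
  obtain ⟨k, rfl⟩ : ∃ k : ℕ, i = j + k := ⟨(i - j).toNat, by omega⟩
  refine (Yosc_bd hN hh G H Wp I j h3 k h2).trans ?_
  have hk : (k : ℝ) ≤ 2 * N := by
    have : (k : ℤ) ≤ 2 * N := by omega
    exact_mod_cast this
  calc (k : ℝ) * (h * (S.Gc * (X ^ 5 / x ^ 2))) ≤ (2 * N) * (h * (S.Gc * (X ^ 5 / x ^ 2))) := by gcongr
    _ = _ := by rw [hh]; field_simp

/-- ratio of wave speeds -/
lemma ratio_bd (hN : 1 ≤ N) (hh : h = S.m / N) (G : Gas S C) (H : SmallPt S x X)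
    (Wp : WallPt S σ x X Θ F P)
    (I : InvR S N h σ x X Θ F C R) {i : ℤ} (h1 : -(N : ℤ) ≤ i) (h2 : i ≤ N) :
    |C (Yv R i) / C (Yv R (N - 1)) - 1| ≤ 1 / 2 * (X / x) := by
  obtain ⟨y1, y2⟩ := I.hYN1 hN
  obtain ⟨D, hD0, hD1, hD⟩ := C_dd G H (I.Ylo i h1 h2) (I.Yhi i h1 h2) y1 y2
  have hC := C_lo G H y1 y2
  have hX := H.hX; have hx := H.hx; have hc1 := S.c1_pos; have hm := S.hm; have hGc := S.Gc_pos
  have ha := S.ha; have hL := S.hL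
  have hpos : 0 < S.c1 / X := by positivity
  have hC0 := hpos.trans_le hC
  have hY := Yosc hN hh G H Wp I h1 h2 (j := N - 1) (by omega) (by omega)
  have e : C (Yv R i) / C (Yv R (N - 1)) - 1 = (C (Yv R i) - C (Yv R (N - 1))) / C (Yv R (N - 1)) := by
    field_simp
  rw [e, abs_div, abs_of_pos hC0, hD, abs_mul, abs_neg, abs_of_nonneg hD0]
  calc D * |Yv R i - Yv R (N - 1)| / C (Yv R (N - 1)) ≤
      (S.L / (S.a * X) ^ 4) * (2 * S.m * S.Gc * (X ^ 5 / x ^ 2)) / (S.c1 / X) := by gcongr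
    _ = S.r0 * (X / x) * (X / x) := by unfold SC.r0; field_simp
    _ ≤ _ := by
      apply mul_le_mul_of_nonneg_right H.hr; positivity

end cons
end

section
structure StepPt (S : SC) (h σ x X X' : ℝ) (Θ F : ℝ → ℝ) : Prop where
  hσ : 0 < σ
  X3lo : X ^ 3 * (1 + 3 * (σ / x)) ≤ X' ^ 3
  X3hi : X' ^ 3 ≤ X ^ 3 * (1 + 6 * S.μ * (σ / x))
  hp : X ^ 5 / x ^ 2 + σ * (X ^ 5 / x ^ 3) ≤ X' ^ 5 / (x + σ) ^ 2
  hX1 : X' ≤ X * (1 + 2 * S.μ * (σ / x))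
  hXX : X ≤ X'
  cfl : σ / h * (2 * S.cs * S.c2 / X) + σ * (S.k0 / x) ≤ 1
  mono : σ * (2 * S.cs * (S.v2 + 1) * S.L / (S.a ^ 4 * x)) ≤ 1
  hAX' : S.A * X' ≤ 1 / 2
  T1 : (1 - S.A * X) * (σ * F x) ≤ Θ (x + σ) - Θ x
  T2 : Θ (x + σ) - Θ x ≤ σ * F (x + σ)
  F2 : F (x + σ) ≤ F (x + σ + σ)

section step
variable {S : SC} {N : ℕ} {h σ x X X' : ℝ} {Θ F C : ℝ → ℝ} {P : ℝ → ℝ → ℝ} {R : ℤ → ℝ}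

lemma stepR_ne {i : ℤ} (hi : i ≠ -(N : ℤ)) : stepR N h σ x Θ C P R i =
    R i - σ / h * (P x (Yv R N) * C (Yv R i)) * (R i - R (i - 1)) := by
  simp [stepR, hi]

lemma stepR_neg (hN : 1 ≤ N) : stepR N h σ x Θ C P R (-N) =
    stepR N h σ x Θ C P R N - 2 * Θ (x + σ) := by
  rw [stepR_ne (i := N) (by omega)]
  simp [stepR]

lemma P_bd (hN : 1 ≤ N) (H : SmallPt S x X) (Wp : WallPt S σ x X Θ F P)
    (I : InvR S N h σ x X Θ F C R) : S.cs ≤ P x (Yv R N) ∧ P x (Yv R N) ≤ S.cs * (1 + S.A * X) ∧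
      P x (Yv R N) ≤ 2 * S.cs := by
  have hX := H.hX; have ha := S.ha
  have h1 := I.Ylo N (by omega) (by omega)
  have h2 := I.Yhi N (by omega) (by omega)
  have h0 : 0 ≤ Yv R N := le_trans (by positivity) h1
  have h3 := Wp.Phi _ h0 h2
  refine ⟨Wp.Plo _ h0 h2, h3, ?_⟩
  have := H.hAX; have := S.hcs
  nlinarith

noncomputable def nuI (N : ℕ) (h σ x : ℝ) (C : ℝ → ℝ) (P : ℝ → ℝ → ℝ) (R : ℤ → ℝ) (i : ℤ) : ℝ :=
  σ / h * (P x (Yv R N) * C (Yv R i))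

lemma nu_bd (hN : 1 ≤ N) (hh : h = S.m / N) (hσ : 0 < σ) (G : Gas S C) (H : SmallPt S x X) (Wp : WallPt S σ x X Θ F P)
    (I : InvR S N h σ x X Θ F C R) {i : ℤ} (h1 : -(N : ℤ) ≤ i) (h2 : i ≤ N) :
    0 ≤ nuI N h σ x C P R i ∧ nuI N h σ x C P R i ≤ σ / h * (2 * S.cs * S.c2 / X) := by
  have hN' : (0 : ℝ) < N := by exact_mod_cast hN
  have hm := S.hm
  have hh0 : 0 < h := by rw [hh]; positivity
  obtain ⟨p1, p2, p3⟩ := P_bd hN H Wp I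
  have hX := H.hX; have hcs := S.hcs; have hc1 := S.c1_pos
  have l1 := C_lo G H (I.Ylo i h1 h2) (I.Yhi i h1 h2)
  have l2 := C_hi G H (I.Ylo i h1 h2) (I.Yhi i h1 h2)
  have hpos : 0 < S.c1 / X := by positivity
  have hC0 := hpos.trans_le l1
  have hP0 := hcs.trans_le p1
  unfold nuI
  refine ⟨by positivity, ?_⟩
  rw [mul_div_assoc (2 * S.cs)]
  gcongr

/-- one step: nonneg coefficient form -/
lemma step_comb (hN : 1 ≤ N) (hh : h = S.m / N) (hσ : 0 < σ) (G : Gas S C) (H : SmallPt S x X)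
    (Wp : WallPt S σ x X Θ F P)
    (I : InvR S N h σ x X Θ F C R) {i : ℤ} (h1 : -(N : ℤ) < i) (h2 : i ≤ N)
    (dp : ℝ) (hdp1 : 0 ≤ dp) (hdp2 : dp ≤ S.v2 * (X ^ 4 / x) * h) :
    ∃ κ, 0 ≤ κ ∧ κ ≤ σ * (S.k0 / x) ∧
      (1 - nuI N h σ x C P R i) * (R i - R (i - 1)) + nuI N h σ x C P R (i - 1) * dp =
      (1 - nuI N h σ x C P R i - κ) * (R i - R (i - 1)) + nuI N h σ x C P R i * dp
        + κ * (R (1 - i) - R (1 - i - 1)) := by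
  have hN' : (0 : ℝ) < N := by exact_mod_cast hN
  have hm := S.hm
  have hh0 : 0 < h := by rw [hh]; positivity
  obtain ⟨p1, p2, p3⟩ := P_bd hN H Wp I
  have hX := H.hX; have hx := H.hx; have hcs := S.hcs; have ha := S.ha; have hL := S.hL; have hv2 := S.v2_pos
  have hP0 := hcs.trans_le p1
  obtain ⟨D, hD0, hD1, hD⟩ := C_dd G H (I.Ylo i h1.le h2) (I.Yhi i h1.le h2)
    (I.Ylo (i - 1) (by omega) (by omega)) (I.Yhi (i - 1) (by omega) (by omega))
  refine ⟨σ / h * P x (Yv R N) * D * dp / 2, by positivity, ?_, ?_⟩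
  · calc σ / h * P x (Yv R N) * D * dp / 2 ≤
        σ / h * (2 * S.cs) * (S.L / (S.a * X) ^ 4) * (S.v2 * (X ^ 4 / x) * h) / 2 := by gcongr
      _ = _ := by unfold SC.k0; field_simp
  · have e : nuI N h σ x C P R i - nuI N h σ x C P R (i - 1) =
        σ / h * P x (Yv R N) * D / 2 * ((R i - R (i - 1)) - (R (1 - i) - R (1 - i - 1))) := by
      unfold nuI
      have : σ / h * (P x (Yv R N) * C (Yv R i)) - σ / h * (P x (Yv R N) * C (Yv R (i - 1))) =
        σ / h * P x (Yv R N) * (C (Yv R i) - C (Yv R (i - 1))) := by ring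
      rw [this, hD, Yv_sub]; ring
    linear_combination (-dp) * e

lemma step_d (hN : 1 ≤ N) (hh : h = S.m / N) (hσ : 0 < σ) (G : Gas S C) (H : SmallPt S x X)
    (Wp : WallPt S σ x X Θ F P)
    (I : InvR S N h σ x X Θ F C R) {i : ℤ} (h1 : -(N : ℤ) + 1 < i) (h2 : i ≤ N) :
    ∃ κ, 0 ≤ κ ∧ κ ≤ σ * (S.k0 / x) ∧
      stepR N h σ x Θ C P R i - stepR N h σ x Θ C P R (i - 1) =
      (1 - nuI N h σ x C P R i - κ) * (R i - R (i - 1)) + nuI N h σ x C P R i * (R (i - 1) - R (i - 1 - 1))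
        + κ * (R (1 - i) - R (1 - i - 1)) := by
  have hs := slope_bd hN hh G H Wp I (i := i - 1) (by omega) (by omega)
  have h0 : 0 ≤ S.v1 * (X ^ 4 / x) * h := by
    have hN' : (0 : ℝ) < N := by exact_mod_cast hN
    have hm := S.hm; have := S.v1_pos; have := H.hX; have := H.hx
    rw [hh]; positivity
  obtain ⟨κ, k1, k2, k3⟩ := step_comb hN hh hσ G H Wp I (i := i) (by omega) h2 _ (h0.trans hs.1) hs.2
  refine ⟨κ, k1, k2, ?_⟩
  rw [← k3, stepR_ne (by omega), stepR_ne (by omega)]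
  unfold nuI; ring

lemma step_d0 (hN : 1 ≤ N) (hh : h = S.m / N) (hσ : 0 < σ) (G : Gas S C) (H : SmallPt S x X)
    (Wp : WallPt S σ x X Θ F P)
    (I : InvR S N h σ x X Θ F C R) {i : ℤ} (hi : i = -(N : ℤ) + 1) :
    ∃ κ, 0 ≤ κ ∧ κ ≤ σ * (S.k0 / x) ∧
      stepR N h σ x Θ C P R i - stepR N h σ x Θ C P R (i - 1) =
      (1 - nuI N h σ x C P R i - κ) * (R i - R (i - 1)) + nuI N h σ x C P R i * (R N - R (N - 1))
        + κ * (R N - R (N - 1)) + 2 * (Θ (x + σ) - Θ x) := by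
  have hs := slope_bd hN hh G H Wp I (i := N) (by omega) (by omega)
  have h0 : 0 ≤ S.v1 * (X ^ 4 / x) * h := by
    have hN' : (0 : ℝ) < N := by exact_mod_cast hN
    have hm := S.hm; have := S.v1_pos; have := H.hX; have := H.hx
    rw [hh]; positivity
  obtain ⟨κ, k1, k2, k3⟩ := step_comb hN hh hσ G H Wp I (i := i) (by omega) (by omega) _ (h0.trans hs.1) hs.2
  refine ⟨κ, k1, k2, ?_⟩
  have e1 : 1 - i = N := by omega
  have e2 : i - 1 = -(N : ℤ) := by omega
  rw [e1] at k3
  rw [← k3, e2, stepR_neg hN, stepR_ne (i := i) (by omega), stepR_ne (i := N) (by omega), e2, I.bc]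
  have e3 : nuI N h σ x C P R (-(N : ℤ)) = nuI N h σ x C P R N := by
    unfold nuI; rw [Yv_neg]
  rw [e3]
  unfold nuI; ring

/-- Y step -/
lemma step_Y (hN : 1 ≤ N) (hh : h = S.m / N) (G : Gas S C) (H : SmallPt S x X)
    (Wp : WallPt S σ x X Θ F P) (St : StepPt S h σ x X X' Θ F)
    (I : InvR S N h σ x X Θ F C R) {i : ℤ} (h1 : -(N : ℤ) ≤ i) (h2 : i ≤ N) :
    ∃ W, S.v1 * (X ^ 4 / x) ≤ W ∧ W ≤ (S.v2 + 1) * (X ^ 4 / x) ∧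
      Yv (stepR N h σ x Θ C P R) i = Yv R i + σ * P x (Yv R N) * W * C (Yv R i) := by
  have hN' : (0 : ℝ) < N := by exact_mod_cast hN
  have hm := S.hm
  have hh0 : 0 < h := by rw [hh]; positivity
  have hX := H.hX; have hx := H.hx; have hcs := S.hcs
  have hq : 0 < X ^ 4 / x := by positivity
  wlog hi : 0 ≤ i generalizing i
  · obtain ⟨W, w1, w2, w3⟩ := this (i := -i) (by omega) (by omega) (by omega)
    exact ⟨W, w1, w2, by simpa only [Yv_neg] using w3⟩
  have s1 := slope_bd hN hh G H Wp I (i := i) (by omega) h2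
  rcases eq_or_lt_of_le h2 with rfl | hlt
  · obtain ⟨p1, p2, p3⟩ := P_bd hN H Wp I
    have l1 := C_lo G H (I.Ylo N h1 h2) (I.Yhi N h1 h2)
    have hc1 := S.c1_pos
    have hpos : 0 < S.c1 / X := by positivity
    have hC0 := hpos.trans_le l1
    have hP0 := hcs.trans_le p1
    have hσ := St.hσ
    have hΔ : 0 ≤ Θ (x + σ) - Θ x := by
      refine le_trans ?_ St.T1
      have := H.hAX; have := Wp.F0
      exact mul_nonneg (by linarith) (by positivity)
    refine ⟨(R N - R (N - 1)) / h + (Θ (x + σ) - Θ x) / (σ * P x (Yv R N) * C (Yv R N)), ?_, ?_, ?_⟩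
    · have : S.v1 * (X ^ 4 / x) ≤ (R N - R (N - 1)) / h := by rw [le_div_iff₀ hh0]; exact s1.1
      have : 0 ≤ (Θ (x + σ) - Θ x) / (σ * P x (Yv R N) * C (Yv R N)) := by positivity
      linarith
    · have e1 : (R N - R (N - 1)) / h ≤ S.v2 * (X ^ 4 / x) := by rw [div_le_iff₀ hh0]; exact s1.2
      have hF : F (x + σ) ≤ (S.d + 1) * (X ^ 4 / x ^ 2) := by
        have e1 := Wp.Fω
        have e2 := Wp.Fhi
        have e3 : X ^ 5 / x ^ 3 ≤ X ^ 4 / x ^ 2 := by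
          rw [div_le_div_iff₀ (by positivity) (by positivity)]
          have : X ^ 4 * x ^ 2 * X ≤ X ^ 4 * x ^ 2 * x := by
            apply mul_le_mul_of_nonneg_left H.hXx; positivity
          nlinarith
        linarith
      have hd := S.hd
      have e2 : (Θ (x + σ) - Θ x) / (σ * P x (Yv R N) * C (Yv R N)) ≤
          (σ * ((S.d + 1) * (X ^ 4 / x ^ 2))) / (σ * S.cs * (S.c1 / X)) := by
        have : Θ (x + σ) - Θ x ≤ σ * ((S.d + 1) * (X ^ 4 / x ^ 2)) :=
          St.T2.trans (by gcongr)
        gcongr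
      have e3 : (σ * ((S.d + 1) * (X ^ 4 / x ^ 2))) / (σ * S.cs * (S.c1 / X)) =
          ((S.d + 1) / (S.cs * S.c1) * (X / x)) * (X ^ 4 / x) := by
        field_simp
      have e4 := mul_le_mul_of_nonneg_right H.hW hq.le
      linarith
    · unfold Yv
      rw [stepR_neg hN, stepR_ne (i := N) (by omega), I.bc]
      have hY : -(R N + (R N - 2 * Θ x)) / 2 = Yv R N := by unfold Yv; rw [I.bc]
      rw [hY]
      have hne : P x (Yv R N) ≠ 0 := hP0.ne'
      have hne2 : C (Yv R N) ≠ 0 := hC0.ne'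
      have hY2 : Yv R N = -R N + Θ x := by rw [← hY]; ring
      generalize P x (Yv R N) = p at *
      generalize C (Yv R N) = c at *
      rw [hY2]
      field_simp
      ring
  · have s2 := slope_bd hN hh G H Wp I (i := -i) (by omega) (by omega)
    refine ⟨((R i - R (i - 1)) + (R (-i) - R (-i - 1))) / 2 / h, ?_, ?_, ?_⟩
    · rw [le_div_iff₀ hh0]; linarith [s1.1, s2.1]
    · rw [div_le_iff₀ hh0]; nlinarith [s1.2, s2.2]
    · have e := Yv_neg R i
      unfold Yv
      rw [stepR_ne (by omega), stepR_ne (by omega), e]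
      have hY : -(R i + R (-i)) / 2 = Yv R i := rfl
      have hYN : -(R N + R (-N)) / 2 = Yv R N := rfl
      rw [hY, hYN]
      have hY2 : Yv R i = -(R i + R (-i)) / 2 := rfl
      generalize P x (Yv R N) = p at *
      generalize C (Yv R i) = c at *
      rw [hY2]
      field_simp
      ring

lemma step_Ybd (hN : 1 ≤ N) (hh : h = S.m / N) (G : Gas S C) (H : SmallPt S x X)
    (Wp : WallPt S σ x X Θ F P) (St : StepPt S h σ x X X' Θ F)
    (I : InvR S N h σ x X Θ F C R) {i : ℤ} (h1 : -(N : ℤ) ≤ i) (h2 : i ≤ N) :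
    (S.a * X') ^ 3 ≤ Yv (stepR N h σ x Θ C P R) i ∧
    Yv (stepR N h σ x Θ C P R) i ≤ (S.b * X') ^ 3 ∧
    Yv R i ≤ Yv (stepR N h σ x Θ C P R) i := by
  obtain ⟨W, w1, w2, w3⟩ := step_Y hN hh G H Wp St I h1 h2
  obtain ⟨p1, p2, p3⟩ := P_bd hN H Wp I
  have hX := H.hX; have hx := H.hx; have hcs := S.hcs; have ha := S.ha; have hb := S.hb
  have hL := S.hL; have hσ := St.hσ; have hv1 := S.v1_pos; have hv2 := S.v2_pos
  have hq : 0 < X ^ 4 / x := by positivity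
  have hP0 := hcs.trans_le p1
  have hW0 : 0 < W := lt_of_lt_of_le (by positivity) w1
  have Y1 := I.Ylo i h1 h2
  have Y2 := I.Yhi i h1 h2
  have haX : 0 < S.a * X := by positivity
  have haY0 : (S.a * X) ^ 3 ≤ S.Y0 := Y1.trans (Y2.trans H.hY)
  set β := σ * P x (Yv R N) * W with hβ
  have hβ0 : 0 < β := by positivity
  have hβ1 : β * (S.L / (S.a * X) ^ 4) ≤ 1 := by
    calc β * (S.L / (S.a * X) ^ 4) ≤ (σ * (2 * S.cs) * ((S.v2 + 1) * (X ^ 4 / x))) * (S.L / (S.a * X) ^ 4) := by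
          rw [hβ]; gcongr
      _ = σ * (2 * S.cs * (S.v2 + 1) * S.L / (S.a ^ 4 * x)) := by field_simp
      _ ≤ 1 := St.mono
  have hlip : ∀ y z, (S.a * X) ^ 3 ≤ y → y ≤ z → z ≤ S.Y0 → y + β * C y ≤ z + β * C z := by
    intro y z hy hyz hz
    have := G.lip (S.a * X) y z haX hy hyz hz
    have e := mul_le_mul_of_nonneg_left this hβ0.le
    have e2 : β * (S.L / (S.a * X) ^ 4 * (z - y)) ≤ 1 * (z - y) := by
      rw [← mul_assoc]; exact mul_le_mul_of_nonneg_right hβ1 (by linarith)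
    linarith
  rw [w3]
  have hC0 : 0 < C (Yv R i) := lt_of_lt_of_le (by have := S.c1_pos; positivity) (C_lo G H Y1 Y2)
  refine ⟨?_, ?_, by have := mul_pos hβ0 hC0; linarith⟩
  · refine le_trans ?_ (hlip _ _ le_rfl Y1 (Y2.trans H.hY))
    have c := G.lo (S.a * X) haX haY0
    have hca := S.hca
    have e1 : (S.a * X') ^ 3 ≤ S.a ^ 3 * (X ^ 3 * (1 + 6 * S.μ * (σ / x))) := by
      rw [mul_pow]; have := St.X3hi; gcongr
    have e2 : σ * S.cs * (S.v1 * (X ^ 4 / x)) * (S.ca / (S.a * X)) ≤ β * C ((S.a * X) ^ 3) := by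
      rw [hβ]; gcongr
    have e3 : S.a ^ 3 * (X ^ 3 * (6 * S.μ * (σ / x))) ≤ σ * S.cs * (S.v1 * (X ^ 4 / x)) * (S.ca / (S.a * X)) := by
      have e4 : S.a ^ 3 * (X ^ 3 * (6 * S.μ * (σ / x))) = (6 * S.μ * S.a ^ 4) * (σ * X ^ 3 / (x * S.a)) := by
        field_simp
      have e5 : σ * S.cs * (S.v1 * (X ^ 4 / x)) * (S.ca / (S.a * X)) =
          (S.cs * S.v1 * S.ca) * (σ * X ^ 3 / (x * S.a)) := by field_simp
      rw [e4, e5]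
      exact mul_le_mul_of_nonneg_right S.ha4 (by positivity)
    nlinarith
  · refine le_trans (hlip _ _ Y1 Y2 H.hY) ?_
    have c := G.hi (S.b * X) (by positivity) H.hY
    have hcb := S.hcb
    have e1 : S.b ^ 3 * (X ^ 3 * (1 + 3 * (σ / x))) ≤ (S.b * X') ^ 3 := by
      rw [mul_pow]; have := St.X3lo; gcongr
    have e2 : β * C ((S.b * X) ^ 3) ≤ σ * (2 * S.cs) * ((S.v2 + 1) * (X ^ 4 / x)) * (S.cb / (S.b * X)) := by
      have : 0 ≤ S.cb / (S.b * X) := by positivity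
      calc β * C ((S.b * X) ^ 3) ≤ β * (S.cb / (S.b * X)) := by gcongr
        _ ≤ _ := by rw [hβ]; gcongr
    have e3 : σ * (2 * S.cs) * ((S.v2 + 1) * (X ^ 4 / x)) * (S.cb / (S.b * X)) ≤
        S.b ^ 3 * (X ^ 3 * (3 * (σ / x))) := by
      have e4 : S.b ^ 3 * (X ^ 3 * (3 * (σ / x))) = (3 * S.b ^ 4) * (σ * X ^ 3 / (x * S.b)) := by
        field_simp
      have e5 : σ * (2 * S.cs) * ((S.v2 + 1) * (X ^ 4 / x)) * (S.cb / (S.b * X)) =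
          (2 * S.cs * (S.v2 + 1) * S.cb) * (σ * X ^ 3 / (x * S.b)) := by field_simp
      rw [e4, e5]
      exact mul_le_mul_of_nonneg_right S.hb4 (by positivity)
    nlinarith
end step
end

section
section alg
lemma comb_le {n k u1 u2 u3 d1 d2 d3 : ℝ} (hn : 0 ≤ n) (hk : 0 ≤ k) (hnk : n + k ≤ 1)
    (h1 : d1 ≤ u1) (h2 : d2 ≤ u2) (h3 : d3 ≤ u3) :
    (1 - n - k) * d1 + n * d2 + k * d3 ≤ (1 - n - k) * u1 + n * u2 + k * u3 := by
  have : 0 ≤ 1 - n - k := by linarith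
  gcongr

lemma up_int_alg {N : ℝ} (hN : 0 < N) {h m T T' e e' g g' w n k sc : ℝ} (hh : h = m / N) (hm : 0 < m)
    (hw : w ≤ 1) (hk : 0 ≤ k) (hg : 0 ≤ g) (hgg : g ≤ g') (hsc : n * h = sc)
    (key : sc * g + 2 * k * m * g ≤ (T' - T) + m * (e' - e)) :
    (1 - n - k) * (T / N + h * (e + g * (1 - w))) + n * (T / N + h * (e + g * (1 - (w - 1 / N))))
      + k * (T / N + h * (e + g * (1 - -w))) ≤ T' / N + h * (e' + g' * (1 - w)) := by
  have hh0 : 0 < h := by rw [hh]; positivity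
  have e1 : (1 - n - k) * (T / N + h * (e + g * (1 - w))) + n * (T / N + h * (e + g * (1 - (w - 1 / N))))
      + k * (T / N + h * (e + g * (1 - -w))) = T / N + h * e + h * g * (1 - w) + (n * h) * g / N + 2 * k * w * h * g := by
    field_simp; ring
  have e2 : h * g * (1 - w) ≤ h * g' * (1 - w) := by
    have : 0 ≤ 1 - w := by linarith
    gcongr
  have e3 : 2 * k * w * h * g ≤ 2 * k * h * g := by
    have : 0 ≤ 2 * k * h * g := by positivity
    nlinarith
  have e4 : (sc * g + 2 * k * m * g) / N ≤ ((T' - T) + m * (e' - e)) / N :=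
    div_le_div_of_nonneg_right key hN.le
  have e5 : (sc * g + 2 * k * m * g) / N = sc * g / N + 2 * k * h * g := by rw [hh]; field_simp
  have e6 : ((T' - T) + m * (e' - e)) / N = T' / N - T / N + h * e' - h * e := by rw [hh]; field_simp; ring
  rw [e1, hsc]
  nlinarith

lemma dn_int_alg {N : ℝ} (hN : 0 < N) {h m T T' e e' g g' w n k sc ls : ℝ} (hh : h = m / N) (hm : 0 < m)
    (hw : w ≤ 1) (hw0 : -1 ≤ w) (hk : 0 ≤ k) (hg : 0 ≤ g) (hl : 0 ≤ ls) (hgg : g - ls ≤ g') (hsc : n * h = sc)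
    (key : (T' - T) - m * (e' - e) + 2 * m * ls + 2 * k * m * g ≤ sc * g) :
    T' / N - h * (e' + g' * (1 + w)) ≤
    (1 - n - k) * (T / N - h * (e + g * (1 + w))) + n * (T / N - h * (e + g * (1 + (w - 1 / N))))
      + k * (T / N - h * (e + g * (1 + -w))) := by
  have hh0 : 0 < h := by rw [hh]; positivity
  have e1 : (1 - n - k) * (T / N - h * (e + g * (1 + w))) + n * (T / N - h * (e + g * (1 + (w - 1 / N))))
      + k * (T / N - h * (e + g * (1 + -w))) = T / N - h * e - h * g * (1 + w) + (n * h) * g / N + 2 * k * w * h * g := by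
    field_simp; ring
  have e2 : h * (g - ls) * (1 + w) ≤ h * g' * (1 + w) := by
    have : 0 ≤ 1 + w := by linarith
    gcongr
  have e2' : h * ls * (1 + w) ≤ 2 * h * ls := by
    have : 0 ≤ h * ls := by positivity
    nlinarith
  have e3 : -(2 * k * h * g) ≤ 2 * k * w * h * g := by
    have : 0 ≤ 2 * k * h * g := by positivity
    nlinarith
  have e4 := div_le_div_of_nonneg_right key hN.le
  have e5 : ((T' - T) - m * (e' - e) + 2 * m * ls + 2 * k * m * g) / N =
     T' / N - T / N - h * e' + h * e + 2 * h * ls + 2 * k * h * g := by rw [hh]; field_simp; ring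
  rw [e1, hsc]
  nlinarith

lemma up_bd_alg {N : ℝ} (hN : 1 ≤ N) {h T T' e e' g g' n k sc : ℝ} (hh : 0 < h)
    (hk : 0 ≤ k) (hg : 0 ≤ g) (hgg : g ≤ g') (hsc : n * h = sc) (hee : e ≤ e')
    (key : T' - T ≤ sc * g) :
    (1 - n - k) * (T / N + h * (e + g * (2 - 1 / (2 * N)))) + n * (T / N + h * (e + g * (1 / (2 * N))))
      + k * (T / N + h * (e + g * (1 / (2 * N)))) + 2 * (T' - T) ≤ T' / N + h * (e' + g' * (2 - 1 / (2 * N))) := by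
  have hN0 : 0 < N := by linarith
  have i1 : 1 / N ≤ 1 := by rw [div_le_one hN0]; exact hN
  have i2 : 0 < 1 / N := by positivity
  have e1 : (1 - n - k) * (T / N + h * (e + g * (2 - 1 / (2 * N)))) + n * (T / N + h * (e + g * (1 / (2 * N))))
      + k * (T / N + h * (e + g * (1 / (2 * N)))) = T / N + h * e + h * g * (2 - 1 / (2 * N))
       - (n * h) * g * (2 - 1 / N) - k * h * g * (2 - 1 / N) := by
    field_simp; ring
  have e0 : 1 / (2 * N) = 1 / N / 2 := by field_simp
  have e2 : h * g * (2 - 1 / (2 * N)) ≤ h * g' * (2 - 1 / (2 * N)) := by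
    have : 0 ≤ 2 - 1 / (2 * N) := by rw [e0]; linarith
    gcongr
  have e3 : 0 ≤ k * h * g * (2 - 1 / N) := by
    have : 0 ≤ 2 - 1 / N := by linarith
    positivity
  have e4 := mul_le_mul_of_nonneg_right key (show 0 ≤ 2 - 1 / N by linarith)
  have e5 : T' / N = T / N + (T' - T) * (1 / N) := by field_simp; ring
  rw [e1, hsc, e5]
  nlinarith

lemma dn_bd_alg {N : ℝ} (hN : 1 ≤ N) {h T T' e e' g g' n k sc ls : ℝ} (hh : 0 < h)
    (hk : 0 ≤ k) (hg : 0 ≤ g) (hl : 0 ≤ ls) (hgg : g - ls ≤ g') (hsc : n * h = sc)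
    (hee : 2 * k * g + ls ≤ e' - e)
    (key : sc * g ≤ T' - T) :
     T' / N - h * (e' + g' * (1 / (2 * N))) ≤
    (1 - n - k) * (T / N - h * (e + g * (1 / (2 * N)))) + n * (T / N - h * (e + g * (2 - 1 / (2 * N))))
      + k * (T / N - h * (e + g * (2 - 1 / (2 * N)))) + 2 * (T' - T) := by
  have hN0 : 0 < N := by linarith
  have i1 : 1 / N ≤ 1 := by rw [div_le_one hN0]; exact hN
  have i2 : 0 < 1 / N := by positivity
  have e1 : (1 - n - k) * (T / N - h * (e + g * (1 / (2 * N)))) + n * (T / N - h * (e + g * (2 - 1 / (2 * N))))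
      + k * (T / N - h * (e + g * (2 - 1 / (2 * N)))) = T / N - h * e - h * g * (1 / (2 * N))
       - (n * h) * g * (2 - 1 / N) - h * (k * g) * (2 - 1 / N) := by
    field_simp; ring
  have e0 : 1 / (2 * N) = 1 / N / 2 := by field_simp
  have e2 : h * (g - ls) * (1 / (2 * N)) ≤ h * g' * (1 / (2 * N)) := by
    gcongr
  have e2' : h * ls * (1 / (2 * N)) ≤ h * ls := by
    have : 0 ≤ h * ls := by positivity
    rw [e0]; nlinarith
  have e3 : h * (k * g) * (2 - 1 / N) ≤ h * (2 * k * g) := by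
    have : 0 ≤ h * (k * g) := by positivity
    nlinarith
  have e4 := mul_le_mul_of_nonneg_right key (show 0 ≤ 2 - 1 / N by linarith)
  have e5 : T' / N = T / N + (T' - T) * (1 / N) := by field_simp; ring
  have e6 := mul_le_mul_of_nonneg_left hee hh.le
  rw [e1, hsc, e5]
  nlinarith

lemma q_up1 {a A X r : ℝ} (ha : a = A * X) (hA : 0 < A) (h1 : a ≤ 1 / 2) (hX : X ≤ r) (hr : 0 < r) :
    (1 + a) * (1 + 1 / 2 * r) ≤ 1 + (A + 3 / 4) * r := by
  have : a ≤ A * r := by rw [ha]; gcongr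
  nlinarith
lemma q_up2 {a r : ℝ} (h0 : 0 < a) (h1 : a ≤ 1 / 2) (hr : 0 < r) (hr1 : r ≤ 1) :
    (1 + a) * (1 + 1 / 2 * r) ≤ 9 / 4 := by nlinarith
lemma q_up3 {k F w A d r : ℝ} (q3 : k * F ≤ (1 + (A + 3 / 4) * r) * F) (q4 : k * w ≤ 9 / 4 * w)
    (q5 : (A + 3 / 4) * (F * r) ≤ (A + 3 / 4) * (d * w)) :
    k * (F + w) ≤ F + (d * (A + 3 / 4) + 9 / 4) * w := by nlinarith
lemma q_dn1 {A X r : ℝ} (hA : 0 < A) (hX0 : 0 < X) (hX : X ≤ r) (hr : 0 < r) :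
    1 - (1 / 2 + 2 * A) * r ≤ (1 - 1 / 2 * r) * (1 - 2 * A * X) := by
  have : A * X ≤ A * r := by gcongr
  have : 0 < A * X * r := by positivity
  nlinarith
lemma q_bd {p a : ℝ} (h1 : p ≤ 1 + a) (h2 : a ≤ 1 / 2) (h0 : 0 < a) : p * (1 - 2 * a) ≤ 1 - a := by
  have := mul_le_mul_of_nonneg_right h1 (show 0 ≤ 1 - 2 * a by linarith)
  nlinarith
end alg

section inv
variable {S : SC} {N : ℕ} {h σ x X X' : ℝ} {Θ F C : ℝ → ℝ} {P : ℝ → ℝ → ℝ} {R : ℤ → ℝ}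

set_option maxHeartbeats 2000000 in
theorem InvR.step (hN : 1 ≤ N) (hh : h = S.m / N) (G : Gas S C) (H : SmallPt S x X)
    (H' : SmallPt S (x + σ) X')
    (Wp : WallPt S σ x X Θ F P) (St : StepPt S h σ x X X' Θ F)
    (I : InvR S N h σ x X Θ F C R) :
    InvR S N h σ (x + σ) X' Θ F C (stepR N h σ x Θ C P R) := by
  have hN' : (0 : ℝ) < N := by exact_mod_cast hN
  have hN1 : (1 : ℝ) ≤ N := by exact_mod_cast hN
  have hm := S.hm
  have hh0 : 0 < h := by rw [hh]; positivity
  have hX := H.hX; have hx := H.hx; have hcs := S.hcs; have ha := S.ha; have hb := S.hb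
  have hσ := St.hσ; have hA := S.hA; have hd := S.hd; have hμ := S.hμ
  have hμ0 : 0 < S.μ := by linarith
  have hk0 := S.k0_pos; have hCg := S.Cg_pos; have hE := S.E_pos
  obtain ⟨p1, p2, p3⟩ := P_bd hN H Wp I
  have hP0 := hcs.trans_le p1
  obtain ⟨hg0, hg1⟩ := gU_bd hN G H Wp I
  obtain ⟨hgl0, hgl1⟩ := gL_bd hN G H Wp I
  obtain ⟨y1, y2⟩ := I.hYN1 hN
  have hC0 : 0 < C (Yv R (N - 1)) := lt_of_lt_of_le (by have := S.c1_pos; positivity) (C_lo G H y1 y2)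
  have hF0 := Wp.F0
  obtain ⟨z1, z2, z3⟩ := step_Ybd hN hh G H Wp St I (i := N - 1) (by omega) (by omega)
  have y0 : 0 < Yv R (N - 1) := lt_of_lt_of_le (by positivity) y1
  have hCC : C (Yv (stepR N h σ x Θ C P R) (N - 1)) ≤ C (Yv R (N - 1)) := G.anti _ _ y0 z3 (z2.trans H'.hY)
  have hC0' : 0 < C (Yv (stepR N h σ x Θ C P R) (N - 1)) :=
    lt_of_lt_of_le (by have := S.c1_pos; have := H'.hX; positivity) (C_lo G H' z1 z2)
  set p := X ^ 5 / x ^ 2 with hp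
  set ω := X ^ 5 / x ^ 3 with hω
  set p' := X' ^ 5 / (x + σ) ^ 2 with hp'
  have hpp : p + σ * ω ≤ p' := St.hp
  have hω0 : 0 < ω := by positivity
  have hpω : p / x = ω := by rw [hp, hω]; field_simp
  have hr1 : X / x ≤ 1 := by rw [div_le_one hx]; exact H.hXx
  have hr0 : 0 < X / x := by positivity
  have hXr : X ≤ X / x := by rw [le_div_iff₀ hx]; nlinarith [H.hx1]
  have hX1 : X ≤ 1 := hXr.trans hr1
  have hFr : F x * (X / x) ≤ S.d * ω := by
    calc F x * (X / x) ≤ S.d * (X ^ 4 / x ^ 2) * (X / x) := by have := Wp.Fhi; gcongr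
      _ = S.d * ω := by rw [hω]; field_simp
  have hAX := H.hAX
  have hAX0 : 0 < S.A * X := by positivity
  have hgUU : gU S N σ x F C R ≤ gU S N σ (x + σ) F C (stepR N h σ x Θ C P R) := by
    unfold gU
    have := St.F2
    have : 0 ≤ F (x + σ) := Wp.F0.trans Wp.Fmono
    gcongr
    linarith
  set ls := 2 * S.A * (X' - X) * (F x / (C (Yv R (N - 1)) * S.cs)) with hls
  have hgq : F x / (C (Yv R (N - 1)) * S.cs) ≤ S.Cg * p := by
    refine le_trans ?_ hg1
    unfold gU
    have := Wp.Fmono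
    gcongr
  have hgq0 : 0 ≤ F x / (C (Yv R (N - 1)) * S.cs) := by positivity
  have hls0 : 0 ≤ ls := by
    have : 0 ≤ X' - X := by linarith [St.hXX]
    positivity
  have hls1 : ls ≤ σ * (4 * S.A * S.μ * S.Cg * ω) := by
    have e1 : X' - X ≤ 2 * S.μ * σ * (X / x) := by
      have := St.hX1
      have e : X * (1 + 2 * S.μ * (σ / x)) = X + 2 * S.μ * σ * (X / x) := by field_simp
      linarith
    calc ls ≤ 2 * S.A * (2 * S.μ * σ * (X / x)) * (S.Cg * p) := by rw [hls]; gcongr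
      _ = σ * (4 * S.A * S.μ * S.Cg * ω) * X := by rw [← hpω]; field_simp; ring
      _ ≤ σ * (4 * S.A * S.μ * S.Cg * ω) * 1 := by gcongr
      _ = _ := by ring
  have hgLL : gL S N x X F C R - ls ≤ gL S N (x + σ) X' F C (stepR N h σ x Θ C P R) := by
    have e1 : gL S N x X F C R - ls = F x * (1 - 2 * S.A * X') / (C (Yv R (N - 1)) * S.cs) := by
      unfold gL; rw [hls]; field_simp; ring
    rw [e1]
    unfold gL
    have := Wp.Fmono
    have h0 : 0 ≤ 1 - 2 * S.A * X' := by linarith [St.hAX']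
    have : 0 ≤ F (x + σ) := Wp.F0.trans Wp.Fmono
    gcongr
  have hmE : S.m * S.E = 4 * S.d * S.A + 2 * S.d + 5 + 2 * S.m * S.k0 * S.Cg + 8 * S.m * S.A * S.μ * S.Cg := by
    unfold SC.E; field_simp
  have hE2 : 2 * S.k0 * S.Cg + 8 * S.A * S.μ * S.Cg ≤ S.E := by
    unfold SC.E
    have : 0 ≤ (4 * S.d * S.A + 2 * S.d + 5) / S.m := by positivity
    linarith
  have hnuh : ∀ i, nuI N h σ x C P R i * h = σ * (P x (Yv R N) * C (Yv R i)) := by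
    intro i; unfold nuI; field_simp
  have hkg : ∀ κ g, 0 ≤ κ → κ ≤ σ * (S.k0 / x) → 0 ≤ g → g ≤ S.Cg * p → κ * g ≤ σ * (S.k0 * S.Cg * ω) := by
    intro κ g k1 k2 g1 g2
    calc κ * g ≤ (σ * (S.k0 / x)) * (S.Cg * p) := by gcongr
      _ = _ := by rw [← hpω]; field_simp
  have hnk : ∀ i κ, -(N : ℤ) ≤ i → i ≤ N → κ ≤ σ * (S.k0 / x) → nuI N h σ x C P R i + κ ≤ 1 := by
    intro i κ h1 h2 h3
    have := (nu_bd hN hh hσ G H Wp I h1 h2).2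
    linarith [St.cfl]
  have hEp : S.E * p + S.E * (σ * ω) ≤ S.E * p' := by
    rw [← mul_add]; exact mul_le_mul_of_nonneg_left hpp hE.le
  have hmEp : S.m * S.E * (σ * ω) ≤ S.m * (S.E * p' - S.E * p) := by
    have := mul_le_mul_of_nonneg_left hEp hm.le
    linarith
  have hσω : 0 < σ * ω := by positivity
  have hΔ1 := St.T1
  have hΔ2 := St.T2
  have hAF : S.A * X * (σ * F x) ≤ S.A * S.d * (σ * ω) := by
    calc S.A * X * (σ * F x) ≤ S.A * (X / x) * (σ * F x) := by gcongr
      _ = S.A * σ * (F x * (X / x)) := by ring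
      _ ≤ S.A * σ * (S.d * ω) := by gcongr
      _ = _ := by ring
  refine ⟨stepR_neg hN, ?_, ?_, ?_, ?_⟩
  · intro i h1 h2
    by_cases hi : i = -(N : ℤ) + 1
    · obtain ⟨κ, k1, k2, k3⟩ := step_d0 hN hh hσ G H Wp I hi
      rw [k3]
      have hnu := nu_bd hN hh hσ G H Wp I h1.le h2
      have hnk' := hnk i κ h1.le h2 k2
      have c := comb_le hnu.1 k1 hnk' (I.up i h1 h2) (I.up N (by omega) (by omega)) (I.up N (by omega) (by omega))
      have w1 : 1 - wI N i = 2 - 1 / (2 * N) := by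
        rw [hi]; unfold wI; push_cast; field_simp; ring
      have w2 : 1 - wI N (N : ℤ) = 1 / (2 * N) := by
        unfold wI; push_cast; field_simp; ring
      have key : Θ (x + σ) - Θ x ≤ (σ * (P x (Yv R N) * C (Yv R i))) * gU S N σ x F C R := by
        have e : Yv R i = Yv R (N - 1) := by
          rw [← Yv_neg, hi]; congr 1; ring
        rw [e]; unfold gU
        have e2 : σ * (P x (Yv R N) * C (Yv R (N - 1))) * (F (x + σ) / (C (Yv R (N - 1)) * S.cs)) =
          (σ * F (x + σ)) * (P x (Yv R N) / S.cs) := by field_simp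
        rw [e2]
        have e3 : 1 ≤ P x (Yv R N) / S.cs := by rw [le_div_iff₀ hcs]; linarith
        have e4 : 0 ≤ σ * F (x + σ) := mul_nonneg hσ.le (Wp.F0.trans Wp.Fmono)
        exact hΔ2.trans (le_mul_of_one_le_right e4 e3)
      have A := up_bd_alg (T := Θ x) (T' := Θ (x + σ)) (e := S.E * p) (e' := S.E * p') hN1 hh0 k1 hg0 hgUU (hnuh i) (by linarith [mul_pos hE hσω]) key
      rw [w1, w2] at c
      rw [w1]
      linarith
    · obtain ⟨κ, k1, k2, k3⟩ := step_d hN hh hσ G H Wp I (i := i) (by omega) h2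
      rw [k3]
      have hnu := nu_bd hN hh hσ G H Wp I h1.le h2
      have hnk' := hnk i κ h1.le h2 k2
      have c := comb_le hnu.1 k1 hnk' (I.up i h1 h2) (I.up (i - 1) (by omega) (by omega)) (I.up (1 - i) (by omega) (by omega))
      rw [wI_refl, wI_pred] at c
      refine c.trans (up_int_alg hN' hh hm (wI_bd hN h1 h2).2 k1 hg0 hgUU (hnuh i) ?_)
      have hrat := (abs_le.1 (ratio_bd hN hh G H Wp I h1.le h2)).2
      have e2 : σ * (P x (Yv R N) * C (Yv R i)) * gU S N σ x F C R =
          σ * ((P x (Yv R N) / S.cs) * (C (Yv R i) / C (Yv R (N - 1))) * F (x + σ)) := by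
        unfold gU; field_simp
      have e3 : P x (Yv R N) / S.cs ≤ 1 + S.A * X := by rw [div_le_iff₀ hcs]; linarith
      have e4 : C (Yv R i) / C (Yv R (N - 1)) ≤ 1 + 1 / 2 * (X / x) := by linarith
      have e5 : (P x (Yv R N) / S.cs) * (C (Yv R i) / C (Yv R (N - 1))) * F (x + σ) ≤
          F x + (S.d * (S.A + 3 / 4) + 9 / 4) * ω := by
        have hCi : 0 ≤ C (Yv R i) := le_trans (by have := S.c1_pos; positivity) (C_lo G H (I.Ylo i h1.le h2) (I.Yhi i h1.le h2))
        calc (P x (Yv R N) / S.cs) * (C (Yv R i) / C (Yv R (N - 1))) * F (x + σ) ≤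
            (1 + S.A * X) * (1 + 1 / 2 * (X / x)) * (F x + ω) := by
              have := Wp.Fω; have := Wp.F0.trans Wp.Fmono; gcongr
          _ ≤ _ := by
              have q1 : (1 + S.A * X) * (1 + 1 / 2 * (X / x)) ≤ 1 + (S.A + 3 / 4) * (X / x) := q_up1 rfl hA hAX hXr hr0
              have q2 : (1 + S.A * X) * (1 + 1 / 2 * (X / x)) ≤ 9 / 4 := q_up2 hAX0 hAX hr0 hr1
              have q3 := mul_le_mul_of_nonneg_right q1 hF0
              have q4 := mul_le_mul_of_nonneg_right q2 hω0.le
              have q5 := mul_le_mul_of_nonneg_left hFr (show 0 ≤ S.A + 3 / 4 by positivity)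
              exact q_up3 q3 q4 q5
      have e6 := mul_le_mul_of_nonneg_left e5 hσ.le
      have e7 := hkg κ _ k1 k2 hg0 hg1
      have e8 := mul_le_mul_of_nonneg_left e7 hm.le
      rw [e2]
      rw [hmE] at hmEp
      have e9 : 0 ≤ S.m * S.A * S.μ * S.Cg * (σ * ω) := by positivity
      have e10 : 0 ≤ S.d * S.A * (σ * ω) := by positivity
      have e11 : 0 ≤ S.d * (σ * ω) := by positivity
      linarith
  · intro i h1 h2
    by_cases hi : i = -(N : ℤ) + 1
    · obtain ⟨κ, k1, k2, k3⟩ := step_d0 hN hh hσ G H Wp I hi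
      rw [k3]
      have hnu := nu_bd hN hh hσ G H Wp I h1.le h2
      have hnk' := hnk i κ h1.le h2 k2
      have c := comb_le hnu.1 k1 hnk' (I.dn i h1 h2) (I.dn N (by omega) (by omega)) (I.dn N (by omega) (by omega))
      have w1 : 1 + wI N i = 1 / (2 * N) := by
        rw [hi]; unfold wI; push_cast; field_simp; ring
      have w2 : 1 + wI N (N : ℤ) = 2 - 1 / (2 * N) := by
        unfold wI; push_cast; field_simp; ring
      have key : (σ * (P x (Yv R N) * C (Yv R i))) * gL S N x X F C R ≤ Θ (x + σ) - Θ x := by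
        have e : Yv R i = Yv R (N - 1) := by
          rw [← Yv_neg, hi]; congr 1; ring
        rw [e]; unfold gL
        have e2 : σ * (P x (Yv R N) * C (Yv R (N - 1))) * (F x * (1 - 2 * S.A * X) / (C (Yv R (N - 1)) * S.cs)) =
          (σ * F x) * ((P x (Yv R N) / S.cs) * (1 - 2 * S.A * X)) := by field_simp
        rw [e2]
        have e3 : P x (Yv R N) / S.cs ≤ 1 + S.A * X := by rw [div_le_iff₀ hcs]; linarith
        have e4 : 0 ≤ σ * F x := mul_nonneg hσ.le hF0
        have e5 : (P x (Yv R N) / S.cs) * (1 - 2 * S.A * X) ≤ 1 - S.A * X := by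
          have := q_bd e3 hAX hAX0
          rwa [← mul_assoc] at this
        have := mul_le_mul_of_nonneg_left e5 e4
        linarith
      have e7 := hkg κ _ k1 k2 hgl0 hgl1
      have A := dn_bd_alg (T := Θ x) (T' := Θ (x + σ)) (e := S.E * p) (e' := S.E * p') hN1 hh0 k1 hgl0 hls0 hgLL (hnuh i)
        (by
          have q := mul_le_mul_of_nonneg_right hE2 hσω.le
          have e9 : 0 ≤ S.A * S.μ * S.Cg * (σ * ω) := by positivity
          linarith) key
      rw [w1, w2] at c
      rw [w1]
      linarith
    · obtain ⟨κ, k1, k2, k3⟩ := step_d hN hh hσ G H Wp I (i := i) (by omega) h2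
      rw [k3]
      have hnu := nu_bd hN hh hσ G H Wp I h1.le h2
      have hnk' := hnk i κ h1.le h2 k2
      have c := comb_le hnu.1 k1 hnk' (I.dn i h1 h2) (I.dn (i - 1) (by omega) (by omega)) (I.dn (1 - i) (by omega) (by omega))
      rw [wI_refl, wI_pred] at c
      refine le_trans (dn_int_alg hN' hh hm (wI_bd hN h1 h2).2 (wI_bd hN h1 h2).1 k1 hgl0 hls0 hgLL (hnuh i) ?_) c
      have hrat := (abs_le.1 (ratio_bd hN hh G H Wp I h1.le h2)).1
      have e2 : σ * (P x (Yv R N) * C (Yv R i)) * gL S N x X F C R =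
          σ * ((P x (Yv R N) / S.cs) * (C (Yv R i) / C (Yv R (N - 1))) * (F x * (1 - 2 * S.A * X))) := by
        unfold gL; field_simp
      have e3 : 1 ≤ P x (Yv R N) / S.cs := by rw [le_div_iff₀ hcs]; linarith
      have e4 : 1 - 1 / 2 * (X / x) ≤ C (Yv R i) / C (Yv R (N - 1)) := by linarith
      have e5 : F x - (1 / 2 + 2 * S.A) * S.d * ω ≤
         (P x (Yv R N) / S.cs) * (C (Yv R i) / C (Yv R (N - 1))) * (F x * (1 - 2 * S.A * X)) := by
        have h0 : 0 ≤ 1 - 2 * S.A * X := by linarith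
        have h0' : 0 ≤ 1 - 1 / 2 * (X / x) := by linarith
        calc F x - (1 / 2 + 2 * S.A) * S.d * ω ≤ 1 * (1 - 1 / 2 * (X / x)) * (F x * (1 - 2 * S.A * X)) := by
              have q1 : 1 - (1 / 2 + 2 * S.A) * (X / x) ≤ (1 - 1 / 2 * (X / x)) * (1 - 2 * S.A * X) := q_dn1 hA hX hXr hr0
              have q3 := mul_le_mul_of_nonneg_right q1 hF0
              have q5 := mul_le_mul_of_nonneg_left hFr (show 0 ≤ 1 / 2 + 2 * S.A by positivity)
              linarith
          _ ≤ _ := by gcongr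
      have e6 := mul_le_mul_of_nonneg_left e5 hσ.le
      have e7 := hkg κ _ k1 k2 hgl0 hgl1
      have e8 := mul_le_mul_of_nonneg_left e7 hm.le
      have e12 := mul_le_mul_of_nonneg_left hls1 hm.le
      have e13 := mul_le_mul_of_nonneg_left Wp.Fω hσ.le
      rw [e2]
      rw [hmE] at hmEp
      have e10 : 0 ≤ S.d * S.A * (σ * ω) := by positivity
      have e11 : 0 ≤ S.d * (σ * ω) := by positivity
      linarith
  · intro i h1 h2; exact (step_Ybd hN hh G H Wp St I h1 h2).1
  · intro i h1 h2; exact (step_Ybd hN hh G H Wp St I h1 h2).2.1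
end inv
end

section
/-- global wall data -/
structure Wall (S : SC) (l : ℝ) (Θ F C : ℝ → ℝ) (P : ℝ → ℝ → ℝ) : Prop where
  G : Gas S C
  hl : 0 < l
  small : ∀ x, 0 < x → x ≤ l → SmallPt S x (x ^ S.μ)
  Fm : Monotone F
  Fu : UniformContinuous F
  F0 : ∀ x, 0 < x → 0 ≤ F x
  Fhi : ∀ x, 0 < x → x ≤ l → F x ≤ S.d * ((x ^ S.μ) ^ 4 / x ^ 2)
  Tlo : ∀ x, 0 < x → x ≤ l → S.t1 * ((x ^ S.μ) ^ 4 / x) ≤ Θ x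
  Thi : ∀ x, 0 < x → x ≤ l → Θ x ≤ S.t2 * ((x ^ S.μ) ^ 4 / x)
  Plo : ∀ x, 0 < x → x ≤ l → ∀ Y, 0 ≤ Y → Y ≤ (S.b * x ^ S.μ) ^ 3 → S.cs ≤ P x Y
  Phi : ∀ x, 0 < x → x ≤ l → ∀ Y, 0 ≤ Y → Y ≤ (S.b * x ^ S.μ) ^ 3 → P x Y ≤ S.cs * (1 + S.A * x ^ S.μ)
  T1 : ∀ x σ, 0 < x → 0 < σ → σ ≤ x → x + σ ≤ l → (1 - S.A * x ^ S.μ) * (σ * F x) ≤ Θ (x + σ) - Θ x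
  T2 : ∀ x σ, 0 < x → 0 < σ → σ ≤ x → x + σ ≤ l → Θ (x + σ) - Θ x ≤ σ * F (x + σ)

lemma rpow_up {p s : ℝ} (hp : 0 ≤ p) (hs : 0 ≤ s) (h : p * s ≤ 1) : (1 + s) ^ p ≤ 1 + 2 * p * s := by
  have h1 : (1 + s) ^ p ≤ Real.exp (p * s) := by
    have e : 1 + s ≤ Real.exp s := by linarith [Real.add_one_le_exp s]
    calc (1 + s) ^ p ≤ (Real.exp s) ^ p := Real.rpow_le_rpow (by linarith) e hp
      _ = _ := by rw [← Real.exp_mul]; ring_nf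
  have h0 : 0 ≤ p * s := by positivity
  have h2 := Real.abs_exp_sub_one_sub_id_le (x := p * s) (by rw [abs_of_nonneg h0]; exact h)
  have h3 := (abs_le.1 h2).2
  nlinarith

/-- discrete approximate solution -/
structure Disc (S : SC) (l : ℝ) (Θ C : ℝ → ℝ) (P : ℝ → ℝ → ℝ) (η ε h σ : ℝ) (N M : ℕ) (R : ℕ → ℤ → ℝ) : Prop where
  hε : 0 < ε
  hεη : ε ≤ η
  hN : 1 ≤ N
  hh : h = S.m / N
  hhη : h ≤ η
  hσ : 0 < σ
  hση : σ ≤ η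
  hM : ε + M * σ = l
  bc : ∀ n : ℕ, n ≤ M → R n (-N) = R n N - 2 * Θ (ε + n * σ)
  slo : ∀ n : ℕ, n ≤ M → ∀ i : ℤ, -(N : ℤ) < i → i ≤ N →
    S.v1 * (((ε + n * σ) ^ S.μ) ^ 4 / (ε + n * σ)) * h ≤ R n i - R n (i - 1)
  shi : ∀ n : ℕ, n ≤ M → ∀ i : ℤ, -(N : ℤ) < i → i ≤ N →
    R n i - R n (i - 1) ≤ S.v2 * (((ε + n * σ) ^ S.μ) ^ 4 / (ε + n * σ)) * h
  yd : ∀ n : ℕ, n ≤ M → ∀ i : ℤ, -(N : ℤ) < i → i ≤ N →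
    |Yv (R n) i - Yv (R n) (i - 1)| ≤ h * (S.Gc * (((ε + n * σ) ^ S.μ) ^ 5 / (ε + n * σ) ^ 2))
  Ylo : ∀ n : ℕ, n ≤ M → ∀ i : ℤ, -(N : ℤ) ≤ i → i ≤ N → (S.a * (ε + n * σ) ^ S.μ) ^ 3 ≤ Yv (R n) i
  Yhi : ∀ n : ℕ, n ≤ M → ∀ i : ℤ, -(N : ℤ) ≤ i → i ≤ N → Yv (R n) i ≤ (S.b * (ε + n * σ) ^ S.μ) ^ 3
  upd : ∀ n : ℕ, n < M → ∀ i : ℤ, -(N : ℤ) < i → i ≤ N →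
    R (n + 1) i = R n i - σ / h * (P (ε + n * σ) (Yv (R n) N) * C (Yv (R n) i)) * (R n i - R n (i - 1))

noncomputable def iterR (N : ℕ) (h σ ε : ℝ) (Θ C : ℝ → ℝ) (P : ℝ → ℝ → ℝ) (R0 : ℤ → ℝ) : ℕ → ℤ → ℝ
  | 0 => R0
  | n + 1 => stepR N h σ (ε + n * σ) Θ C P (iterR N h σ ε Θ C P R0 n)

set_option maxHeartbeats 1000000 in
theorem exists_disc {S : SC} {l : ℝ} {Θ F C : ℝ → ℝ} {P : ℝ → ℝ → ℝ} (W : Wall S l Θ F C P)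
    {η : ℝ} (hη : 0 < η) : ∃ (ε h σ : ℝ) (N M : ℕ) (R : ℕ → ℤ → ℝ), Disc S l Θ C P η ε h σ N M R := by
  have hl := W.hl; have hm := S.hm; have hμ := S.hμ; have hcs := S.hcs; have hc2 := S.c2_pos
  have hk0 := S.k0_pos; have hv2 := S.v2_pos; have hL := S.hL; have ha := S.ha
  have hμ0 : 0 < S.μ := by linarith
  obtain ⟨ε, hε, hεη, hεl⟩ : ∃ ε : ℝ, 0 < ε ∧ ε ≤ η ∧ ε < l :=
    ⟨min η (l / 2), by positivity, min_le_left _ _, (min_le_right _ _).trans_lt (by linarith)⟩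
  obtain ⟨N, hN⟩ := exists_nat_gt (max 1 (S.m / η))
  have hN1 : (1 : ℝ) < N := (le_max_left _ _).trans_lt hN
  have hN0 : (0 : ℝ) < N := by linarith
  have hNn : 1 ≤ N := by exact_mod_cast hN1.le
  obtain ⟨h, hh⟩ : ∃ h, h = S.m / N := ⟨_, rfl⟩
  have hh0 : 0 < h := by rw [hh]; positivity
  have hhη : h ≤ η := by
    have := (le_max_right 1 (S.m / η)).trans hN.le
    rw [hh, div_le_iff₀ hN0]; rw [div_le_iff₀ hη] at this; linarith
  have hl1 : l ≤ 1 := (W.small l hl le_rfl).hx1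
  obtain ⟨δ, hδ, hFδ⟩ := Metric.uniformContinuous_iff.1 W.Fu ((ε ^ S.μ) ^ 5) (by positivity)
  have hεμ : 0 < ε ^ S.μ := by positivity
  -- σ bound
  set K := (2 * S.cs * S.c2 / ε ^ S.μ) / h + S.k0 / ε + 2 * S.cs * (S.v2 + 1) * S.L / (S.a ^ 4 * ε) + 3 * S.μ / ε + 1 / ε + 1 / η + 2 / δ with hK
  have hK0 : 0 < K := by positivity
  obtain ⟨M, hM⟩ := exists_nat_gt (max 1 ((l - ε) * K))
  have hM1 : (1 : ℝ) < M := (le_max_left _ _).trans_lt hM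
  have hM0 : (0 : ℝ) < M := by linarith
  obtain ⟨σ, hσd⟩ : ∃ σ, σ = (l - ε) / M := ⟨_, rfl⟩
  have hσ : 0 < σ := by rw [hσd]; exact div_pos (by linarith) hM0
  have hσK : σ * K ≤ 1 := by
    rw [hσd, div_mul_eq_mul_div, div_le_one hM0]; exact (le_max_right _ _).trans hM.le
  have hMl : ε + M * σ = l := by rw [hσd]; field_simp; ring
  have t1 : 0 < σ * ((2 * S.cs * S.c2 / ε ^ S.μ) / h) := by positivity
  have t2 : 0 < σ * (S.k0 / ε) := by positivity
  have t3 : 0 < σ * (2 * S.cs * (S.v2 + 1) * S.L / (S.a ^ 4 * ε)) := by positivity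
  have t4 : 0 < σ * (3 * S.μ / ε) := by positivity
  have t5 : 0 < σ * (1 / ε) := by positivity
  have t6 : 0 < σ * (1 / η) := by positivity
  have t7 : 0 < σ * (2 / δ) := by positivity
  rw [hK] at hσK
  rw [mul_add, mul_add, mul_add, mul_add, mul_add, mul_add] at hσK
  have s1 : σ * ((2 * S.cs * S.c2 / ε ^ S.μ) / h) + σ * (S.k0 / ε) ≤ 1 := by linarith
  have s3 : σ * (2 * S.cs * (S.v2 + 1) * S.L / (S.a ^ 4 * ε)) ≤ 1 := by linarith
  have s4 : σ * (3 * S.μ / ε) ≤ 1 := by linarith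
  have s5 : σ ≤ ε := by
    have : σ * (1 / ε) ≤ 1 := by linarith
    rwa [mul_one_div, div_le_one hε] at this
  have s6 : σ ≤ η := by
    have : σ * (1 / η) ≤ 1 := by linarith
    rwa [mul_one_div, div_le_one hη] at this
  have s7 : σ < δ := by
    have : σ * (2 / δ) ≤ 1 := by linarith
    rw [mul_div_assoc', div_le_one hδ] at this
    linarith
  clear t1 t2 t3 t4 t5 t6 t7 hσK
  have wall : ∀ x, ε ≤ x → x ≤ l → WallPt S σ x (x ^ S.μ) Θ F P := by
    intro x hx hxl
    have hx0 : 0 < x := by linarith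
    refine ⟨W.F0 x hx0, W.Fm (by linarith), ?_, W.Fhi x hx0 hxl, W.Tlo x hx0 hxl, W.Thi x hx0 hxl,
      W.Plo x hx0 hxl, W.Phi x hx0 hxl⟩
    have := hFδ (a := x + σ) (b := x) (by rw [Real.dist_eq]; simpa [abs_of_pos hσ] using s7)
    rw [Real.dist_eq] at this
    have h1 := (abs_lt.1 this).2
    have h2 : (ε ^ S.μ) ^ 5 ≤ (x ^ S.μ) ^ 5 / x ^ 3 := by
      rw [le_div_iff₀ (by positivity)]
      have : x ^ 3 ≤ 1 := pow_le_one₀ hx0.le (by linarith)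
      calc (ε ^ S.μ) ^ 5 * x ^ 3 ≤ (ε ^ S.μ) ^ 5 * 1 := by gcongr
        _ ≤ _ := by rw [mul_one]; gcongr
    linarith
  have stp : ∀ x, ε ≤ x → x + σ ≤ l → StepPt S h σ x (x ^ S.μ) ((x + σ) ^ S.μ) Θ F := by
    intro x hx hxl
    have hx0 : 0 < x := by linarith
    have hX0 : 0 < x ^ S.μ := by positivity
    obtain ⟨s, hs⟩ : ∃ s, s = σ / x := ⟨_, rfl⟩
    have hs0 : 0 < s := by rw [hs]; positivity
    have hsμ : 3 * S.μ * s ≤ 1 := by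
      refine le_trans ?_ s4
      rw [hs, mul_div_assoc', mul_div_assoc', mul_comm σ]; gcongr
    have hX' : (x + σ) ^ S.μ = x ^ S.μ * (1 + s) ^ S.μ := by
      rw [← Real.mul_rpow hx0.le (by linarith), hs]; congr 1; field_simp
    have hεX : ε ^ S.μ ≤ x ^ S.μ := by gcongr
    have pw : ∀ k : ℕ, ((1 + s) ^ S.μ) ^ k = (1 + s) ^ (k * S.μ) := by
      intro k; rw [mul_comm, Real.rpow_mul (by linarith), Real.rpow_natCast]
    have one_le : 1 ≤ (1 + s) ^ S.μ := Real.one_le_rpow (by linarith) hμ0.le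
    refine ⟨hσ, ?_, ?_, ?_, ?_, ?_, ?_, ?_, ?_, W.T1 x σ hx0 hσ (by linarith) hxl, W.T2 x σ hx0 hσ (by linarith) hxl, W.Fm (by linarith)⟩
    · rw [hX', mul_pow, pw, ← hs]
      gcongr
      have := one_add_mul_self_le_rpow_one_add (s := s) (by linarith) (p := (3 : ℕ) * S.μ) (by push_cast; linarith)
      push_cast at this ⊢
      nlinarith
    · rw [hX', mul_pow, pw, ← hs]
      gcongr
      have := rpow_up (p := (3 : ℕ) * S.μ) (s := s) (by positivity) hs0.le (by push_cast; linarith)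
      push_cast at this ⊢
      linarith
    · rw [hX', mul_pow, pw]
      have e1 : x + σ = x * (1 + s) := by rw [hs]; field_simp
      have e2 : σ = x * s := by rw [hs]; field_simp
      rw [e1, e2]
      have e3 : (1 + s) ^ (3 : ℕ) ≤ (1 + s) ^ ((5 : ℕ) * S.μ) := by
        rw [← Real.rpow_natCast]
        apply Real.rpow_le_rpow_of_exponent_le (by linarith); push_cast; linarith
      have e4 : (x ^ S.μ) ^ 5 / x ^ 2 + x * s * ((x ^ S.μ) ^ 5 / x ^ 3) = (x ^ S.μ) ^ 5 * (1 + s) ^ (3:ℕ) / (x * (1 + s)) ^ 2 := by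
        field_simp
      rw [e4]
      gcongr
    · rw [hX', ← hs]
      gcongr
      have := rpow_up (p := S.μ) (s := s) (by positivity) hs0.le (by nlinarith)
      linarith
    · gcongr; linarith
    · refine le_trans ?_ s1
      have e : σ / h * (2 * S.cs * S.c2 / x ^ S.μ) = σ * ((2 * S.cs * S.c2 / x ^ S.μ) / h) := by ring
      rw [e]; gcongr
    · refine le_trans ?_ s3
      gcongr
    · exact (W.small (x + σ) (by linarith) hxl).hAX
  set R0 : ℤ → ℝ := fun i => -(S.a * ε ^ S.μ) ^ 3 + Θ ε * (i / N) with hR0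
  set R := iterR N h σ ε Θ C P R0 with hR
  have xs : ∀ n : ℕ, n ≤ M → ε ≤ ε + n * σ ∧ ε + n * σ ≤ l := by
    intro n hn
    have : (n : ℝ) ≤ M := by exact_mod_cast hn
    constructor
    · have : 0 ≤ n * σ := by positivity
      linarith
    · rw [← hMl]; gcongr
  have inv : ∀ n : ℕ, n ≤ M → InvR S N h σ (ε + n * σ) ((ε + n * σ) ^ S.μ) Θ F C (R n) := by
    intro n
    induction n with
    | zero =>
      intro _
      have hY : ∀ i, Yv R0 i = (S.a * ε ^ S.μ) ^ 3 := by
        intro i; simp only [Yv, hR0]; push_cast; field_simp; ring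
      have hd : ∀ i, R0 i - R0 (i - 1) = Θ ε / N := by
        intro i; simp only [hR0]; push_cast; field_simp; ring
      have e0 : ε + ((0 : ℕ) : ℝ) * σ = ε := by simp
      rw [e0]
      have sm := W.small ε hε hεl.le
      have hab : (S.a * ε ^ S.μ) ^ 3 ≤ (S.b * ε ^ S.μ) ^ 3 := by have := S.hab; gcongr
      have hC : 0 ≤ C ((S.a * ε ^ S.μ) ^ 3) := le_trans (by have := S.c1_pos; positivity) (C_lo W.G sm le_rfl hab)
      have hE := S.E_pos
      show InvR S N h σ ε (ε ^ S.μ) Θ F C R0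
      refine ⟨?_, ?_, ?_, ?_, ?_⟩
      · simp only [hR0]; push_cast; field_simp; ring
      · intro i h1 h2
        rw [hd]
        have g0 : 0 ≤ gU S N σ ε F C R0 := by
          unfold gU; rw [hY]; have := W.F0 (ε + σ) (by linarith); positivity
        have := (wI_bd hNn h1 h2).2
        have : 0 ≤ 1 - wI N i := by linarith
        have : 0 ≤ h * (S.E * ((ε ^ S.μ) ^ 5 / ε ^ 2) + gU S N σ ε F C R0 * (1 - wI N i)) := by positivity
        linarith
      · intro i h1 h2
        rw [hd]
        have g0 : 0 ≤ gL S N ε (ε ^ S.μ) F C R0 := by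
          unfold gL; rw [hY]; have := W.F0 ε hε; have := sm.hAX
          have : 0 ≤ 1 - 2 * S.A * ε ^ S.μ := by linarith
          positivity
        have := (wI_bd hNn h1 h2).1
        have : 0 ≤ 1 + wI N i := by linarith
        have : 0 ≤ h * (S.E * ((ε ^ S.μ) ^ 5 / ε ^ 2) + gL S N ε (ε ^ S.μ) F C R0 * (1 + wI N i)) := by positivity
        linarith
      · intro i _ _; rw [hY]
      · intro i _ _; rw [hY]; exact hab
    | succ n ih =>
      intro hn
      have I := ih (by omega)
      obtain ⟨x1, x2⟩ := xs n (by omega)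
      obtain ⟨x3, x4⟩ := xs (n + 1) hn
      have e : ε + ((n + 1 : ℕ) : ℝ) * σ = ε + n * σ + σ := by push_cast; ring
      rw [e] at x4 ⊢
      exact InvR.step hNn hh W.G (W.small _ (by linarith) x2) (W.small _ (by linarith) x4) (wall _ x1 x2) (stp _ x1 x4) I
  refine ⟨ε, h, σ, N, M, R, hε, hεη, hNn, hh, hhη, hσ, s6, hMl, ?_, ?_, ?_, ?_, ?_, ?_, ?_⟩
  · intro n hn; exact (inv n hn).bc
  · intro n hn i h1 h2
    obtain ⟨x1, x2⟩ := xs n hn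
    exact (slope_bd hNn hh W.G (W.small _ (by linarith) x2) (wall _ x1 x2) (inv n hn) h1 h2).1
  · intro n hn i h1 h2
    obtain ⟨x1, x2⟩ := xs n hn
    exact (slope_bd hNn hh W.G (W.small _ (by linarith) x2) (wall _ x1 x2) (inv n hn) h1 h2).2
  · intro n hn i h1 h2
    obtain ⟨x1, x2⟩ := xs n hn
    exact Ydiff_bd hNn hh W.G (W.small _ (by linarith) x2) (wall _ x1 x2) (inv n hn) h1 h2
  · intro n hn i h1 h2; exact (inv n hn).Ylo i h1 h2
  · intro n hn i h1 h2; exact (inv n hn).Yhi i h1 h2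
  · intro n hn i h1 h2
    show stepR N h σ (ε + n * σ) Θ C P (R n) i = _
    exact stepR_ne (by omega)
end

section
open Filter Topology

section disc
variable {S : SC} {l : ℝ} {Θ F C : ℝ → ℝ} {P : ℝ → ℝ → ℝ} {η ε h σ : ℝ} {N M : ℕ} {R : ℕ → ℤ → ℝ}

noncomputable def SC.K1 (S : SC) : ℝ := 2 * S.cs * S.c2 * S.v2

lemma SC.K1_pos (S : SC) : 0 < S.K1 := by
  have := S.hcs; have := S.c2_pos; have := S.v2_pos; unfold SC.K1; positivity

lemma Disc.h0 (D : Disc S l Θ C P η ε h σ N M R) : 0 < h := by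
  have := S.hm; have := D.hN
  have hN' : (0 : ℝ) < N := by exact_mod_cast D.hN
  rw [D.hh]; positivity

lemma Disc.Nh (D : Disc S l Θ C P η ε h σ N M R) : N * h = S.m := by
  have hN' : (0 : ℝ) < N := by exact_mod_cast D.hN
  rw [D.hh]; field_simp

lemma Disc.xn (D : Disc S l Θ C P η ε h σ N M R) {n : ℕ} (hn : n ≤ M) :
    0 < ε + n * σ ∧ ε + n * σ ≤ l := by
  have h1 := D.hε; have h2 := D.hσ
  have : (n : ℝ) ≤ M := by exact_mod_cast hn
  refine ⟨by positivity, ?_⟩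
  rw [← D.hM]; gcongr

lemma SmallPt.q1 {x X : ℝ} (H : SmallPt S x X) : X ^ 4 / x ≤ 1 ∧ 0 < X ^ 4 / x := by
  have hx := H.hx; have hX := H.hX; have h1 := H.hx1; have h2 := H.hXx
  refine ⟨?_, by positivity⟩
  rw [div_le_one hx]
  calc X ^ 4 ≤ X ^ 1 := pow_le_pow_of_le_one hX.le (by linarith) (by norm_num)
    _ ≤ x := by simpa using h2

lemma SmallPt.q3 {x X : ℝ} (H : SmallPt S x X) : X ^ 4 / x ≤ X ^ 3 := by
  have hx := H.hx; have hX := H.hX; have h1 := H.hx1; have h2 := H.hXx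
  rw [div_le_iff₀ hx]
  calc X ^ 4 = X ^ 3 * X := by ring
    _ ≤ X ^ 3 * x := by gcongr

lemma Disc.slope_nat (D : Disc S l Θ C P η ε h σ N M R) {n : ℕ} (hn : n ≤ M) (i : ℤ) (h1 : -(N : ℤ) ≤ i) (k : ℕ)
    (h2 : i + k ≤ N) :
    S.v1 * (((ε + n * σ) ^ S.μ) ^ 4 / (ε + n * σ)) * (k * h) ≤ R n (i + k) - R n i ∧
    R n (i + k) - R n i ≤ S.v2 * (((ε + n * σ) ^ S.μ) ^ 4 / (ε + n * σ)) * (k * h) := by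
  induction k with
  | zero => simp
  | succ k ih =>
    have a1 := ih (by push_cast at h2; omega)
    have a2 := D.slo n hn (i + (k + 1 : ℕ)) (by push_cast; omega) h2
    have a3 := D.shi n hn (i + (k + 1 : ℕ)) (by push_cast; omega) h2
    have e : i + ((k + 1 : ℕ) : ℤ) - 1 = i + k := by push_cast; ring
    rw [e] at a2 a3
    push_cast at *
    constructor <;> nlinarith [a1.1, a1.2]

lemma Disc.slope (D : Disc S l Θ C P η ε h σ N M R) {n : ℕ} (hn : n ≤ M) {i j : ℤ} (h1 : -(N : ℤ) ≤ i) (hij : i ≤ j)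
    (h2 : j ≤ N) :
    S.v1 * (((ε + n * σ) ^ S.μ) ^ 4 / (ε + n * σ)) * ((j - i) * h) ≤ R n j - R n i ∧
    R n j - R n i ≤ S.v2 * (((ε + n * σ) ^ S.μ) ^ 4 / (ε + n * σ)) * ((j - i) * h) := by
  obtain ⟨k, rfl⟩ : ∃ k : ℕ, j = i + k := ⟨(j - i).toNat, by omega⟩
  have := D.slope_nat hn i h1 k h2
  have e : ((i + k : ℤ) : ℝ) - i = k := by push_cast; ring
  rw [e]; exact this

lemma Disc.Yslope_nat (D : Disc S l Θ C P η ε h σ N M R) {n : ℕ} (hn : n ≤ M) (i : ℤ) (h1 : -(N : ℤ) ≤ i) (k : ℕ)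
    (h2 : i + k ≤ N) :
    |Yv (R n) (i + k) - Yv (R n) i| ≤ k * h * (S.Gc * (((ε + n * σ) ^ S.μ) ^ 5 / (ε + n * σ) ^ 2)) := by
  induction k with
  | zero => simp
  | succ k ih =>
    have a1 := ih (by push_cast at h2; omega)
    have a2 := D.yd n hn (i + (k + 1 : ℕ)) (by push_cast; omega) h2
    have e : i + ((k + 1 : ℕ) : ℤ) - 1 = i + k := by push_cast; ring
    rw [e] at a2
    have := abs_sub_le (Yv (R n) (i + (k + 1 : ℕ))) (Yv (R n) (i + k)) (Yv (R n) i)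
    push_cast at *
    linarith

lemma Disc.Yslope (D : Disc S l Θ C P η ε h σ N M R) {n : ℕ} (hn : n ≤ M) {i j : ℤ} (h1 : -(N : ℤ) ≤ i) (hij : i ≤ j)
    (h2 : j ≤ N) :
    |Yv (R n) j - Yv (R n) i| ≤ (j - i) * h * (S.Gc * (((ε + n * σ) ^ S.μ) ^ 5 / (ε + n * σ) ^ 2)) := by
  obtain ⟨k, rfl⟩ : ∃ k : ℕ, j = i + k := ⟨(j - i).toNat, by omega⟩
  have := D.Yslope_nat hn i h1 k h2
  have e : ((i + k : ℤ) : ℝ) - i = k := by push_cast; ring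
  rw [e]; exact this

lemma Disc.lipψ (W : Wall S l Θ F C P) (D : Disc S l Θ C P η ε h σ N M R) {n : ℕ} (hn : n ≤ M) {i j : ℤ}
    (h1 : -(N : ℤ) ≤ i) (h2 : i ≤ N) (h3 : -(N : ℤ) ≤ j) (h4 : j ≤ N) :
    |R n j - R n i| ≤ S.v2 * |j * h - i * h| := by
  have hh0 := D.h0
  wlog hij : i ≤ j generalizing i j
  · rw [abs_sub_comm, abs_sub_comm (_ * h)]; exact this h3 h4 h1 h2 (by omega)
  obtain ⟨x1, x2⟩ := D.xn hn
  have q := (W.small _ x1 x2).q1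
  have s := D.slope hn h1 hij h4
  have hv1 := S.v1_pos; have hv2 := S.v2_pos
  have hd : 0 ≤ ((j : ℝ) - i) * h := by
    have : (i : ℝ) ≤ j := by exact_mod_cast hij
    exact mul_nonneg (by linarith) hh0.le
  have e : (j : ℝ) * h - i * h = (j - i) * h := by ring
  rw [e, abs_of_nonneg hd, abs_of_nonneg]
  · refine s.2.trans ?_
    have : S.v2 * (((ε + n * σ) ^ S.μ) ^ 4 / (ε + n * σ)) ≤ S.v2 * 1 := by gcongr; exact q.1
    nlinarith
  · refine le_trans ?_ s.1
    have := q.2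
    positivity

lemma Disc.coef (W : Wall S l Θ F C P) (D : Disc S l Θ C P η ε h σ N M R) {n : ℕ} (hn : n ≤ M) {i : ℤ}
    (h1 : -(N : ℤ) ≤ i) (h2 : i ≤ N) :
    0 ≤ P (ε + n * σ) (Yv (R n) N) * C (Yv (R n) i) ∧
    P (ε + n * σ) (Yv (R n) N) * C (Yv (R n) i) ≤ 2 * S.cs * (S.c2 / (ε + n * σ) ^ S.μ) := by
  obtain ⟨x1, x2⟩ := D.xn hn
  have H := W.small _ x1 x2
  have hX := H.hX; have hcs := S.hcs; have ha := S.ha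
  have l1 := C_lo W.G H (D.Ylo n hn i h1 h2) (D.Yhi n hn i h1 h2)
  have l2 := C_hi W.G H (D.Ylo n hn i h1 h2) (D.Yhi n hn i h1 h2)
  have hC0 : 0 < C (Yv (R n) i) := lt_of_lt_of_le (by have := S.c1_pos; positivity) l1
  have y1 := D.Ylo n hn N (by omega) (by omega)
  have y2 := D.Yhi n hn N (by omega) (by omega)
  have y0 : 0 ≤ Yv (R n) N := le_trans (by positivity) y1
  have p1 := W.Plo _ x1 x2 _ y0 y2
  have p2 := W.Phi _ x1 x2 _ y0 y2
  have hP0 := hcs.trans_le p1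
  have p3 : P (ε + n * σ) (Yv (R n) N) ≤ 2 * S.cs := by have := H.hAX; nlinarith
  exact ⟨by positivity, by gcongr⟩

lemma Disc.lipx_step (W : Wall S l Θ F C P) (D : Disc S l Θ C P η ε h σ N M R) {n : ℕ} (hn : n < M) {i : ℤ}
    (h1 : -(N : ℤ) < i) (h2 : i ≤ N) :
    |R (n + 1) i - R n i| ≤ S.K1 * σ := by
  have hh0 := D.h0; have hσ := D.hσ
  obtain ⟨x1, x2⟩ := D.xn hn.le
  have H := W.small _ x1 x2
  have hX := H.hX; have hcs := S.hcs; have ha := S.ha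
  obtain ⟨c0, c1⟩ := D.coef W hn.le h1.le h2
  have s1 := D.slo n hn.le i h1 h2
  have s2 := D.shi n hn.le i h1 h2
  have hd0 : 0 ≤ R n i - R n (i - 1) := le_trans (by have := S.v1_pos; positivity) s1
  have hc2 := S.c2_pos; have hv2 := S.v2_pos
  rw [D.upd n hn i h1 h2]
  generalize P (ε + n * σ) (Yv (R n) N) * C (Yv (R n) i) = c at *
  have e : R n i - σ / h * c * (R n i - R n (i - 1)) - R n i = -(σ / h * c * (R n i - R n (i - 1))) := by ring
  rw [e, abs_neg, abs_of_nonneg (by positivity)]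
  calc σ / h * c * (R n i - R n (i - 1)) ≤ σ / h * (2 * S.cs * (S.c2 / (ε + n * σ) ^ S.μ)) *
        (S.v2 * (((ε + n * σ) ^ S.μ) ^ 4 / (ε + n * σ)) * h) := by gcongr
    _ = S.K1 * σ * (((ε + n * σ) ^ S.μ) ^ 3 / (ε + n * σ)) := by unfold SC.K1; field_simp
    _ ≤ S.K1 * σ * 1 := by
      have hK := S.K1_pos
      gcongr
      rw [div_le_one x1]
      calc ((ε + n * σ) ^ S.μ) ^ 3 ≤ ((ε + n * σ) ^ S.μ) ^ 1 := pow_le_pow_of_le_one hX.le (H.hXx.trans H.hx1) (by norm_num)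
        _ ≤ _ := by simpa using H.hXx
    _ = _ := by ring

lemma Disc.lipx_nat (W : Wall S l Θ F C P) (D : Disc S l Θ C P η ε h σ N M R) {n k : ℕ} (hn : n + k ≤ M) {i : ℤ}
    (h1 : -(N : ℤ) < i) (h2 : i ≤ N) :
    |R (n + k) i - R n i| ≤ S.K1 * (k * σ) := by
  induction k with
  | zero => simp
  | succ k ih =>
    have a1 := ih (by omega)
    have a2 := D.lipx_step W (n := n + k) (by omega) h1 h2
    have := abs_sub_le (R (n + (k + 1)) i) (R (n + k) i) (R n i)
    rw [← add_assoc] at this ⊢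
    push_cast
    nlinarith

lemma Disc.lipx (W : Wall S l Θ F C P) (D : Disc S l Θ C P η ε h σ N M R) {n n' : ℕ} (hn : n ≤ M) (hn' : n' ≤ M) {i : ℤ}
    (h1 : -(N : ℤ) < i) (h2 : i ≤ N) :
    |R n' i - R n i| ≤ S.K1 * |(ε + n' * σ) - (ε + n * σ)| := by
  wlog hij : n ≤ n' generalizing n n'
  · rw [abs_sub_comm, abs_sub_comm (ε + _)]; exact this hn' hn (by omega)
  obtain ⟨k, rfl⟩ := Nat.exists_eq_add_of_le hij
  have := D.lipx_nat W hn' h1 h2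
  have e : (ε + (n + k : ℕ) * σ) - (ε + n * σ) = k * σ := by push_cast; ring
  have hσ := D.hσ
  rw [e, abs_of_nonneg (show (0:ℝ) ≤ k * σ by positivity)]; exact this

lemma Disc.lip (W : Wall S l Θ F C P) (D : Disc S l Θ C P η ε h σ N M R) {n n' : ℕ} (hn : n ≤ M) (hn' : n' ≤ M) {i j : ℤ}
    (h1 : -(N : ℤ) ≤ i) (h2 : i ≤ N) (h3 : -(N : ℤ) ≤ j) (h4 : j ≤ N) :
    |R n' j - R n i| ≤ S.K1 * |(ε + n' * σ) - (ε + n * σ)| + S.v2 * |j * h - i * h| + 2 * S.v2 * h := by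
  have hN := D.hN
  have hh0 := D.h0; have hv2 := S.v2_pos
  -- go through i0 = max i (-N+1)
  obtain ⟨i0, a1, a2, a3⟩ : ∃ i0 : ℤ, -(N : ℤ) < i0 ∧ i0 ≤ N ∧ |(i0 : ℝ) * h - i * h| ≤ h := by
    by_cases hi : i = -(N : ℤ)
    · refine ⟨i + 1, by omega, by omega, ?_⟩
      push_cast
      have : ((i : ℝ) + 1) * h - i * h = h := by ring
      rw [this, abs_of_pos hh0]
    · exact ⟨i, by omega, h2, by simpa using hh0.le⟩
  have b1 := D.lipψ W hn h1 h2 a1.le a2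
  have b2 := D.lipx W hn hn' a1 a2
  have b3 := D.lipψ W hn' a1.le a2 h3 h4
  have c1 := abs_sub_le (R n' j) (R n' i0) (R n i)
  have c2 := abs_sub_le (R n' i0) (R n i0) (R n i)
  have c3 := abs_sub_le ((j : ℝ) * h) (i * h) (i0 * h)
  rw [abs_sub_comm ((i : ℝ) * h) (i0 * h)] at c3
  have d1 := mul_le_mul_of_nonneg_left a3 hv2.le
  have d2 := mul_le_mul_of_nonneg_left (c3.trans (add_le_add_right a3 _)) hv2.le
  linarith

lemma Disc.bdd (W : Wall S l Θ F C P) (D : Disc S l Θ C P η ε h σ N M R) {n : ℕ} (hn : n ≤ M) {i : ℤ}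
    (h1 : -(N : ℤ) ≤ i) (h2 : i ≤ N) : |R n i| ≤ S.Y0 + S.v2 * S.m := by
  obtain ⟨x1, x2⟩ := D.xn hn
  have H := W.small _ x1 x2
  have hX := H.hX; have ha := S.ha; have hh0 := D.h0; have hv2 := S.v2_pos
  have y1 := D.Ylo n hn i h1 h2
  have y2 := (D.Yhi n hn i h1 h2).trans H.hY
  have y0 : 0 ≤ Yv (R n) i := le_trans (by positivity) y1
  have s := D.lipψ W hn (i := -i) (j := i) (by omega) (by omega) h1 h2
  have e : |(i : ℝ) * h - ((-i : ℤ) : ℝ) * h| ≤ 2 * S.m := by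
    have i1 : (i : ℝ) ≤ N := by exact_mod_cast h2
    have i2 : -(N : ℝ) ≤ i := by exact_mod_cast h1
    push_cast
    rw [← D.Nh, abs_le]
    constructor <;> nlinarith
  have s' := s.trans (mul_le_mul_of_nonneg_left e hv2.le)
  have e2 : R n i = -Yv (R n) i + (R n i - R n (-i)) / 2 := by unfold Yv; ring
  rw [abs_le] at s'
  rw [e2, abs_le]
  constructor <;> linarith

/-- index functions -/
noncomputable def nI (ε σ x : ℝ) : ℕ := ⌊(x - ε) / σ⌋₊
noncomputable def iI (h ψ : ℝ) : ℤ := ⌊ψ / h⌋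

lemma Disc.nI_le (D : Disc S l Θ C P η ε h σ N M R) {x : ℝ} (hx : x ≤ l) : nI ε σ x ≤ M := by
  unfold nI
  apply Nat.floor_le_of_le
  rw [div_le_iff₀ D.hσ]; linarith [D.hM]

lemma Disc.nI_close (D : Disc S l Θ C P η ε h σ N M R) {x : ℝ} (hx0 : 0 ≤ x) :
    |ε + nI ε σ x * σ - x| ≤ η := by
  have hσ := D.hσ
  unfold nI
  by_cases hx : x < ε
  · have : ⌊(x - ε) / σ⌋₊ = 0 := by
      apply Nat.floor_of_nonpos
      apply div_nonpos_of_nonpos_of_nonneg <;> linarith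
    rw [this]
    have := D.hεη
    rw [abs_le]; push_cast; constructor <;> linarith
  · push Not at hx
    have h1 := Nat.floor_le (a := (x - ε) / σ) (div_nonneg (by linarith) hσ.le)
    have h2 := Nat.lt_floor_add_one ((x - ε) / σ)
    rw [le_div_iff₀ hσ] at h1
    rw [div_lt_iff₀ hσ] at h2
    have := D.hση
    rw [abs_le]; constructor <;> nlinarith

lemma Disc.iI_mem (D : Disc S l Θ C P η ε h σ N M R) {ψ : ℝ} (h1 : -S.m ≤ ψ) (h2 : ψ ≤ S.m) :
    -(N : ℤ) ≤ iI h ψ ∧ iI h ψ ≤ N := by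
  have hh0 := D.h0
  unfold iI
  rw [← D.Nh] at h1 h2
  constructor
  · rw [Int.le_floor, le_div_iff₀ hh0]; push_cast; linarith
  · rw [Int.floor_le_iff, div_lt_iff₀ hh0]; push_cast; nlinarith

lemma Disc.iI_close (D : Disc S l Θ C P η ε h σ N M R) (ψ : ℝ) :
    ψ - h < iI h ψ * h ∧ iI h ψ * h ≤ ψ ∧ |iI h ψ * h - ψ| ≤ η := by
  have hh0 := D.h0
  unfold iI
  have h1 := Int.floor_le (ψ / h)
  have h2 := Int.lt_floor_add_one (ψ / h)
  rw [le_div_iff₀ hh0] at h1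
  rw [div_lt_iff₀ hh0] at h2
  have := D.hhη
  refine ⟨by nlinarith, h1, ?_⟩
  rw [abs_le]; constructor <;> nlinarith

lemma iI_mono (hh : 0 < h) {ψ ψ' : ℝ} (hψ : ψ ≤ ψ') : iI h ψ ≤ iI h ψ' := by
  unfold iI; apply Int.floor_le_floor; gcongr

lemma Disc.iI_neg (D : Disc S l Θ C P η ε h σ N M R) (ψ : ℝ) :
    |(iI h (-ψ) : ℝ) * h - ((-iI h ψ : ℤ) : ℝ) * h| ≤ h := by
  have a := D.iI_close ψ
  have b := D.iI_close (-ψ)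
  have hh0 := D.h0
  have h1 : (-2 : ℝ) < ((iI h (-ψ) + iI h ψ : ℤ) : ℝ) := by
    push_cast
    by_contra hc
    push Not at hc
    nlinarith
  have h2 : (-1 : ℤ) ≤ iI h (-ψ) + iI h ψ := by
    have : (-2 : ℤ) < iI h (-ψ) + iI h ψ := by exact_mod_cast h1
    omega
  have h3 : (-1 : ℝ) ≤ (iI h (-ψ) : ℝ) + iI h ψ := by exact_mod_cast h2
  push_cast
  rw [abs_le]; constructor <;> nlinarith

lemma nI_grid (hσ : 0 < σ) (n : ℕ) : nI ε σ (ε + n * σ) = n := by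
  unfold nI
  have : (ε + n * σ - ε) / σ = n := by field_simp; ring
  rw [this]; simp

lemma iI_grid (hh : 0 < h) (i : ℤ) : iI h (i * h) = i := by
  unfold iI
  have : (i : ℝ) * h / h = i := by field_simp
  rw [this]; simp

lemma Disc.rlip (W : Wall S l Θ F C P) (D : Disc S l Θ C P η ε h σ N M R) {x x' ψ ψ' : ℝ}
    (hx0 : 0 ≤ x) (hx1 : x ≤ l) (hx0' : 0 ≤ x') (hx1' : x' ≤ l) (hψ : -S.m ≤ ψ) (hψ1 : ψ ≤ S.m)
    (hψ' : -S.m ≤ ψ') (hψ1' : ψ' ≤ S.m) :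
    |R (nI ε σ x') (iI h ψ') - R (nI ε σ x) (iI h ψ)| ≤
      S.K1 * |x' - x| + S.v2 * |ψ' - ψ| + (2 * S.K1 + 4 * S.v2) * η := by
  have := D.lip W (D.nI_le hx1) (D.nI_le hx1') (D.iI_mem hψ hψ1).1 (D.iI_mem hψ hψ1).2 (D.iI_mem hψ' hψ1').1 (D.iI_mem hψ' hψ1').2
  have a1 := D.nI_close hx0
  have a2 := D.nI_close hx0'
  have b1 := (D.iI_close ψ).2.2
  have b2 := (D.iI_close ψ').2.2
  have hK := S.K1_pos; have hv2 := S.v2_pos; have hη := D.hhη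
  have c1 : |(ε + nI ε σ x' * σ) - (ε + nI ε σ x * σ)| ≤ |x' - x| + 2 * η := by
    rw [abs_le] at *
    have e1 := le_abs_self (x' - x); have e2 := neg_abs_le (x' - x)
    constructor <;> linarith
  -- refine: use sharper i-bound
  have c3 : |(iI h ψ' : ℝ) * h - iI h ψ * h| ≤ |ψ' - ψ| + h := by
    have e1 := le_abs_self (ψ' - ψ); have e2 := neg_abs_le (ψ' - ψ)
    rw [abs_le]
    constructor
    · linarith [(D.iI_close ψ).2.1, (D.iI_close ψ').1]
    · linarith [(D.iI_close ψ').2.1, (D.iI_close ψ).1]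
  have d1 := mul_le_mul_of_nonneg_left c1 hK.le
  have d2 := mul_le_mul_of_nonneg_left c3 hv2.le
  have d3 := mul_le_mul_of_nonneg_left hη hv2.le
  have hη0 : 0 ≤ η := D.h0.le.trans hη
  have : 0 ≤ S.v2 * η := by positivity
  linarith
end disc
end

section
open Filter Topology

structure Fam (S : SC) (l : ℝ) (Θ C : ℝ → ℝ) (P : ℝ → ℝ → ℝ) (η ε h σ : ℕ → ℝ) (N M : ℕ → ℕ)
    (Rk : ℕ → ℕ → ℤ → ℝ) (U : Ultrafilter ℕ) (R : ℝ → ℝ → ℝ) : Prop where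
  D : ∀ k, Disc S l Θ C P (η k) (ε k) (h k) (σ k) (N k) (M k) (Rk k)
  η0 : Tendsto η U (𝓝 0)
  lim : ∀ x, 0 ≤ x → x ≤ l → ∀ ψ, -S.m ≤ ψ → ψ ≤ S.m →
    Tendsto (fun k => Rk k (nI (ε k) (σ k) x) (iI (h k) ψ)) U (𝓝 (R x ψ))

noncomputable def YR (R : ℝ → ℝ → ℝ) (x ψ : ℝ) : ℝ := -(R x ψ + R x (-ψ)) / 2

lemma exists_fam {S : SC} {l : ℝ} {Θ F C : ℝ → ℝ} {P : ℝ → ℝ → ℝ} (W : Wall S l Θ F C P) :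
    ∃ η ε h σ N M Rk U R, Fam S l Θ C P η ε h σ N M Rk U R := by
  have H : ∀ k : ℕ, ∃ (ε h σ : ℝ) (N M : ℕ) (R : ℕ → ℤ → ℝ), Disc S l Θ C P (1 / ((k : ℝ) + 1)) ε h σ N M R :=
    fun k => exists_disc W (by positivity)
  choose ε h σ N M Rk D using H
  let U : Ultrafilter ℕ := hyperfilter ℕ
  have hU : (U : Filter ℕ) ≤ atTop := Nat.hyperfilter_le_atTop
  have H : ∀ x ψ, ∃ r, (0 ≤ x → x ≤ l → -S.m ≤ ψ → ψ ≤ S.m →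
    Tendsto (fun k => Rk k (nI (ε k) (σ k) x) (iI (h k) ψ)) U (𝓝 r)) := by
    intro x ψ
    by_cases hc : 0 ≤ x ∧ x ≤ l ∧ -S.m ≤ ψ ∧ ψ ≤ S.m
    · obtain ⟨c1, c2, c3, c4⟩ := hc
      have hK : IsCompact (Set.Icc (-(S.Y0 + S.v2 * S.m)) (S.Y0 + S.v2 * S.m)) := isCompact_Icc
      obtain ⟨r, -, hr⟩ := hK.ultrafilter_le_nhds (U.map (fun k => Rk k (nI (ε k) (σ k) x) (iI (h k) ψ))) (by
        rw [le_principal_iff]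
        apply Filter.Eventually.of_forall (f := (U : Filter ℕ))
        intro k
        have := (D k).bdd W ((D k).nI_le c2) ((D k).iI_mem c3 c4).1 ((D k).iI_mem c3 c4).2
        exact abs_le.mp this)
      exact ⟨r, fun _ _ _ _ => hr⟩
    · exact ⟨0, fun a b c d => absurd ⟨a, b, c, d⟩ hc⟩
  choose R hR using H
  exact ⟨_, ε, h, σ, N, M, Rk, U, R, D, tendsto_one_div_add_atTop_nhds_zero_nat.mono_left hU,
    fun x a b ψ c d => hR x ψ a b c d⟩

section
variable {S : SC} {l : ℝ} {Θ F C : ℝ → ℝ} {P : ℝ → ℝ → ℝ} {η ε h σ : ℕ → ℝ} {N M : ℕ → ℕ}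
    {Rk : ℕ → ℕ → ℤ → ℝ} {U : Ultrafilter ℕ} {R : ℝ → ℝ → ℝ}

lemma Fam.lip (W : Wall S l Θ F C P) (D : Fam S l Θ C P η ε h σ N M Rk U R) {x x' ψ ψ' : ℝ}
    (hx0 : 0 ≤ x) (hx1 : x ≤ l) (hx0' : 0 ≤ x') (hx1' : x' ≤ l) (hψ : -S.m ≤ ψ) (hψ1 : ψ ≤ S.m)
    (hψ' : -S.m ≤ ψ') (hψ1' : ψ' ≤ S.m) :
    |R x' ψ' - R x ψ| ≤ S.K1 * |x' - x| + S.v2 * |ψ' - ψ| := by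
  have t1 := ((D.lim x' hx0' hx1' ψ' hψ' hψ1').sub (D.lim x hx0 hx1 ψ hψ hψ1)).abs
  have t2 : Tendsto (fun k => S.K1 * |x' - x| + S.v2 * |ψ' - ψ| + (2 * S.K1 + 4 * S.v2) * η k) U
      (𝓝 (S.K1 * |x' - x| + S.v2 * |ψ' - ψ| + (2 * S.K1 + 4 * S.v2) * 0)) :=
    tendsto_const_nhds.add (D.η0.const_mul _)
  have := le_of_tendsto_of_tendsto' t1 t2 (fun k => (D.D k).rlip W hx0 hx1 hx0' hx1' hψ hψ1 hψ' hψ1')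
  simpa using this

lemma Fam.h0 (D : Fam S l Θ C P η ε h σ N M Rk U R) : Tendsto h U (𝓝 0) :=
  squeeze_zero (fun k => (D.D k).h0.le) (fun k => (D.D k).hhη) D.η0

lemma Fam.σ0 (D : Fam S l Θ C P η ε h σ N M Rk U R) : Tendsto σ U (𝓝 0) :=
  squeeze_zero (fun k => (D.D k).hσ.le) (fun k => (D.D k).hση) D.η0

lemma Fam.xlim (D : Fam S l Θ C P η ε h σ N M Rk U R) {x : ℝ} (hx0 : 0 ≤ x) :
    Tendsto (fun k => ε k + nI (ε k) (σ k) x * σ k) U (𝓝 x) := by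
  rw [tendsto_iff_norm_sub_tendsto_zero]
  exact squeeze_zero (fun k => norm_nonneg _) (fun k => (D.D k).nI_close hx0) D.η0

lemma Fam.ψlim (D : Fam S l Θ C P η ε h σ N M Rk U R) (ψ : ℝ) :
    Tendsto (fun k => (iI (h k) ψ : ℝ) * h k) U (𝓝 ψ) := by
  rw [tendsto_iff_norm_sub_tendsto_zero]
  exact squeeze_zero (fun k => norm_nonneg _) (fun k => ((D.D k).iI_close ψ).2.2) D.η0

/-- convergence along arbitrary grid sequences -/
lemma Fam.conv (W : Wall S l Θ F C P) (D : Fam S l Θ C P η ε h σ N M Rk U R) (n : ℕ → ℕ) (i : ℕ → ℤ)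
    (hn : ∀ k, n k ≤ M k) (hi : ∀ k, -(N k : ℤ) ≤ i k ∧ i k ≤ N k) {x ψ : ℝ}
    (hx0 : 0 ≤ x) (hx1 : x ≤ l) (hψ : -S.m ≤ ψ) (hψ1 : ψ ≤ S.m)
    (hx : Tendsto (fun k => ε k + n k * σ k) U (𝓝 x)) (hy : Tendsto (fun k => (i k : ℝ) * h k) U (𝓝 ψ)) :
    Tendsto (fun k => Rk k (n k) (i k)) U (𝓝 (R x ψ)) := by
  have t := D.lim x hx0 hx1 ψ hψ hψ1
  have e : Tendsto (fun k => Rk k (n k) (i k) - Rk k (nI (ε k) (σ k) x) (iI (h k) ψ)) U (𝓝 0) := by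
    have z : Tendsto (fun k => S.K1 * |(ε k + n k * σ k) - (ε k + nI (ε k) (σ k) x * σ k)| +
        S.v2 * |(i k : ℝ) * h k - iI (h k) ψ * h k| + 2 * S.v2 * h k) U (𝓝 0) := by
      have := ((((hx.sub (D.xlim hx0)).abs).const_mul S.K1).add
        (((hy.sub (D.ψlim ψ)).abs).const_mul S.v2)).add (D.h0.const_mul (2 * S.v2))
      simpa using this
    apply squeeze_zero_norm _ z
    intro k
    exact (D.D k).lip W ((D.D k).nI_le hx1) (hn k) ((D.D k).iI_mem hψ hψ1).1 ((D.D k).iI_mem hψ hψ1).2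
      (hi k).1 (hi k).2
  simpa using e.add t

lemma Fam.Ylim (W : Wall S l Θ F C P) (D : Fam S l Θ C P η ε h σ N M Rk U R) (n : ℕ → ℕ) (i : ℕ → ℤ)
    (hn : ∀ k, n k ≤ M k) (hi : ∀ k, -(N k : ℤ) ≤ i k ∧ i k ≤ N k) {x ψ : ℝ}
    (hx0 : 0 ≤ x) (hx1 : x ≤ l) (hψ : -S.m ≤ ψ) (hψ1 : ψ ≤ S.m)
    (hx : Tendsto (fun k => ε k + n k * σ k) U (𝓝 x)) (hy : Tendsto (fun k => (i k : ℝ) * h k) U (𝓝 ψ)) :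
    Tendsto (fun k => Yv (Rk k (n k)) (i k)) U (𝓝 (YR R x ψ)) := by
  have t1 := D.conv W n i hn hi hx0 hx1 hψ hψ1 hx hy
  have t2 := D.conv W n (fun k => - i k) hn (fun k => by have := hi k; omega) (ψ := -ψ)
    hx0 hx1 (by linarith) (by linarith) hx (by simpa using hy.neg)
  exact ((t1.add t2).neg).div_const 2

lemma Fam.bc (W : Wall S l Θ F C P) (D : Fam S l Θ C P η ε h σ N M Rk U R) (hΘ : ContinuousOn Θ (Set.Icc 0 l))
    {x : ℝ} (hx0 : 0 ≤ x) (hx1 : x ≤ l) : R x (-S.m) = R x S.m - 2 * Θ x := by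
  have hm := S.hm
  have t1 := D.conv W (fun k => nI (ε k) (σ k) x) (fun k => -(N k : ℤ)) (fun k => (D.D k).nI_le hx1)
    (fun k => by omega) (ψ := -S.m) hx0 hx1 (by linarith) (by linarith) (D.xlim hx0)
    (by
      have : (fun k => ((-(N k : ℤ) : ℤ) : ℝ) * h k) = fun k => -S.m := by
        funext k; push_cast; linarith [(D.D k).Nh]
      rw [this]; exact tendsto_const_nhds)
  have t2 := D.conv W (fun k => nI (ε k) (σ k) x) (fun k => (N k : ℤ)) (fun k => (D.D k).nI_le hx1)
    (fun k => by omega) (ψ := S.m) hx0 hx1 (by linarith) (by linarith) (D.xlim hx0)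
    (by
      have : (fun k => ((N k : ℤ) : ℝ) * h k) = fun k => S.m := by
        funext k; push_cast; linarith [(D.D k).Nh]
      rw [this]; exact tendsto_const_nhds)
  have t3 : Tendsto (fun k => Θ (ε k + nI (ε k) (σ k) x * σ k)) U (𝓝 (Θ x)) := by
    have c := hΘ x ⟨hx0, hx1⟩
    apply c.tendsto.comp
    rw [tendsto_nhdsWithin_iff]
    refine ⟨D.xlim hx0, Eventually.of_forall fun k => ?_⟩
    have := (D.D k).xn ((D.D k).nI_le hx1)
    exact ⟨this.1.le, this.2⟩
  have t4 := t2.sub (t3.const_mul 2)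
  refine tendsto_nhds_unique (t1.congr fun k => ?_) t4
  exact (D.D k).bc _ ((D.D k).nI_le hx1)

lemma Fam.Ybd (W : Wall S l Θ F C P) (D : Fam S l Θ C P η ε h σ N M Rk U R)
    {x ψ : ℝ} (hx0 : 0 ≤ x) (hx1 : x ≤ l) (hψ : -S.m ≤ ψ) (hψ1 : ψ ≤ S.m) :
    (S.a * x ^ S.μ) ^ 3 ≤ YR R x ψ ∧ YR R x ψ ≤ (S.b * x ^ S.μ) ^ 3 := by
  have hμ := S.hμ
  have t := D.Ylim W (fun k => nI (ε k) (σ k) x) (fun k => iI (h k) ψ) (fun k => (D.D k).nI_le hx1)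
    (fun k => (D.D k).iI_mem hψ hψ1) hx0 hx1 hψ hψ1 (D.xlim hx0) (D.ψlim ψ)
  have tX : Tendsto (fun k => (ε k + nI (ε k) (σ k) x * σ k) ^ S.μ) U (𝓝 (x ^ S.μ)) :=
    (D.xlim hx0).rpow_const (Or.inr (by linarith))
  constructor
  · exact le_of_tendsto_of_tendsto' ((tX.const_mul S.a).pow 3) t fun k =>
      (D.D k).Ylo _ ((D.D k).nI_le hx1) _ ((D.D k).iI_mem hψ hψ1).1 ((D.D k).iI_mem hψ hψ1).2
  · exact le_of_tendsto_of_tendsto' t ((tX.const_mul S.b).pow 3) fun k =>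
      (D.D k).Yhi _ ((D.D k).nI_le hx1) _ ((D.D k).iI_mem hψ hψ1).1 ((D.D k).iI_mem hψ hψ1).2

lemma Fam.slope (W : Wall S l Θ F C P) (D : Fam S l Θ C P η ε h σ N M Rk U R)
    {x ψ ψ' : ℝ} (hx0 : 0 < x) (hx1 : x ≤ l) (hψ : -S.m ≤ ψ) (hψψ : ψ ≤ ψ') (hψ1 : ψ' ≤ S.m) :
    S.v1 * ((x ^ S.μ) ^ 4 / x) * (ψ' - ψ) ≤ R x ψ' - R x ψ ∧
    R x ψ' - R x ψ ≤ S.v2 * ((x ^ S.μ) ^ 4 / x) * (ψ' - ψ) := by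
  have hμ := S.hμ
  have t := (D.lim x hx0.le hx1 ψ' (hψ.trans hψψ) hψ1).sub (D.lim x hx0.le hx1 ψ hψ (hψψ.trans hψ1))
  have tX : Tendsto (fun k => (ε k + nI (ε k) (σ k) x * σ k) ^ S.μ) U (𝓝 (x ^ S.μ)) :=
    (D.xlim hx0.le).rpow_const (Or.inr (by linarith))
  have tq := (tX.pow 4).div (D.xlim hx0.le) hx0.ne'
  have td : Tendsto (fun k => ((iI (h k) ψ' : ℝ) - iI (h k) ψ) * h k) U (𝓝 (ψ' - ψ)) :=
    ((D.ψlim ψ').sub (D.ψlim ψ)).congr fun k => by ring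
  have key := fun k => (D.D k).slope ((D.D k).nI_le hx1) ((D.D k).iI_mem hψ (hψψ.trans hψ1)).1
    (iI_mono (D.D k).h0 hψψ) ((D.D k).iI_mem (hψ.trans hψψ) hψ1).2
  exact ⟨le_of_tendsto_of_tendsto' ((tq.const_mul S.v1).mul td) t fun k => (key k).1,
    le_of_tendsto_of_tendsto' t ((tq.const_mul S.v2).mul td) fun k => (key k).2⟩

lemma Fam.Yslope (W : Wall S l Θ F C P) (D : Fam S l Θ C P η ε h σ N M Rk U R)
    {x ψ ψ' : ℝ} (hx0 : 0 < x) (hx1 : x ≤ l) (hψ : -S.m ≤ ψ) (hψψ : ψ ≤ ψ') (hψ1 : ψ' ≤ S.m) :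
    |YR R x ψ' - YR R x ψ| ≤ (ψ' - ψ) * (S.Gc * ((x ^ S.μ) ^ 5 / x ^ 2)) := by
  have hμ := S.hμ
  have t1 := D.Ylim W (fun k => nI (ε k) (σ k) x) (fun k => iI (h k) ψ') (fun k => (D.D k).nI_le hx1)
    (fun k => (D.D k).iI_mem (hψ.trans hψψ) hψ1) hx0.le hx1 (hψ.trans hψψ) hψ1 (D.xlim hx0.le) (D.ψlim ψ')
  have t2 := D.Ylim W (fun k => nI (ε k) (σ k) x) (fun k => iI (h k) ψ) (fun k => (D.D k).nI_le hx1)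
    (fun k => (D.D k).iI_mem hψ (hψψ.trans hψ1)) hx0.le hx1 hψ (hψψ.trans hψ1) (D.xlim hx0.le) (D.ψlim ψ)
  have tX : Tendsto (fun k => (ε k + nI (ε k) (σ k) x * σ k) ^ S.μ) U (𝓝 (x ^ S.μ)) :=
    (D.xlim hx0.le).rpow_const (Or.inr (by linarith))
  have tq := (tX.pow 5).div ((D.xlim hx0.le).pow 2) (by positivity)
  have td : Tendsto (fun k => ((iI (h k) ψ' : ℝ) - iI (h k) ψ) * h k) U (𝓝 (ψ' - ψ)) :=
    ((D.ψlim ψ').sub (D.ψlim ψ)).congr fun k => by ring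
  exact le_of_tendsto_of_tendsto' (t1.sub t2).abs (td.mul (tq.const_mul S.Gc)) fun k =>
    (D.D k).Yslope ((D.D k).nI_le hx1) ((D.D k).iI_mem hψ (hψψ.trans hψ1)).1
    (iI_mono (D.D k).h0 hψψ) ((D.D k).iI_mem (hψ.trans hψψ) hψ1).2

end
end

section
open Filter Topology

lemma sum_lem (v c : ℕ → ℕ → ℝ) (T I : ℕ) (h σ c0 e K τ R0 α β : ℝ) (hh : 0 < h) (hσ : 0 < σ) (hc0 : 0 ≤ c0)
    (he : 0 ≤ e) (hK : 0 ≤ K)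
    (upd : ∀ t, t < T → ∀ j, j < I → v (t + 1) (j + 1) = v t (j + 1) - σ / h * c t j * (v t (j + 1) - v t j))
    (hc : ∀ t, t < T → ∀ j, j < I → |c t j - c0| ≤ e)
    (hd : ∀ t, t < T → ∀ j, j < I → |v t (j + 1) - v t j| ≤ K * h)
    (ha : ∀ t, t ≤ T → ∀ j, j ≤ I → |v t j - (R0 + α * (t * σ) + β * (j * h))| ≤ τ) :
    |α + c0 * β| * ((I * h) * (T * σ)) ≤ (I * h) * (2 * τ) + c0 * (T * σ) * (2 * τ) + e * K * ((I * h) * (T * σ)) := by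
  obtain ⟨u, hu⟩ : ∃ u : ℕ → ℕ → ℝ, u = fun t j => v t j - (R0 + α * (t * σ) + β * (j * h)) := ⟨_, rfl⟩
  have step : ∀ t ∈ Finset.range T, ∀ j ∈ Finset.range I,
      (α + c0 * β) * (σ * h) = - (h * (u (t + 1) (j + 1) - u t (j + 1))) - σ * c0 * (u t (j + 1) - u t j)
        - σ * ((c t j - c0) * (v t (j + 1) - v t j)) := by
    intro t ht j hj
    have := upd t (Finset.mem_range.mp ht) j (Finset.mem_range.mp hj)
    simp only [hu]
    rw [this]; push_cast; field_simp; ring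
  have S1 : ∑ t ∈ Finset.range T, ∑ j ∈ Finset.range I, (α + c0 * β) * (σ * h) =
      ∑ t ∈ Finset.range T, ∑ j ∈ Finset.range I, (- (h * (u (t + 1) (j + 1) - u t (j + 1))) - σ * c0 * (u t (j + 1) - u t j)
        - σ * ((c t j - c0) * (v t (j + 1) - v t j))) :=
    Finset.sum_congr rfl fun t ht => Finset.sum_congr rfl fun j hj => step t ht j hj
  simp only [Finset.sum_sub_distrib, Finset.sum_const, Finset.card_range, nsmul_eq_mul, Finset.sum_neg_distrib,
    ← Finset.mul_sum] at S1
  have e1 : ∑ t ∈ Finset.range T, (∑ j ∈ Finset.range I, u (t + 1) (j + 1)) - ∑ t ∈ Finset.range T, (∑ j ∈ Finset.range I, u t (j + 1))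
     = ∑ j ∈ Finset.range I, (u T (j + 1) - u 0 (j + 1)) := by
    rw [← Finset.sum_sub_distrib, Finset.sum_range_sub (fun t => ∑ j ∈ Finset.range I, u t (j + 1)), ← Finset.sum_sub_distrib]
  have e2 : ∑ t ∈ Finset.range T, (∑ j ∈ Finset.range I, u t (j + 1)) - ∑ t ∈ Finset.range T, (∑ j ∈ Finset.range I, u t j)
     = ∑ t ∈ Finset.range T, (u t I - u t 0) := by
    rw [← Finset.sum_sub_distrib]
    exact Finset.sum_congr rfl fun t _ => by rw [← Finset.sum_sub_distrib, Finset.sum_range_sub (fun j => u t j)]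
  rw [e1, e2] at S1
  have b1 : |∑ j ∈ Finset.range I, (u T (j + 1) - u 0 (j + 1))| ≤ I * (2 * τ) := by
    refine (Finset.abs_sum_le_sum_abs _ _).trans ?_
    rw [← nsmul_eq_mul]
    conv_rhs => rw [← Finset.card_range I]
    apply Finset.sum_le_card_nsmul
    intro j hj
    have hj' := Finset.mem_range.mp hj
    have a1 := ha T le_rfl (j + 1) hj'
    have a2 := ha 0 (Nat.zero_le _) (j + 1) hj'
    refine (abs_sub _ _).trans ?_
    simp only [hu]; linarith
  have b2 : |∑ t ∈ Finset.range T, (u t I - u t 0)| ≤ T * (2 * τ) := by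
    refine (Finset.abs_sum_le_sum_abs _ _).trans ?_
    rw [← nsmul_eq_mul]
    conv_rhs => rw [← Finset.card_range T]
    apply Finset.sum_le_card_nsmul
    intro t ht
    have ht' := (Finset.mem_range.mp ht).le
    have a1 := ha t ht' I le_rfl
    have a2 := ha t ht' 0 (Nat.zero_le _)
    refine (abs_sub _ _).trans ?_
    simp only [hu]; linarith
  have b3 : |∑ t ∈ Finset.range T, ∑ j ∈ Finset.range I, ((c t j - c0) * (v t (j + 1) - v t j))| ≤ T * (I * (e * (K * h))) := by
    refine (Finset.abs_sum_le_sum_abs _ _).trans ?_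
    rw [← nsmul_eq_mul]
    conv_rhs => rw [← Finset.card_range T]
    apply Finset.sum_le_card_nsmul
    intro t ht
    refine (Finset.abs_sum_le_sum_abs _ _).trans ?_
    rw [← nsmul_eq_mul]
    conv_rhs => rw [← Finset.card_range I]
    apply Finset.sum_le_card_nsmul
    intro j hj
    rw [abs_mul]
    exact mul_le_mul (hc t (Finset.mem_range.mp ht) j (Finset.mem_range.mp hj)) (hd t (Finset.mem_range.mp ht) j (Finset.mem_range.mp hj))
      (abs_nonneg _) he
  have e0 : |α + c0 * β| * ((I * h) * (T * σ)) = |(T : ℝ) * (I * ((α + c0 * β) * (σ * h)))| := by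
    rw [abs_mul, abs_mul, abs_mul, Nat.abs_cast, Nat.abs_cast, abs_of_pos (mul_pos hσ hh)]; ring
  rw [e0, S1]
  generalize ∑ j ∈ Finset.range I, (u T (j + 1) - u 0 (j + 1)) = s1 at *
  generalize ∑ t ∈ Finset.range T, (u t I - u t 0) = s2 at *
  generalize ∑ t ∈ Finset.range T, ∑ j ∈ Finset.range I, ((c t j - c0) * (v t (j + 1) - v t j)) = s3 at *
  calc |-(h * s1) - σ * c0 * s2 - σ * s3| ≤ h * |s1| + σ * c0 * |s2| + σ * |s3| := by
        have t1 := abs_sub (-(h * s1) - σ * c0 * s2) (σ * s3)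
        have t2 := abs_sub (-(h * s1)) (σ * c0 * s2)
        rw [abs_neg, abs_mul, abs_of_pos hh, abs_mul (σ * c0), abs_of_nonneg (mul_nonneg hσ.le hc0)] at t2
        rw [abs_mul σ, abs_of_pos hσ] at t1
        linarith
    _ ≤ h * (I * (2 * τ)) + σ * c0 * (T * (2 * τ)) + σ * (T * (I * (e * (K * h)))) := by gcongr
    _ = _ := by ring
end

section
open Filter Topology

section
variable {S : SC} {l : ℝ} {Θ F C : ℝ → ℝ} {P : ℝ → ℝ → ℝ} {η ε h σ : ℕ → ℝ} {N M : ℕ → ℕ}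
    {Rk : ℕ → ℕ → ℤ → ℝ} {U : Ultrafilter ℕ} {R : ℝ → ℝ → ℝ}

lemma Disc.im {S : SC} {l : ℝ} {Θ C : ℝ → ℝ} {P : ℝ → ℝ → ℝ} {η ε h σ : ℝ} {N M : ℕ} {R : ℕ → ℤ → ℝ}
    (D : Disc S l Θ C P η ε h σ N M R) {i : ℤ} (h1 : -(N : ℤ) ≤ i) (h2 : i ≤ N) :
    -S.m ≤ i * h ∧ i * h ≤ S.m := by
  have i1 : (i : ℝ) ≤ N := by exact_mod_cast h2
  have i2 : -(N : ℝ) ≤ i := by exact_mod_cast h1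
  have := D.h0
  rw [← D.Nh]; constructor <;> nlinarith

lemma ulim {U : Ultrafilter ℕ} {u : ℕ → ℝ} {A B : ℝ} (hu : ∀ k, A ≤ u k ∧ u k ≤ B) :
    ∃ r, A ≤ r ∧ r ≤ B ∧ Tendsto u U (𝓝 r) := by
  obtain ⟨r, hr1, hr⟩ := (isCompact_Icc (a := A) (b := B)).ultrafilter_le_nhds (U.map u) (by
        rw [le_principal_iff]
        exact Filter.Eventually.of_forall (f := (U : Filter ℕ)) (fun k => hu k))
  exact ⟨r, hr1.1, hr1.2, hr⟩

lemma Fam.unif (W : Wall S l Θ F C P) (D : Fam S l Θ C P η ε h σ N M Rk U R) {e : ℝ} (he : 0 < e) :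
    ∀ᶠ k in (U : Filter ℕ), ∀ n : ℕ, n ≤ M k → ∀ i : ℤ, -(N k : ℤ) ≤ i → i ≤ N k →
      |Rk k n i - R (ε k + n * σ k) (i * h k)| ≤ e := by
  by_contra hc
  rw [← Ultrafilter.eventually_not] at hc
  have H : ∀ k, ∃ (n : ℕ) (i : ℤ), n ≤ M k ∧ -(N k : ℤ) ≤ i ∧ i ≤ N k ∧
      ((¬ ∀ n : ℕ, n ≤ M k → ∀ i : ℤ, -(N k : ℤ) ≤ i → i ≤ N k →
      |Rk k n i - R (ε k + n * σ k) (i * h k)| ≤ e) → e < |Rk k n i - R (ε k + n * σ k) (i * h k)|) := by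
    intro k
    by_cases hk : ∀ n : ℕ, n ≤ M k → ∀ i : ℤ, -(N k : ℤ) ≤ i → i ≤ N k →
      |Rk k n i - R (ε k + n * σ k) (i * h k)| ≤ e
    · exact ⟨0, 0, Nat.zero_le _, by omega, by omega, fun h => absurd hk h⟩
    · have hk' := hk
      push Not at hk'
      obtain ⟨n, hn, i, h1, h2, h3⟩ := hk'
      exact ⟨n, i, hn, h1, h2, fun _ => h3⟩
  choose n i hn h1 h2 h3 using H
  obtain ⟨x, hx0, hx1, hx⟩ := ulim (U := U) (u := fun k => ε k + n k * σ k) (A := 0) (B := l)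
    (fun k => ⟨((D.D k).xn (hn k)).1.le, ((D.D k).xn (hn k)).2⟩)
  obtain ⟨ψ, hψ0, hψ1, hψ⟩ := ulim (U := U) (u := fun k => (i k : ℝ) * h k) (A := -S.m) (B := S.m)
    (fun k => (D.D k).im (h1 k) (h2 k))
  have t := D.conv W n i hn (fun k => ⟨h1 k, h2 k⟩) hx0 hx1 hψ0 hψ1 hx hψ
  have t2 : Tendsto (fun k => R (ε k + n k * σ k) (i k * h k) - R x ψ) U (𝓝 0) := by
    have z : Tendsto (fun k => S.K1 * |(ε k + n k * σ k) - x| + S.v2 * |(i k : ℝ) * h k - ψ|) U (𝓝 0) := by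
      have := (((hx.sub_const x).abs).const_mul S.K1).add (((hψ.sub_const ψ).abs).const_mul S.v2)
      simpa using this
    apply squeeze_zero_norm _ z
    intro k
    have a := (D.D k).xn (hn k)
    have b := (D.D k).im (h1 k) (h2 k)
    exact D.lip W hx0 hx1 a.1.le a.2 hψ0 hψ1 b.1 b.2
  have t3 : Tendsto (fun k => |Rk k (n k) (i k) - R (ε k + n k * σ k) (i k * h k)|) U (𝓝 0) := by
    have := ((t.sub_const (R x ψ)).sub t2).abs
    simpa using this
  have t4 := t3.eventually (eventually_lt_nhds he)
  obtain ⟨k, hk1, hk2⟩ := (hc.and t4).exists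
  exact absurd (h3 k hk1) (not_lt.mpr hk2.le)

lemma YR_lip (W : Wall S l Θ F C P) (D : Fam S l Θ C P η ε h σ N M Rk U R) {x x' ψ ψ' : ℝ}
    (hx0 : 0 ≤ x) (hx1 : x ≤ l) (hx0' : 0 ≤ x') (hx1' : x' ≤ l) (hψ : -S.m ≤ ψ) (hψ1 : ψ ≤ S.m)
    (hψ' : -S.m ≤ ψ') (hψ1' : ψ' ≤ S.m) :
    |YR R x' ψ' - YR R x ψ| ≤ S.K1 * |x' - x| + S.v2 * |ψ' - ψ| := by
  have a := D.lip W hx0 hx1 hx0' hx1' hψ hψ1 hψ' hψ1'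
  have b := D.lip W (ψ := -ψ) (ψ' := -ψ') hx0 hx1 hx0' hx1' (by linarith) (by linarith) (by linarith) (by linarith)
  have e : |-ψ' - -ψ| = |ψ' - ψ| := by rw [← abs_neg]; congr 1; ring
  rw [e] at b
  unfold YR
  rw [abs_le] at *
  constructor <;> linarith

lemma Yv_unif (D : Disc S l Θ C P (η k) (ε k) (h k) (σ k) (N k) (M k) (Rk k)) {e : ℝ}
    (H : ∀ n : ℕ, n ≤ M k → ∀ i : ℤ, -(N k : ℤ) ≤ i → i ≤ N k → |Rk k n i - R (ε k + n * σ k) (i * h k)| ≤ e)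
    {n : ℕ} (hn : n ≤ M k) {i : ℤ} (h1 : -(N k : ℤ) ≤ i) (h2 : i ≤ N k) :
    |Yv (Rk k n) i - YR R (ε k + n * σ k) (i * h k)| ≤ e := by
  have a := H n hn i h1 h2
  have b := H n hn (-i) (by omega) (by omega)
  unfold YR Yv
  push_cast at b
  rw [neg_mul] at b
  rw [abs_le] at *
  constructor <;> linarith

lemma alg_fin {X r a b c0 K δ : ℝ} (hr : 0 < r) (ha : r / 4 ≤ a) (hb : r / 4 ≤ b) (hc0 : 0 ≤ c0) (hδ : 0 < δ)
    (H : X * (a * b) ≤ a * (2 * (2 * (δ * r))) + c0 * b * (2 * (2 * (δ * r))) + δ * K * (a * b)) :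
    X ≤ δ * (16 + 16 * c0 + K) := by
  have ha0 : 0 < a := by linarith
  have hb0 : 0 < b := by linarith
  have hab : 0 < a * b := by positivity
  have : X * (a * b) ≤ δ * (16 + 16 * c0 + K) * (a * b) := by
    have e1 : a * r ≤ 4 * (a * b) := by nlinarith
    have e2 : b * r ≤ 4 * (a * b) := by nlinarith
    have e3 := mul_le_mul_of_nonneg_left e1 hδ.le
    have e4 := mul_le_mul_of_nonneg_left e2 (mul_nonneg hδ.le hc0)
    nlinarith
  exact le_of_mul_le_mul_right this hab

end
end

section
open Filter Topology

section
variable {S : SC} {l : ℝ} {Θ F C : ℝ → ℝ} {P : ℝ → ℝ → ℝ} {η ε h σ : ℕ → ℝ} {N M : ℕ → ℕ}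
    {Rk : ℕ → ℕ → ℤ → ℝ} {U : Ultrafilter ℕ} {R : ℝ → ℝ → ℝ}

lemma pde_coef {x0 Ym Yp δ : ℝ} (hP : ContinuousAt (fun p : ℝ × ℝ => P p.1 p.2) (x0, Ym))
    (hC : ContinuousAt C Yp) (hδ : 0 < δ) :
    ∃ ρ > 0, ∀ x Y Y', |x - x0| ≤ ρ → |Y - Ym| ≤ ρ → |Y' - Yp| ≤ ρ → |P x Y * C Y' - P x0 Ym * C Yp| ≤ δ := by
  have : ContinuousAt (fun p : ℝ × ℝ × ℝ => P p.1 p.2.1 * C p.2.2) (x0, Ym, Yp) := by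
    have h1 : ContinuousAt (fun p : ℝ × ℝ × ℝ => P p.1 p.2.1) (x0, Ym, Yp) :=
      ContinuousAt.comp (f := fun p : ℝ × ℝ × ℝ => (p.1, p.2.1)) (g := fun p : ℝ × ℝ => P p.1 p.2) hP (by fun_prop)
    have h2 : ContinuousAt (fun p : ℝ × ℝ × ℝ => C p.2.2) (x0, Ym, Yp) :=
      ContinuousAt.comp (f := fun p : ℝ × ℝ × ℝ => p.2.2) (g := C) hC (by fun_prop)
    exact h1.mul h2
  rw [Metric.continuousAt_iff] at this
  obtain ⟨ρ, hρ, H⟩ := this δ hδ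
  refine ⟨ρ / 2, by positivity, fun x Y Y' h1 h2 h3 => ?_⟩
  have := @H (x, Y, Y') (by
    rw [Prod.dist_eq, Prod.dist_eq]
    simp only [Real.dist_eq]
    refine max_lt (by linarith) (max_lt (by linarith) (by linarith)))
  rw [Real.dist_eq] at this
  exact this.le

lemma floor_step {r s : ℝ} (hs : 0 < s) (hr : 0 < r) (h : s ≤ r / 4) :
    r / 4 ≤ ⌊r / 2 / s⌋₊ * s ∧ ⌊r / 2 / s⌋₊ * s ≤ r / 2 := by
  have h1 := Nat.floor_le (a := r / 2 / s) (by positivity)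
  have h2 := Nat.lt_floor_add_one (r / 2 / s)
  rw [le_div_iff₀ hs] at h1
  rw [div_lt_iff₀ hs] at h2
  constructor <;> nlinarith

set_option maxHeartbeats 1000000 in
lemma Fam.pde_aux (W : Wall S l Θ F C P) (D : Fam S l Θ C P η ε h σ N M Rk U R) {x0 ψ0 α β : ℝ}
    (hx0 : 0 < x0) (hx1 : x0 < l) (hψ0 : -S.m < ψ0) (hψ1 : ψ0 < S.m)
    (hP : ContinuousAt (fun p : ℝ × ℝ => P p.1 p.2) (x0, YR R x0 S.m))
    (hC : ContinuousAt C (YR R x0 ψ0)) (hc0 : 0 ≤ P x0 (YR R x0 S.m) * C (YR R x0 ψ0))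
    (hd : ∀ δ > 0, ∃ r > 0, ∀ x ψ, |x - x0| ≤ r → |ψ - ψ0| ≤ r →
      |R x ψ - R x0 ψ0 - α * (x - x0) - β * (ψ - ψ0)| ≤ δ * max |x - x0| |ψ - ψ0|)
    {δ : ℝ} (hδ : 0 < δ) :
    |α + P x0 (YR R x0 S.m) * C (YR R x0 ψ0) * β| ≤ δ * (16 + 16 * (P x0 (YR R x0 S.m) * C (YR R x0 ψ0)) + S.v2) := by
  obtain ⟨ρ, hρ, Hρ⟩ := pde_coef hP hC hδ
  obtain ⟨r1, hr1, Hr⟩ := hd δ hδ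
  have hK := S.K1_pos; have hv2 := S.v2_pos; have hm := S.hm
  obtain ⟨r, hr, rr1, rρ, rρ2, rx, rl, rm1, rm2⟩ : ∃ r : ℝ, 0 < r ∧ r ≤ r1 ∧ r ≤ ρ ∧ (S.K1 + S.v2) * r ≤ ρ / 2 ∧ r ≤ x0 ∧
      r ≤ l - x0 ∧ r ≤ S.m - ψ0 ∧ r ≤ ψ0 + S.m := by
    refine ⟨min r1 (min ρ (min (ρ / 2 / (S.K1 + S.v2)) (min x0 (min (l - x0) (min (S.m - ψ0) (ψ0 + S.m)))))), ?_, ?_⟩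
    · have a1 : 0 < l - x0 := by linarith
      have a2 : 0 < S.m - ψ0 := by linarith
      have a3 : 0 < ψ0 + S.m := by linarith
      have a4 : 0 < ρ / 2 / (S.K1 + S.v2) := by positivity
      simp only [lt_min_iff]; exact ⟨hr1, hρ, a4, hx0, a1, a2, a3⟩
    · set r := min r1 (min ρ (min (ρ / 2 / (S.K1 + S.v2)) (min x0 (min (l - x0) (min (S.m - ψ0) (ψ0 + S.m)))))) with hrdef
      have h := le_refl r
      conv at h => rhs; rw [hrdef]
      simp only [le_min_iff] at h
      obtain ⟨b1, b2, b3, b4, b5, b6, b7⟩ := h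
      rw [le_div_iff₀ (by positivity)] at b3
      exact ⟨b1, b2, by linarith, b4, b5, b6, b7⟩
  have E1 := D.unif W (e := min (δ * r) (ρ / 2)) (by positivity)
  have E2 := D.η0.eventually (eventually_lt_nhds (show (0:ℝ) < r / 8 by positivity))
  obtain ⟨k, hk1, hk2⟩ := (E1.and E2).exists
  have Dk := D.D k
  have hh0 := Dk.h0; have hσ := Dk.hσ
  have hhη := Dk.hhη; have hση := Dk.hση
  obtain ⟨T, hT⟩ : ∃ T, T = ⌊r / 2 / σ k⌋₊ := ⟨_, rfl⟩
  obtain ⟨I, hI⟩ : ∃ I, I = ⌊r / 2 / h k⌋₊ := ⟨_, rfl⟩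
  have fT := floor_step hσ hr (by linarith)
  have fI := floor_step hh0 hr (by linarith)
  rw [← hT] at fT; rw [← hI] at fI
  have n1c := Dk.nI_close hx0.le
  have i1c := Dk.iI_close ψ0
  set n1 := nI (ε k) (σ k) x0 with hn1
  set i1 := iI (h k) ψ0 with hi1
  rw [abs_le] at n1c
  -- ranges
  have xr : ∀ t : ℕ, t ≤ T → |ε k + (n1 + t : ℕ) * σ k - x0| ≤ r ∧ n1 + t < M k := by
    intro t ht
    have : (t : ℝ) * σ k ≤ T * σ k := by gcongr
    have t0 : 0 ≤ (t : ℝ) * σ k := by positivity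
    constructor
    · push_cast; rw [abs_le]; constructor <;> nlinarith
    · have hM := Dk.hM
      have : (((n1 + t : ℕ) : ℝ)) * σ k < M k * σ k := by push_cast; nlinarith
      have := lt_of_mul_lt_mul_right this hσ.le
      exact_mod_cast this
  have ir : ∀ j : ℕ, j ≤ I → |((i1 + j : ℤ) : ℝ) * h k - ψ0| ≤ r ∧ -(N k : ℤ) < i1 + j ∧ i1 + j ≤ N k := by
    intro j hj
    have : (j : ℝ) * h k ≤ I * h k := by gcongr
    have t0 : 0 ≤ (j : ℝ) * h k := by positivity
    have hN := Dk.Nh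
    refine ⟨?_, ?_, ?_⟩
    · push_cast; rw [abs_le]; constructor <;> nlinarith [i1c.1, i1c.2.1]
    · have : (-(N k : ℝ)) * h k < ((i1 + j : ℤ) : ℝ) * h k := by push_cast; nlinarith [i1c.1, i1c.2.1]
      have := lt_of_mul_lt_mul_right this hh0.le
      exact_mod_cast this
    · have : ((i1 + j : ℤ) : ℝ) * h k ≤ (N k : ℝ) * h k := by push_cast; nlinarith [i1c.1, i1c.2.1]
      have := le_of_mul_le_mul_right this hh0
      exact_mod_cast this
  have Yclose : ∀ x ψ ψ', |x - x0| ≤ r → |ψ - ψ'| ≤ r → -S.m ≤ ψ → ψ ≤ S.m → -S.m ≤ ψ' → ψ' ≤ S.m →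
      |YR R x ψ - YR R x0 ψ'| ≤ ρ / 2 := by
    intro x ψ ψ' h1 h2 h3 h4 h5 h6
    have h1' := abs_le.mp h1
    refine (YR_lip W D (x := x0) (x' := x) hx0.le hx1.le (by linarith) (by linarith) h5 h6 h3 h4).trans ?_
    have q1 := mul_le_mul_of_nonneg_left h1 hK.le
    have q2 := mul_le_mul_of_nonneg_left h2 hv2.le
    linarith
  have main := sum_lem (fun t j => Rk k (n1 + t) (i1 + j))
    (fun t j => P (ε k + (n1 + t : ℕ) * σ k) (Yv (Rk k (n1 + t)) (N k)) * C (Yv (Rk k (n1 + t)) (i1 + (j + 1 : ℕ)))) T I (h k) (σ k)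
    (P x0 (YR R x0 S.m) * C (YR R x0 ψ0)) δ S.v2 (2 * (δ * r))
    (R x0 ψ0 + α * (ε k + n1 * σ k - x0) + β * (i1 * h k - ψ0)) α β hh0 hσ hc0 hδ.le hv2.le
    (by
      intro t ht j hj
      obtain ⟨-, a2, a3⟩ := ir (j + 1) hj
      have := Dk.upd (n1 + t) (xr t ht.le).2 (i1 + (j + 1 : ℕ)) a2 a3
      have e : i1 + ((j + 1 : ℕ) : ℤ) - 1 = i1 + j := by push_cast; ring
      rw [e] at this
      rw [← add_assoc]; exact this)
    (by
      intro t ht j hj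
      obtain ⟨a1, a2, a3⟩ := ir (j + 1) hj
      obtain ⟨b1, b2⟩ := xr t ht.le
      have c1 := Yv_unif Dk hk1 b2.le a2.le a3
      have c2 := Yv_unif Dk hk1 (i := (N k : ℤ)) b2.le (by omega) le_rfl
      have hNh : (((N k : ℕ) : ℤ) : ℝ) * h k = S.m := by have := Dk.Nh; exact_mod_cast this
      rw [hNh] at c2
      have d1 := Yclose _ _ ψ0 b1 a1 (Dk.im a2.le a3).1 (Dk.im a2.le a3).2 hψ0.le hψ1.le
      have d2 := Yclose _ S.m S.m b1 (by simpa using hr.le) (by linarith) le_rfl (by linarith) le_rfl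
      have hmin := min_le_right (δ * r) (ρ / 2)
      refine Hρ _ _ _ (b1.trans rρ) ?_ ?_
      · refine (abs_sub_le _ _ _).trans (add_le_add (c2.trans hmin) d2) |>.trans (by linarith)
      · refine (abs_sub_le _ _ _).trans (add_le_add (c1.trans hmin) d1) |>.trans (by linarith))
    (by
      intro t ht j hj
      obtain ⟨-, a2, a3⟩ := ir (j + 1) hj
      obtain ⟨-, a4, a5⟩ := ir j hj.le
      have := Dk.lipψ W (xr t ht.le).2.le a4.le a5 a2.le a3
      have e : ((i1 + (j + 1 : ℕ) : ℤ) : ℝ) * h k - ((i1 + j : ℤ) : ℝ) * h k = h k := by push_cast; ring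
      rw [e, abs_of_pos hh0] at this
      exact this)
    (by
      intro t ht j hj
      obtain ⟨a1, a2, a3⟩ := ir j hj
      obtain ⟨b1, b2⟩ := xr t ht
      have c := (hk1 (n1 + t) b2.le (i1 + j) a2.le a3).trans (min_le_left _ _)
      have d := Hr _ _ (b1.trans rr1) (a1.trans rr1)
      have d' := d.trans (mul_le_mul_of_nonneg_left (max_le b1 a1) hδ.le)
      have c' := abs_le.mp c
      have d'' := abs_le.mp d'
      have e1 : (ε k + (n1 + t : ℕ) * σ k - x0) = (ε k + n1 * σ k - x0) + t * σ k := by push_cast; ring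
      have e2 : ((i1 + j : ℤ) : ℝ) * h k - ψ0 = (i1 * h k - ψ0) + j * h k := by push_cast; ring
      rw [e1, e2] at d''
      rw [abs_le]
      constructor <;> linarith)
  exact alg_fin hr fI.1 fT.1 hc0 hδ main

lemma Fam.pde (W : Wall S l Θ F C P) (D : Fam S l Θ C P η ε h σ N M Rk U R) {x0 ψ0 α β : ℝ}
    (hx0 : 0 < x0) (hx1 : x0 < l) (hψ0 : -S.m < ψ0) (hψ1 : ψ0 < S.m)
    (hP : ContinuousAt (fun p : ℝ × ℝ => P p.1 p.2) (x0, YR R x0 S.m))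
    (hC : ContinuousAt C (YR R x0 ψ0))
    (hd : ∀ δ > 0, ∃ r > 0, ∀ x ψ, |x - x0| ≤ r → |ψ - ψ0| ≤ r →
      |R x ψ - R x0 ψ0 - α * (x - x0) - β * (ψ - ψ0)| ≤ δ * max |x - x0| |ψ - ψ0|) :
    α + P x0 (YR R x0 S.m) * C (YR R x0 ψ0) * β = 0 := by
  have hm := S.hm; have hv2 := S.v2_pos; have ha := S.ha
  have H := W.small x0 hx0 hx1.le
  have hX := H.hX
  have y1 := D.Ybd W hx0.le hx1.le hψ0.le hψ1.le
  have y2 := D.Ybd W (ψ := S.m) hx0.le hx1.le (by linarith) le_rfl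
  have hc0 : 0 ≤ P x0 (YR R x0 S.m) * C (YR R x0 ψ0) := by
    apply mul_nonneg
    · exact S.hcs.le.trans (W.Plo x0 hx0 hx1.le _ (le_trans (by positivity) y2.1) y2.2)
    · exact le_trans (by have := S.c1_pos; positivity) (C_lo W.G H y1.1 y1.2)
  have key := fun δ (hδ : 0 < δ) => D.pde_aux W hx0 hx1 hψ0 hψ1 hP hC hc0 hd hδ
  generalize P x0 (YR R x0 S.m) * C (YR R x0 ψ0) = c0 at *
  rw [← abs_nonpos_iff]
  apply le_of_forall_pos_le_add
  intro e he
  have := key (e / (16 + 16 * c0 + S.v2)) (by positivity)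
  rw [div_mul_cancel₀ _ (by positivity)] at this
  linarith
end
end

section
open Filter Topology

structure LimR (S : SC) (l : ℝ) (Θ C : ℝ → ℝ) (P : ℝ → ℝ → ℝ) (R : ℝ → ℝ → ℝ) : Prop where
  lip : ∀ x x' ψ ψ', 0 ≤ x → x ≤ l → 0 ≤ x' → x' ≤ l → -S.m ≤ ψ → ψ ≤ S.m → -S.m ≤ ψ' → ψ' ≤ S.m →
    |R x' ψ' - R x ψ| ≤ S.K1 * |x' - x| + S.v2 * |ψ' - ψ|
  bc : ∀ x, 0 ≤ x → x ≤ l → R x (-S.m) = R x S.m - 2 * Θ x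
  Ybd : ∀ x ψ, 0 ≤ x → x ≤ l → -S.m ≤ ψ → ψ ≤ S.m →
    (S.a * x ^ S.μ) ^ 3 ≤ YR R x ψ ∧ YR R x ψ ≤ (S.b * x ^ S.μ) ^ 3
  slope : ∀ x ψ ψ', 0 < x → x ≤ l → -S.m ≤ ψ → ψ ≤ ψ' → ψ' ≤ S.m →
    S.v1 * ((x ^ S.μ) ^ 4 / x) * (ψ' - ψ) ≤ R x ψ' - R x ψ ∧
    R x ψ' - R x ψ ≤ S.v2 * ((x ^ S.μ) ^ 4 / x) * (ψ' - ψ)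
  Yslope : ∀ x ψ ψ', 0 < x → x ≤ l → -S.m ≤ ψ → ψ ≤ ψ' → ψ' ≤ S.m →
    |YR R x ψ' - YR R x ψ| ≤ (ψ' - ψ) * (S.Gc * ((x ^ S.μ) ^ 5 / x ^ 2))
  R0 : ∀ ψ, -S.m ≤ ψ → ψ ≤ S.m → R 0 ψ = 0
  pde : ∀ x0 ψ0 α β, 0 < x0 → x0 < l → -S.m < ψ0 → ψ0 < S.m →
    (∀ δ > 0, ∃ r > 0, ∀ x ψ, |x - x0| ≤ r → |ψ - ψ0| ≤ r →
      |R x ψ - R x0 ψ0 - α * (x - x0) - β * (ψ - ψ0)| ≤ δ * max |x - x0| |ψ - ψ0|) →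
    α + P x0 (YR R x0 S.m) * C (YR R x0 ψ0) * β = 0

lemma LimR.Ylt {S : SC} {l : ℝ} {Θ F C : ℝ → ℝ} {P : ℝ → ℝ → ℝ} (W : Wall S l Θ F C P) {x Y : ℝ}
    (h0 : 0 < x) (h1 : x < l) (h2 : (S.a * x ^ S.μ) ^ 3 ≤ Y) (h3 : Y ≤ (S.b * x ^ S.μ) ^ 3) : 0 < Y ∧ Y < S.Y0 := by
  have ha := S.ha; have hb := S.hb; have hμ := S.hμ
  have hX := (W.small x h0 h1.le).hX
  refine ⟨lt_of_lt_of_le (by positivity) h2, lt_of_le_of_lt h3 (lt_of_lt_of_le ?_ (W.small l W.hl le_rfl).hY)⟩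
  have : x ^ S.μ < l ^ S.μ := Real.rpow_lt_rpow h0.le h1 (by linarith)
  gcongr

theorem exists_limR {S : SC} {l : ℝ} {Θ F C : ℝ → ℝ} {P : ℝ → ℝ → ℝ} (W : Wall S l Θ F C P)
    (hΘ : ContinuousOn Θ (Set.Icc 0 l))
    (hP : ∀ x Y, 0 < x → x < l → 0 < Y → Y < S.Y0 → ContinuousAt (fun p : ℝ × ℝ => P p.1 p.2) (x, Y))
    (hC : ∀ Y, 0 < Y → Y < S.Y0 → ContinuousAt C Y) : ∃ R, LimR S l Θ C P R := by
  obtain ⟨η, ε, h, σ, N, M, Rk, U, R, D⟩ := exists_fam W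
  have hm := S.hm; have hl := W.hl; have hμ := S.hμ; have hv1 := S.v1_pos; have hv2 := S.v2_pos
  have hlip : ∀ x x' ψ ψ', 0 ≤ x → x ≤ l → 0 ≤ x' → x' ≤ l → -S.m ≤ ψ → ψ ≤ S.m → -S.m ≤ ψ' → ψ' ≤ S.m →
    |R x' ψ' - R x ψ| ≤ S.K1 * |x' - x| + S.v2 * |ψ' - ψ| :=
    fun x x' ψ ψ' a1 a2 a3 a4 a5 a6 a7 a8 => D.lip W a1 a2 a3 a4 a5 a6 a7 a8
  have hconst : ∀ ψ ψ', -S.m ≤ ψ → ψ ≤ ψ' → ψ' ≤ S.m → R 0 ψ' - R 0 ψ = 0 := by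
    intro ψ ψ' h1 h2 h3
    have tl : ∀ φ, -S.m ≤ φ → φ ≤ S.m → Tendsto (fun x => R x φ) (𝓝[>] 0) (𝓝 (R 0 φ)) := by
      intro φ h4 h5
      rw [tendsto_iff_norm_sub_tendsto_zero]
      have z : Tendsto (fun x : ℝ => S.K1 * |x|) (𝓝[>] 0) (𝓝 0) := by
        have : Tendsto (fun x : ℝ => S.K1 * |x|) (𝓝 0) (𝓝 (S.K1 * |0|)) := by
          apply Continuous.tendsto; fun_prop
        simp only [abs_zero, mul_zero] at this
        exact this.mono_left nhdsWithin_le_nhds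
      refine squeeze_zero' (Eventually.of_forall fun _ => norm_nonneg _) ?_ z
      filter_upwards [Ioo_mem_nhdsGT hl] with x hx
      have := hlip 0 x φ φ le_rfl hl.le hx.1.le hx.2.le h4 h5 h4 h5
      simpa using this
    have t := (tl ψ' (h1.trans h2) h3).sub (tl ψ h1 (h2.trans h3))
    refine tendsto_nhds_unique t ?_
    have z : Tendsto (fun x : ℝ => S.v2 * (x ^ S.μ) ^ 3 * (ψ' - ψ)) (𝓝[>] 0) (𝓝 0) := by
      have : Tendsto (fun x : ℝ => S.v2 * (x ^ S.μ) ^ 3 * (ψ' - ψ)) (𝓝 0) (𝓝 (S.v2 * ((0:ℝ) ^ S.μ) ^ 3 * (ψ' - ψ))) := by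
        apply Continuous.tendsto
        have : Continuous (fun x : ℝ => x ^ S.μ) := Real.continuous_rpow_const (by linarith)
        fun_prop
      rw [Real.zero_rpow (by linarith)] at this
      simp only [ne_eq, OfNat.ofNat_ne_zero, not_false_eq_true, zero_pow, mul_zero, zero_mul] at this
      exact this.mono_left nhdsWithin_le_nhds
    refine squeeze_zero' ?_ ?_ z
    · filter_upwards [Ioo_mem_nhdsGT hl] with x hx
      have H := W.small x hx.1 hx.2.le
      have s := (D.slope W hx.1 hx.2.le h1 h2 h3).1
      have := H.q1.2
      have : 0 ≤ ψ' - ψ := by linarith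
      exact le_trans (by positivity) s
    · filter_upwards [Ioo_mem_nhdsGT hl] with x hx
      have H := W.small x hx.1 hx.2.le
      have s := (D.slope W hx.1 hx.2.le h1 h2 h3).2
      have := H.q3
      have : 0 ≤ ψ' - ψ := by linarith
      refine s.trans ?_
      gcongr
  refine ⟨R, hlip, fun x a b => D.bc W hΘ a b, fun x ψ a b c d => D.Ybd W a b c d,
    fun x ψ ψ' a b c d e => D.slope W a b c d e, fun x ψ ψ' a b c d e => D.Yslope W a b c d e, ?_, ?_⟩
  · intro ψ h1 h2
    have y := D.Ybd W (x := 0) (ψ := ψ) le_rfl hl.le h1 h2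
    rw [Real.zero_rpow (by linarith)] at y
    norm_num at y
    have y0 : YR R 0 ψ = 0 := le_antisymm y.2 y.1
    unfold YR at y0
    have : R 0 ψ = R 0 (-ψ) := by
      rcases le_total ψ (-ψ) with hc | hc
      · linarith [hconst ψ (-ψ) h1 hc (by linarith)]
      · linarith [hconst (-ψ) ψ (by linarith) hc h2]
    linarith
  · intro x0 ψ0 α β a1 a2 a3 a4 hd
    have y1 := D.Ybd W a1.le a2.le a3.le a4.le
    have y2 := D.Ybd W (ψ := S.m) a1.le a2.le (by linarith) le_rfl
    have z1 := LimR.Ylt W a1 a2 y1.1 y1.2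
    have z2 := LimR.Ylt W a1 a2 y2.1 y2.2
    exact D.pde W a1 a2 a3 a4 (hP _ _ a1 a2 z2.1 z2.2) (hC _ z1.1 z1.2) hd
end

section
open Real Set Filter Topology

lemma invFunOn_deriv {f : ℝ → ℝ} {s : Set ℝ} (inj : InjOn f s) {x f' : ℝ} (hs : s ∈ 𝓝 x)
    (hf : HasStrictDerivAt f f' x) (hf' : f' ≠ 0) : HasDerivAt (Function.invFunOn f s) f'⁻¹ (f x) := by
  have h1 := hf.to_localInverse hf'
  refine h1.hasDerivAt.congr_of_eventuallyEq ?_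
  have e1 : ∀ᶠ y in 𝓝 (f x), f (hf.localInverse f f' x hf' y) = y := by
    exact (hf.hasStrictFDerivAt_equiv hf').eventually_right_inverse
  have e0 : hf.localInverse f f' x hf' (f x) = x := by
    exact (hf.hasStrictFDerivAt_equiv hf').localInverse_apply_image
  have e2 : ∀ᶠ y in 𝓝 (f x), hf.localInverse f f' x hf' y ∈ s := by
    have := h1.hasDerivAt.continuousAt
    unfold ContinuousAt at this
    rw [e0] at this
    exact this hs
  filter_upwards [e1, e2] with y a b
  have hy : y ∈ f '' s := ⟨_, b, a⟩
  obtain ⟨c1, c2⟩ := Function.invFunOn_pos (f := f) (s := s) (b := y) ⟨_, b, a⟩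
  exact inj c1 b (c2.trans a.symm)

lemma invFunOn_eq' {f : ℝ → ℝ} {s : Set ℝ} (inj : InjOn f s) {x : ℝ} (hx : x ∈ s) :
    Function.invFunOn f s (f x) = x := by
  obtain ⟨c1, c2⟩ := Function.invFunOn_pos (f := f) (s := s) (b := f x) ⟨_, hx, rfl⟩
  exact inj c1 hx c2

section gas
variable {γ : ℝ}

lemma cstar_pos (hγ : 1 < γ) : 0 < cstar γ := by unfold cstar; apply Real.sqrt_pos.mpr; apply div_pos <;> linarith
lemma cstar_sq (hγ : 1 < γ) : cstar γ ^ 2 = 2 / (γ + 1) := by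
  unfold cstar; apply Real.sq_sqrt; apply div_nonneg <;> linarith
lemma qmax_pos (hγ : 1 < γ) : 0 < qmaxF γ := by unfold qmaxF; apply Real.sqrt_pos.mpr; apply div_pos <;> linarith
lemma qmax_sq (hγ : 1 < γ) : qmaxF γ ^ 2 = 2 / (γ - 1) := by
  unfold qmaxF; apply Real.sq_sqrt; apply div_nonneg <;> linarith
lemma cstar_lt (hγ : 1 < γ) : cstar γ < qmaxF γ := by
  unfold cstar qmaxF; apply Real.sqrt_lt_sqrt
  · apply div_nonneg <;> linarith
  · apply div_lt_div_of_pos_left <;> linarith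

lemma Dpos (hγ : 1 < γ) {s : ℝ} (h0 : 0 ≤ s) (h1 : s < qmaxF γ) : 0 < 1 - (γ - 1) / 2 * s ^ 2 := by
  have : s ^ 2 < qmaxF γ ^ 2 := by gcongr
  rw [qmax_sq hγ, lt_div_iff₀ (by linarith)] at this
  linarith

lemma rho_deriv (hγ : 1 < γ) {t : ℝ} (h : 0 < 1 - (γ - 1) / 2 * t) :
    deriv (rhoF γ) t = -(1 / 2) * (1 - (γ - 1) / 2 * t) ^ (1 / (γ - 1) - 1) := by
  have h1 : HasDerivAt (fun t => 1 - (γ - 1) / 2 * t) (-((γ - 1) / 2)) t := by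
    simpa using ((hasDerivAt_id t).const_mul ((γ - 1) / 2)).const_sub 1
  have h2 := h1.rpow_const (p := 1 / (γ - 1)) (Or.inl h.ne')
  have : deriv (rhoF γ) t = _ := h2.deriv
  rw [this]
  have : γ - 1 ≠ 0 := by linarith
  field_simp

noncomputable def gA (γ s : ℝ) : ℝ :=
  (rhoF γ (s ^ 2) + 2 * s ^ 2 * deriv (rhoF γ) (s ^ 2)) / (s * (rhoF γ (s ^ 2)) ^ 2)

lemma gA_eq (hγ : 1 < γ) {s : ℝ} (h0 : 0 < s) (h1 : s < qmaxF γ) :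
    gA γ s = (1 - (γ + 1) / 2 * s ^ 2) / (s * (1 - (γ - 1) / 2 * s ^ 2) * (1 - (γ - 1) / 2 * s ^ 2) ^ (1 / (γ - 1))) := by
  have hD := Dpos hγ h0.le h1
  unfold gA
  rw [rho_deriv hγ hD]
  unfold rhoF
  rw [Real.rpow_sub_one hD.ne']
  generalize he : (1 - (γ - 1) / 2 * s ^ 2) ^ (1 / (γ - 1)) = r
  have hr : 0 < r := by rw [← he]; exact Real.rpow_pos_of_pos hD _
  generalize hDD : 1 - (γ - 1) / 2 * s ^ 2 = D at *
  have e : 1 - (γ + 1) / 2 * s ^ 2 = D - s ^ 2 := by rw [← hDD]; ring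
  rw [e]
  field_simp
  ring

lemma rho_cont (hγ : 1 < γ) {s : ℝ} (h0 : 0 < s) (h1 : s < qmaxF γ) : ContinuousAt (fun s => rhoF γ (s ^ 2)) s := by
  have hD := Dpos hγ h0.le h1
  unfold rhoF
  apply ContinuousAt.rpow_const
  · fun_prop
  · exact Or.inl hD.ne'

lemma gA_cont (hγ : 1 < γ) {s : ℝ} (h0 : 0 < s) (h1 : s < qmaxF γ) : ContinuousAt (gA γ) s := by
  have hD := Dpos hγ h0.le h1
  have e : (fun s => (1 - (γ + 1) / 2 * s ^ 2) / (s * (1 - (γ - 1) / 2 * s ^ 2) * (1 - (γ - 1) / 2 * s ^ 2) ^ (1 / (γ - 1))))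
      =ᶠ[𝓝 s] gA γ := by
    filter_upwards [Ioo_mem_nhds h0 h1] with x hx
    exact (gA_eq hγ hx.1 hx.2).symm
  refine ContinuousAt.congr ?_ e
  have := rho_cont hγ h0 h1
  unfold rhoF at this
  apply ContinuousAt.div
  · fun_prop
  · apply ContinuousAt.mul _ this; fun_prop
  · have := Real.rpow_pos_of_pos hD (1 / (γ - 1)); positivity

lemma seg_sub (hγ : 1 < γ) {q : ℝ} (h0 : 0 < q) (h1 : q < qmaxF γ) : uIcc (cstar γ) q ⊆ Ioo 0 (qmaxF γ) := by
  intro x hx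
  have := cstar_pos hγ; have := cstar_lt hγ
  rcases le_total (cstar γ) q with h | h
  · rw [uIcc_of_le h] at hx; exact ⟨by linarith [hx.1], by linarith [hx.2]⟩
  · rw [uIcc_of_ge h] at hx; exact ⟨by linarith [hx.1], by linarith [hx.2]⟩

lemma prim_deriv (hγ : 1 < γ) {g : ℝ → ℝ} (hg : ∀ s, 0 < s → s < qmaxF γ → ContinuousAt g s) {q : ℝ} (h0 : 0 < q) (h1 : q < qmaxF γ) :
    HasStrictDerivAt (fun q => ∫ s in (cstar γ)..q, g s) (g q) q := by
  apply intervalIntegral.integral_hasStrictDerivAt_right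
  · apply ContinuousOn.intervalIntegrable
    intro x hx
    have := seg_sub hγ h0 h1 hx
    exact (hg x this.1 this.2).continuousWithinAt
  · have : ContinuousOn g (Ioo 0 (qmaxF γ)) := fun x hx => (hg x hx.1 hx.2).continuousWithinAt
    exact this.stronglyMeasurableAtFilter isOpen_Ioo q ⟨h0, h1⟩
  · exact hg q h0 h1

lemma A_deriv (hγ : 1 < γ) {q : ℝ} (h0 : 0 < q) (h1 : q < qmaxF γ) : HasStrictDerivAt (Afun γ) (gA γ q) q :=
  prim_deriv hγ (fun _ a b => gA_cont hγ a b) h0 h1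

lemma B_deriv (hγ : 1 < γ) {q : ℝ} (h0 : 0 < q) (h1 : q < qmaxF γ) :
    HasStrictDerivAt (Bfun γ) (rhoF γ (q ^ 2) / q) q :=
  prim_deriv (g := fun s => rhoF γ (s ^ 2) / s) hγ (fun _ a b => (rho_cont hγ a b).div continuousAt_id a.ne') h0 h1

lemma gA_neg (hγ : 1 < γ) {s : ℝ} (h0 : cstar γ < s) (h1 : s < qmaxF γ) : gA γ s < 0 := by
  have hc := cstar_pos hγ
  have hs : 0 < s := hc.trans h0
  have hD := Dpos hγ hs.le h1
  rw [gA_eq hγ hs h1]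
  have hr := Real.rpow_pos_of_pos hD (1 / (γ - 1))
  apply div_neg_of_neg_of_pos _ (by positivity)
  have : cstar γ ^ 2 < s ^ 2 := by gcongr
  rw [cstar_sq hγ, div_lt_iff₀ (by linarith)] at this
  linarith

lemma A_anti (hγ : 1 < γ) : StrictAntiOn (Afun γ) (Ico (cstar γ) (qmaxF γ)) := by
  have hc := cstar_pos hγ
  apply strictAntiOn_of_deriv_neg (convex_Ico _ _)
  · intro x hx
    exact (A_deriv hγ (hc.trans_le hx.1) hx.2).hasDerivAt.continuousAt.continuousWithinAt
  · intro x hx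
    rw [interior_Ico] at hx
    rw [(A_deriv hγ (hc.trans hx.1) hx.2).hasDerivAt.deriv]
    exact gA_neg hγ hx.1 hx.2

lemma Ainv_eq (hγ : 1 < γ) {q : ℝ} (h0 : cstar γ ≤ q) (h1 : q < qmaxF γ) : AplusInv γ (Afun γ q) = q :=
  invFunOn_eq' (A_anti hγ).injOn ⟨h0, h1⟩

lemma bfun_eq (hγ : 1 < γ) {q : ℝ} (h0 : cstar γ < q) (h1 : q < qmaxF γ) :
    bfun γ (Afun γ q) = -(rhoF γ (q ^ 2) / q * (gA γ q)⁻¹) := by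
  have hc := cstar_pos hγ
  have hq : 0 < q := hc.trans h0
  have d1 : HasDerivAt (AplusInv γ) (gA γ q)⁻¹ (Afun γ q) :=
    invFunOn_deriv (A_anti hγ).injOn (Ico_mem_nhds h0 h1) (A_deriv hγ hq h1) (gA_neg hγ h0 h1).ne
  have d2 : HasDerivAt (Bfun γ) (rhoF γ (q ^ 2) / q) (AplusInv γ (Afun γ q)) := by
    rw [Ainv_eq hγ h0.le h1]; exact (B_deriv hγ hq h1).hasDerivAt
  have d3 : HasDerivAt (Kfun γ) (rhoF γ (q ^ 2) / q * (gA γ q)⁻¹) (Afun γ q) := d2.comp _ d1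
  unfold bfun
  rw [d3.deriv]
end gas
end

section
open Real Set Filter Topology

section gas
variable {γ : ℝ}

noncomputable def dw (γ w : ℝ) : ℝ := (γ + 1) / 2 + (γ - 1) / 2 * w ^ 2
noncomputable def qw (γ w : ℝ) : ℝ := Real.sqrt ((1 + w ^ 2) / dw γ w)
noncomputable def gY (γ w : ℝ) : ℝ := w ^ 2 / ((1 + w ^ 2) * dw γ w)
noncomputable def GY (γ w : ℝ) : ℝ := ∫ t in (0:ℝ)..w, gY γ t
noncomputable def Cw (γ w : ℝ) : ℝ := (dw γ w) ^ (-(1 / (γ - 1))) / w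

lemma dw_gt (hγ : 1 < γ) (w : ℝ) : 1 < dw γ w := by unfold dw; nlinarith [sq_nonneg w]
lemma dw_pos (hγ : 1 < γ) (w : ℝ) : 0 < dw γ w := by linarith [dw_gt hγ w]

lemma qw_sq (hγ : 1 < γ) (w : ℝ) : qw γ w ^ 2 = (1 + w ^ 2) / dw γ w := by
  have := dw_pos hγ w
  unfold qw; apply Real.sq_sqrt; positivity
lemma qw_pos (hγ : 1 < γ) (w : ℝ) : 0 < qw γ w := by
  have := dw_pos hγ w
  unfold qw; apply Real.sqrt_pos.mpr; positivity
lemma qw_zero : qw γ 0 = cstar γ := by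
  unfold qw dw cstar; congr 1; simp
lemma D_qw (hγ : 1 < γ) (w : ℝ) : 1 - (γ - 1) / 2 * qw γ w ^ 2 = (dw γ w)⁻¹ := by
  have := dw_pos hγ w
  rw [qw_sq hγ]; field_simp; unfold dw; ring
lemma qw_lt (hγ : 1 < γ) (w : ℝ) : qw γ w < qmaxF γ := by
  have h := dw_pos hγ w
  have h2 := D_qw hγ w
  have h3 : 0 < (dw γ w)⁻¹ := by positivity
  have h4 := qmax_sq hγ
  have : qw γ w ^ 2 < qmaxF γ ^ 2 := by
    rw [h4, lt_div_iff₀ (by linarith)]; nlinarith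
  exact lt_of_pow_lt_pow_left₀ 2 (qmax_pos hγ).le this
lemma qw_diff (hγ : 1 < γ) (w : ℝ) : qw γ w ^ 2 - cstar γ ^ 2 = w ^ 2 / (dw γ w * ((γ + 1) / 2)) := by
  have h := dw_pos hγ w
  have h1 : 0 < γ + 1 := by linarith
  rw [qw_sq hγ, cstar_sq hγ]; field_simp; unfold dw; ring
lemma qw_ge (hγ : 1 < γ) (w : ℝ) : cstar γ ≤ qw γ w := by
  have h := dw_pos hγ w
  have h1 : 0 < γ + 1 := by linarith
  have h2 := qw_diff hγ w
  have : 0 ≤ w ^ 2 / (dw γ w * ((γ + 1) / 2)) := by positivity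
  exact le_of_sq_le_sq (by linarith) (qw_pos hγ w).le
lemma qw_gt (hγ : 1 < γ) {w : ℝ} (hw : 0 < w) : cstar γ < qw γ w := by
  have h := dw_pos hγ w
  have h1 : 0 < γ + 1 := by linarith
  have h2 := qw_diff hγ w
  have : 0 < w ^ 2 / (dw γ w * ((γ + 1) / 2)) := by positivity
  exact lt_of_pow_lt_pow_left₀ 2 (qw_pos hγ w).le (by linarith)
lemma qw_le (hγ : 1 < γ) (w : ℝ) : qw γ w ≤ cstar γ + w ^ 2 / cstar γ := by
  have h := dw_gt hγ w
  have hc := cstar_pos hγ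
  have h1 : 0 < γ + 1 := by linarith
  have h2 := qw_diff hγ w
  have h3 := qw_ge hγ w
  have : w ^ 2 / (dw γ w * ((γ + 1) / 2)) ≤ w ^ 2 := by
    apply div_le_self (sq_nonneg _); nlinarith
  have h4 : (qw γ w - cstar γ) * cstar γ ≤ w ^ 2 := by nlinarith
  rw [← le_div_iff₀ hc] at h4
  linarith

lemma dw_deriv (w : ℝ) : HasDerivAt (dw γ) ((γ - 1) * w) w := by
  unfold dw
  have := (((hasDerivAt_id w).pow 2).const_mul ((γ - 1) / 2)).const_add ((γ + 1) / 2)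
  refine this.congr_deriv ?_
  simp; ring
lemma dw_cont : Continuous (dw γ) := by unfold dw; fun_prop

lemma qw_cont (hγ : 1 < γ) : Continuous (qw γ) := by
  unfold qw
  apply Real.continuous_sqrt.comp
  exact Continuous.div (by fun_prop) dw_cont (fun w => (dw_pos hγ w).ne')

lemma qw_deriv (hγ : 1 < γ) (w : ℝ) : HasDerivAt (qw γ) (w / (qw γ w * dw γ w ^ 2)) w := by
  have h := dw_pos hγ w
  have h1 : HasDerivAt (fun w : ℝ => 1 + w ^ 2) (2 * w) w := by
    simpa using ((hasDerivAt_id w).pow 2).const_add 1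
  have h3 : (1 + w ^ 2) / dw γ w ≠ 0 := by positivity
  have h2 := (h1.div (dw_deriv (γ := γ) w) h.ne').sqrt h3
  refine h2.congr_deriv ?_
  have hq := qw_pos hγ w
  change _ / (2 * qw γ w) = _
  have : (2 * w * dw γ w - (1 + w ^ 2) * ((γ - 1) * w)) = 2 * w := by unfold dw; ring
  rw [this]
  field_simp

lemma gY_cont (hγ : 1 < γ) : Continuous (gY γ) := by
  unfold gY
  refine Continuous.div (by fun_prop) (Continuous.mul (by fun_prop) dw_cont) (fun w => ?_)
  have := dw_pos hγ w
  positivity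

lemma gY_pos (hγ : 1 < γ) {w : ℝ} (hw : 0 < w) : 0 < gY γ w := by
  have := dw_pos hγ w
  unfold gY; positivity

lemma GY_deriv (hγ : 1 < γ) (w : ℝ) : HasStrictDerivAt (GY γ) (gY γ w) w :=
  intervalIntegral.integral_hasStrictDerivAt_right ((gY_cont hγ).intervalIntegrable _ _)
    (gY_cont hγ).stronglyMeasurable.stronglyMeasurableAtFilter (gY_cont hγ).continuousAt

lemma GY_mono (hγ : 1 < γ) : StrictMonoOn (GY γ) (Ici 0) := by
  apply strictMonoOn_of_deriv_pos (convex_Ici 0)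
  · exact fun x _ => (GY_deriv hγ x).hasDerivAt.continuousAt.continuousWithinAt
  · intro x hx
    rw [interior_Ici] at hx
    rw [(GY_deriv hγ x).hasDerivAt.deriv]; exact gY_pos hγ hx

lemma GY_zero : GY γ 0 = 0 := by simp [GY]

lemma Cw_pos (hγ : 1 < γ) {w : ℝ} (hw : 0 < w) : 0 < Cw γ w := by
  have := Real.rpow_pos_of_pos (dw_pos hγ w) (-(1 / (γ - 1)))
  unfold Cw; positivity

lemma Cw_deriv (hγ : 1 < γ) {w : ℝ} (hw : 0 < w) :
    HasDerivAt (Cw γ) (-(dw γ w) ^ (-(1 / (γ - 1))) * (1 / dw γ w + 1 / w ^ 2)) w := by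
  have h := dw_pos hγ w
  have h1 := (dw_deriv (γ := γ) w).rpow_const (p := -(1 / (γ - 1))) (Or.inl h.ne')
  have h2 := h1.div (hasDerivAt_id w) hw.ne'
  refine h2.congr_deriv ?_
  rw [Real.rpow_sub_one h.ne']
  have : γ - 1 ≠ 0 := by linarith
  simp only [id]
  field_simp
  ring

lemma Cw_anti (hγ : 1 < γ) : AntitoneOn (Cw γ) (Ioi 0) := by
  apply antitoneOn_of_deriv_nonpos (convex_Ioi 0)
  · exact fun x hx => (Cw_deriv hγ hx).continuousAt.continuousWithinAt
  · intro x hx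
    rw [interior_Ioi] at hx
    exact (Cw_deriv hγ hx).differentiableAt.differentiableWithinAt
  · intro x hx
    rw [interior_Ioi] at hx
    rw [(Cw_deriv hγ hx).deriv]
    have := dw_pos hγ x
    have := Real.rpow_pos_of_pos this (-(1 / (γ - 1)))
    have hx' : 0 < x := hx
    have : 0 < (dw γ x) ^ (-(1 / (γ - 1))) * (1 / dw γ x + 1 / x ^ 2) := by positivity
    linarith

/-- relation with `A` -/
lemma gA_qw (hγ : 1 < γ) (w : ℝ) : gA γ (qw γ w) = -(w ^ 2 / (qw γ w * (dw γ w) ^ (-(1 / (γ - 1))))) := by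
  have h := dw_pos hγ w
  have hq := qw_pos hγ w
  rw [gA_eq hγ hq (qw_lt hγ w), D_qw hγ, qw_sq hγ, Real.inv_rpow h.le, ← Real.rpow_neg h.le]
  have hr := Real.rpow_pos_of_pos h (-(1 / (γ - 1)))
  have e : 1 - (γ + 1) / 2 * ((1 + w ^ 2) / dw γ w) = -(w ^ 2 / dw γ w) := by
    field_simp; unfold dw; ring
  rw [e]
  field_simp

lemma rho_qw (hγ : 1 < γ) (w : ℝ) : rhoF γ (qw γ w ^ 2) = (dw γ w) ^ (-(1 / (γ - 1))) := by
  have h := dw_pos hγ w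
  unfold rhoF
  rw [D_qw hγ, Real.inv_rpow h.le, ← Real.rpow_neg h.le]

lemma b_qw (hγ : 1 < γ) {w : ℝ} (hw : 0 < w) : bfun γ (Afun γ (qw γ w)) = Cw γ w ^ 2 := by
  rw [bfun_eq hγ (qw_gt hγ hw) (qw_lt hγ w), gA_qw hγ, rho_qw hγ]
  have hq := qw_pos hγ w
  have hr := Real.rpow_pos_of_pos (dw_pos hγ w) (-(1 / (γ - 1)))
  unfold Cw
  field_simp

lemma yw_deriv (hγ : 1 < γ) (w : ℝ) :
    HasDerivAt (fun w => -Afun γ (qw γ w)) (w ^ 3 / ((dw γ w) ^ (-(1 / (γ - 1))) * ((1 + w ^ 2) * dw γ w))) w := by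
  have d1 := ((A_deriv hγ (qw_pos hγ w) (qw_lt hγ w)).hasDerivAt.comp w (qw_deriv hγ w)).neg
  refine d1.congr_deriv ?_
  rw [gA_qw hγ]
  have hq := qw_pos hγ w
  have h := dw_pos hγ w
  have hr := Real.rpow_pos_of_pos h (-(1 / (γ - 1)))
  have e : qw γ w ^ 2 * dw γ w = 1 + w ^ 2 := by rw [qw_sq hγ]; field_simp
  rw [← e]
  field_simp

end gas
end

section
open Real Set Filter Topology

structure GasD (γ Y0 ca cb L Lq ya yb : ℝ) (q C y : ℝ → ℝ) : Prop where
  hY0 : 0 < Y0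
  hca : 0 < ca
  hcb : 0 < cb
  hL : 0 < L
  hLq : 0 < Lq
  hya : 0 < ya
  hyb : 0 < yb
  qlo : ∀ Y, 0 ≤ Y → Y ≤ Y0 → cstar γ ≤ q Y
  qhi : ∀ Y, 0 ≤ Y → Y ≤ Y0 → q Y ≤ (cstar γ + qmaxF γ) / 2
  qc : ContinuousOn q (Icc 0 Y0)
  qca : ∀ Y, 0 < Y → Y ≤ Y0 → ContinuousAt q Y
  qL : ∀ t Y, 0 ≤ t → 0 ≤ Y → Y ≤ t ^ 3 → t ^ 3 ≤ Y0 → q Y ≤ cstar γ * (1 + Lq * t)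
  Cpos : ∀ Y, 0 < Y → Y ≤ Y0 → 0 < C Y
  Cc : ∀ Y, 0 < Y → Y ≤ Y0 → ContinuousAt C Y
  anti : ∀ a b, 0 < a → a ≤ b → b ≤ Y0 → C b ≤ C a
  lo : ∀ t, 0 < t → t ^ 3 ≤ Y0 → ca / t ≤ C (t ^ 3)
  hi : ∀ t, 0 < t → t ^ 3 ≤ Y0 → C (t ^ 3) ≤ cb / t
  lip : ∀ t a b, 0 < t → t ^ 3 ≤ a → a ≤ b → b ≤ Y0 → C a - C b ≤ L / t ^ 4 * (b - a)
  y0 : y 0 = 0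
  yinv : ∀ Y, 0 ≤ Y → Y ≤ Y0 → AplusInv γ (-y Y) = q Y
  yc : ContinuousOn y (Icc 0 Y0)
  yd : ∀ Y, 0 < Y → Y ≤ Y0 → HasDerivAt y (1 / C Y) Y
  ylo : ∀ t, 0 ≤ t → t ^ 3 ≤ Y0 → ya * t ^ 4 ≤ y (t ^ 3)
  yhi : ∀ t, 0 ≤ t → t ^ 3 ≤ Y0 → y (t ^ 3) ≤ yb * t ^ 4
  bC : ∀ Y, 0 < Y → Y ≤ Y0 → bfun γ (-y Y) = C Y ^ 2

section gas
variable {γ : ℝ}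

/-- compare derivative with a power -/
lemma pow_cmp {f f' : ℝ → ℝ} {c : ℝ} {n : ℕ} (hf : ∀ w, HasDerivAt f (f' w) w) (h0 : f 0 = 0) {W : ℝ}
    (hle : ∀ w, 0 ≤ w → w ≤ W → f' w ≤ c * w ^ n) {w : ℝ} (h1 : 0 ≤ w) (h2 : w ≤ W) :
    f w ≤ c / (n + 1) * w ^ (n + 1) := by
  have d : ∀ w, HasDerivAt (fun w => c / (n + 1) * w ^ (n + 1)) (c * w ^ n) w := by
    intro w
    have := (hasDerivAt_pow (n + 1) w).const_mul (c / (n + 1))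
    refine this.congr_deriv ?_
    rw [Nat.add_sub_cancel]; push_cast; field_simp
  have M : MonotoneOn (fun w => c / (n + 1) * w ^ (n + 1) - f w) (Icc 0 W) := by
    apply monotoneOn_of_deriv_nonneg (convex_Icc 0 W)
    · exact fun x _ => ((d x).sub (hf x)).continuousAt.continuousWithinAt
    · exact fun x _ => ((d x).sub (hf x)).differentiableAt.differentiableWithinAt
    · intro x hx
      rw [interior_Icc] at hx
      have D : HasDerivAt (fun w => c / (n + 1) * w ^ (n + 1) - f w) (c * x ^ n - f' x) x := (d x).sub (hf x)
      rw [D.deriv]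
      linarith [hle x hx.1.le hx.2.le]
  have := M ⟨le_rfl, h1.trans h2⟩ ⟨h1, h2⟩ h1
  simp [h0] at this
  exact this

lemma dw_le (hγ : 1 < γ) {w : ℝ} (h0 : 0 ≤ w) (h1 : w ≤ 1) : dw γ w ≤ γ := by
  have : w ^ 2 ≤ 1 := by nlinarith
  unfold dw; nlinarith

lemma gY_bd (hγ : 1 < γ) {w : ℝ} (h0 : 0 ≤ w) (h1 : w ≤ 1) : 1 / (2 * γ) * w ^ 2 ≤ gY γ w ∧ gY γ w ≤ 1 * w ^ 2 := by
  have a := dw_gt hγ w; have b := dw_le hγ h0 h1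
  have : w ^ 2 ≤ 1 := by nlinarith
  unfold gY
  constructor
  · rw [div_mul_eq_mul_div, one_mul]
    gcongr
    linarith
  · rw [one_mul]; apply div_le_self (sq_nonneg _); nlinarith [sq_nonneg w]

lemma GY_bd (hγ : 1 < γ) {w : ℝ} (h0 : 0 ≤ w) (h1 : w ≤ 1) : 1 / (6 * γ) * w ^ 3 ≤ GY γ w ∧ GY γ w ≤ 1 / 3 * w ^ 3 := by
  constructor
  · have := pow_cmp (f := fun w => - GY γ w) (f' := fun w => - gY γ w) (c := -(1 / (2 * γ))) (n := 2) (W := 1)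
      (fun w => (GY_deriv hγ w).hasDerivAt.neg) (by simp [GY_zero]) (fun w a b => by linarith [(gY_bd hγ a b).1]) h0 h1
    norm_num at this
    have e : 1 / (6 * γ) * w ^ 3 = γ⁻¹ * (1 / 2) / 3 * w ^ 3 := by field_simp; norm_num; ring
    rw [e]; linarith
  · have := pow_cmp (f := fun w => GY γ w) (f' := fun w => gY γ w) (c := 1) (n := 2) (W := 1)
      (fun w => (GY_deriv hγ w).hasDerivAt) (by simp [GY_zero]) (fun w a b => (gY_bd hγ a b).2) h0 h1
    norm_num at this ⊢
    exact this

lemma rw_bd (hγ : 1 < γ) {w : ℝ} (h0 : 0 ≤ w) (h1 : w ≤ 1) :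
    γ ^ (-(1 / (γ - 1))) ≤ (dw γ w) ^ (-(1 / (γ - 1))) ∧ (dw γ w) ^ (-(1 / (γ - 1))) ≤ 1 := by
  have a := dw_gt hγ w; have b := dw_le hγ h0 h1
  have e : -(1 / (γ - 1)) ≤ 0 := by
    have : 0 < γ - 1 := by linarith
    have : 0 < 1 / (γ - 1) := by positivity
    linarith
  exact ⟨Real.rpow_le_rpow_of_nonpos (by linarith) b e, Real.rpow_le_one_of_one_le_of_nonpos a.le e⟩

lemma yw_bd (hγ : 1 < γ) {w : ℝ} (h0 : 0 ≤ w) (h1 : w ≤ 1) :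
    1 / (8 * γ) * w ^ 4 ≤ -Afun γ (qw γ w) ∧ -Afun γ (qw γ w) ≤ 1 / (4 * γ ^ (-(1 / (γ - 1)))) * w ^ 4 := by
  have z : Afun γ (qw γ 0) = 0 := by rw [qw_zero]; simp [Afun]
  have hr0 : 0 < γ ^ (-(1 / (γ - 1))) := Real.rpow_pos_of_pos (by linarith) _
  constructor
  · have := pow_cmp (f := fun w => - -Afun γ (qw γ w)) (c := -(1 / (2 * γ))) (n := 3) (W := 1)
      (fun w => (yw_deriv hγ w).neg) (by simp [z]) (fun w a b => by
        have r := rw_bd hγ a b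
        have d1 := dw_gt hγ w; have d2 := dw_le hγ a b
        have : w ^ 2 ≤ 1 := by nlinarith
        have : 1 / (2 * γ) * w ^ 3 ≤ w ^ 3 / ((dw γ w) ^ (-(1 / (γ - 1))) * ((1 + w ^ 2) * dw γ w)) := by
          rw [div_mul_eq_mul_div, one_mul]
          have r0 := Real.rpow_pos_of_pos (dw_pos hγ w) (-(1 / (γ - 1)))
          have r2 := r.2
          revert r0 r2
          generalize (dw γ w) ^ (-(1 / (γ - 1))) = rr
          intro r0 r2
          have dp := dw_pos hγ w
          apply div_le_div_of_nonneg_left (by positivity) (by positivity)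
          calc rr * ((1 + w ^ 2) * dw γ w) ≤ 1 * ((1 + 1) * γ) := by gcongr
            _ = _ := by ring
        linarith) h0 h1
    norm_num at this
    have e : 1 / (8 * γ) * w ^ 4 = γ⁻¹ * (1 / 2) / 4 * w ^ 4 := by field_simp; norm_num; ring
    rw [e]; linarith
  · have := pow_cmp (f := fun w => -Afun γ (qw γ w)) (c := 1 / γ ^ (-(1 / (γ - 1)))) (n := 3) (W := 1)
      (fun w => (yw_deriv hγ w)) (by simp [z]) (fun w a b => by
        have r := rw_bd hγ a b
        have d1 := dw_gt hγ w
        rw [div_mul_eq_mul_div, one_mul]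
        have r1 := r.1
        have hr0 := hr0
        revert r1 hr0
        generalize (dw γ w) ^ (-(1 / (γ - 1))) = rr
        generalize γ ^ (-(1 / (γ - 1))) = r0
        intro r1 hr0
        apply div_le_div_of_nonneg_left (by positivity) hr0
        calc r0 = r0 * (1 * 1) := by ring
          _ ≤ rr * ((1 + w ^ 2) * dw γ w) := by
            have := sq_nonneg w
            apply mul_le_mul r1 _ (by norm_num) (hr0.le.trans r1)
            nlinarith) h0 h1
    have e : 1 / (4 * γ ^ (-(1 / (γ - 1)))) * w ^ 4 = 1 / γ ^ (-(1 / (γ - 1))) / ((3 : ℕ) + 1) * w ^ (3 + 1) := by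
      push_cast; norm_num; left; ring
    rw [e]; exact this

lemma Cw_lip (hγ : 1 < γ) {u v : ℝ} (h0 : 0 < u) (huv : u ≤ v) (h1 : v ≤ 1) :
    Cw γ u - Cw γ v ≤ 4 * γ / u ^ 4 * (GY γ v - GY γ u) := by
  have M : MonotoneOn (fun w => 4 * γ / u ^ 4 * GY γ w + Cw γ w) (Icc u v) := by
    have D : ∀ x ∈ Icc u v, HasDerivAt (fun w => 4 * γ / u ^ 4 * GY γ w + Cw γ w)
      (4 * γ / u ^ 4 * gY γ x + (-(dw γ x) ^ (-(1 / (γ - 1))) * (1 / dw γ x + 1 / x ^ 2))) x := fun x hx =>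
      ((GY_deriv hγ x).hasDerivAt.const_mul _).add (Cw_deriv hγ (h0.trans_le hx.1))
    apply monotoneOn_of_deriv_nonneg (convex_Icc u v)
    · exact fun x hx => (D x hx).continuousAt.continuousWithinAt
    · exact fun x hx => (D x (interior_subset hx)).differentiableAt.differentiableWithinAt
    · intro x hx
      have hx' := interior_subset hx
      rw [(D x hx').deriv]
      have x0 : 0 < x := h0.trans_le hx'.1
      have x1 : x ≤ 1 := hx'.2.trans h1
      have g := (gY_bd hγ x0.le x1).1
      have r := rw_bd hγ x0.le x1
      have d := dw_gt hγ x
      have r0 := Real.rpow_pos_of_pos (dw_pos hγ x) (-(1 / (γ - 1)))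
      have e1 : (dw γ x) ^ (-(1 / (γ - 1))) * (1 / dw γ x + 1 / x ^ 2) ≤ 2 / u ^ 2 := by
        calc (dw γ x) ^ (-(1 / (γ - 1))) * (1 / dw γ x + 1 / x ^ 2) ≤ 1 * (1 / u ^ 2 + 1 / u ^ 2) := by
              have hux := hx'.1
              have hu1 : u ^ 2 ≤ 1 := by nlinarith
              gcongr
              · exact r.2
              · linarith
          _ = _ := by ring
      have e2 : 2 / u ^ 2 ≤ 4 * γ / u ^ 4 * gY γ x := by
        calc 2 / u ^ 2 = 4 * γ / u ^ 4 * (1 / (2 * γ) * u ^ 2) := by field_simp; norm_num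
          _ ≤ 4 * γ / u ^ 4 * (1 / (2 * γ) * x ^ 2) := by have := hx'.1; gcongr
          _ ≤ _ := by gcongr
      linarith
  have := M ⟨le_rfl, huv⟩ ⟨huv, le_rfl⟩ huv
  simp only at this
  linarith

noncomputable def WY (γ : ℝ) : ℝ → ℝ := Function.invFunOn (GY γ) (Ici 0)

lemma WY_eq (hγ : 1 < γ) {w : ℝ} (hw : 0 ≤ w) : WY γ (GY γ w) = w :=
  invFunOn_eq' (GY_mono hγ).injOn hw

lemma WY_deriv (hγ : 1 < γ) {w : ℝ} (hw : 0 < w) : HasDerivAt (WY γ) (gY γ w)⁻¹ (GY γ w) :=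
  invFunOn_deriv (GY_mono hγ).injOn (Ici_mem_nhds hw) (GY_deriv hγ w) (gY_pos hγ hw).ne'

lemma WY_surj (hγ : 1 < γ) {w2 Y : ℝ} (hw : 0 ≤ w2) (h0 : 0 ≤ Y) (h1 : Y ≤ GY γ w2) : ∃ w, 0 ≤ w ∧ w ≤ w2 ∧ GY γ w = Y := by
  have := intermediate_value_Icc hw (f := GY γ)
    (fun x _ => (GY_deriv hγ x).hasDerivAt.continuousAt.continuousWithinAt)
  rw [GY_zero] at this
  obtain ⟨w, a, b⟩ := this ⟨h0, h1⟩
  exact ⟨w, a.1, a.2, b⟩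

lemma w_t (hγ : 1 < γ) {w t : ℝ} (h0 : 0 ≤ w) (h1 : w ≤ 1) (ht : 0 ≤ t) (h : GY γ w ≤ t ^ 3) : w ≤ 6 * γ * t := by
  have g := (GY_bd hγ h0 h1).1
  have : w ^ 3 ≤ (6 * γ * t) ^ 3 := by
    have e : w ^ 3 = 6 * γ * (1 / (6 * γ) * w ^ 3) := by field_simp
    rw [e, mul_pow]
    calc 6 * γ * (1 / (6 * γ) * w ^ 3) ≤ 6 * γ * t ^ 3 := by gcongr; linarith
      _ ≤ (6 * γ) ^ 3 * t ^ 3 := by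
        gcongr
        exact le_self_pow₀ (by linarith) (by norm_num)
  exact le_of_pow_le_pow_left₀ (by norm_num) (by positivity) this

lemma t_w (hγ : 1 < γ) {w t : ℝ} (h0 : 0 ≤ w) (h1 : w ≤ 1) (h : t ^ 3 ≤ GY γ w) : t ≤ w := by
  have g := (GY_bd hγ h0 h1).2
  have : t ^ 3 ≤ w ^ 3 := by have : 0 ≤ w ^ 3 := by positivity
                             linarith
  exact (Odd.strictMono_pow (by decide)).le_iff_le.mp this

theorem exists_gas (hγ : 1 < γ) : ∃ Y0 ca cb L Lq ya yb q C y, GasD γ Y0 ca cb L Lq ya yb q C y := by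
  have hc := cstar_pos hγ
  have hlt := cstar_lt hγ
  obtain ⟨w2, hw0, hw1, hw2⟩ : ∃ w2 : ℝ, 0 < w2 ∧ w2 ≤ 1 ∧ w2 ≤ cstar γ * ((qmaxF γ - cstar γ) / 2) := by
    refine ⟨min 1 (cstar γ * ((qmaxF γ - cstar γ) / 2)), ?_, min_le_left _ _, min_le_right _ _⟩
    have : 0 < qmaxF γ - cstar γ := by linarith
    positivity
  have hr0 : 0 < γ ^ (-(1 / (γ - 1))) := Real.rpow_pos_of_pos (by linarith) _
  have hγ0 : 0 < γ := by linarith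
  have Y0pos : 0 < GY γ w2 := by
    have := GY_mono hγ (show (0:ℝ) ∈ Ici 0 from mem_Ici.mpr le_rfl) (show w2 ∈ Ici 0 from hw0.le) hw0
    rwa [GY_zero] at this
  -- surjectivity
  have sj : ∀ Y, 0 ≤ Y → Y ≤ GY γ w2 → ∃ w, 0 ≤ w ∧ w ≤ w2 ∧ GY γ w = Y := fun Y a b => WY_surj hγ hw0.le a b
  have sjp : ∀ Y, 0 < Y → Y ≤ GY γ w2 → ∃ w, 0 < w ∧ w ≤ w2 ∧ GY γ w = Y := by
    intro Y a b
    obtain ⟨w, h1, h2, h3⟩ := sj Y a.le b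
    refine ⟨w, lt_of_le_of_ne h1 ?_, h2, h3⟩
    rintro rfl
    rw [GY_zero] at h3; linarith
  have W0 : WY γ 0 = 0 := by have := WY_eq hγ (le_refl (0:ℝ)); rwa [GY_zero] at this
  have Wc : ContinuousOn (WY γ) (Icc 0 (GY γ w2)) := by
    intro Y hY
    rcases eq_or_lt_of_le hY.1 with h | h
    · subst h
      unfold ContinuousWithinAt
      rw [W0]
      have z : Tendsto (fun Y : ℝ => 6 * γ * Y ^ ((1:ℝ) / 3)) (𝓝[Icc 0 (GY γ w2)] 0) (𝓝 0) := by
        have : Continuous fun Y : ℝ => 6 * γ * Y ^ ((1:ℝ) / 3) :=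
          continuous_const.mul (Real.continuous_rpow_const (by norm_num))
        have := this.tendsto 0
        rw [Real.zero_rpow (by norm_num), mul_zero] at this
        exact this.mono_left nhdsWithin_le_nhds
      refine squeeze_zero' ?_ ?_ z
      · filter_upwards [self_mem_nhdsWithin] with Y hY
        obtain ⟨w, a, b, rfl⟩ := sj Y hY.1 hY.2
        rw [WY_eq hγ a]; exact a
      · filter_upwards [self_mem_nhdsWithin] with Y hY
        obtain ⟨w, a, b, e⟩ := sj Y hY.1 hY.2
        have e2 : WY γ Y = w := by rw [← e, WY_eq hγ a]
        rw [e2]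
        refine w_t hγ a (b.trans hw1) (Real.rpow_nonneg hY.1 _) ?_
        rw [e, ← Real.rpow_natCast, ← Real.rpow_mul hY.1]; norm_num
    · obtain ⟨w, a, b, rfl⟩ := sjp Y h hY.2
      exact (WY_deriv hγ a).continuousAt.continuousWithinAt
  refine ⟨GY γ w2, γ ^ (-(1 / (γ - 1))) / (6 * γ), 1, 4 * γ, 6 * γ / cstar γ ^ 2, 1 / (8 * γ),
    1 / (4 * γ ^ (-(1 / (γ - 1)))) * (6 * γ) ^ 4, fun Y => qw γ (WY γ Y), fun Y => Cw γ (WY γ Y),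
    fun Y => -Afun γ (qw γ (WY γ Y)), ?_⟩
  refine ⟨Y0pos, by positivity, one_pos, by positivity, by positivity, by positivity, by positivity, ?_, ?_, ?_, ?_, ?_, ?_,
    ?_, ?_, ?_, ?_, ?_, ?_, ?_, ?_, ?_, ?_, ?_, ?_⟩
  · intro Y _ _; exact qw_ge hγ _
  · intro Y a b
    obtain ⟨w, h1, h2, rfl⟩ := sj Y a b
    simp only [WY_eq hγ h1]
    refine (qw_le hγ w).trans ?_
    have : w ^ 2 ≤ cstar γ * ((qmaxF γ - cstar γ) / 2) := by nlinarith
    rw [mul_comm, ← div_le_iff₀ hc] at this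
    linarith
  · exact (qw_cont hγ).comp_continuousOn Wc
  · intro Y a b
    obtain ⟨w, h1, h2, rfl⟩ := sjp Y a b
    exact (qw_cont hγ).continuousAt.comp (WY_deriv hγ h1).continuousAt
  · intro t Y ht a hY b
    obtain ⟨w, h1, h2, e⟩ := sj Y a (hY.trans b)
    have e2 : WY γ Y = w := by rw [← e, WY_eq hγ h1]
    simp only [e2]
    have hw := w_t hγ h1 (h2.trans hw1) ht (by rw [e]; exact hY)
    refine (qw_le hγ w).trans ?_
    have : w ^ 2 / cstar γ ≤ 6 * γ * t / cstar γ := by gcongr; nlinarith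
    have e3 : cstar γ * (1 + 6 * γ / cstar γ ^ 2 * t) = cstar γ + 6 * γ * t / cstar γ := by field_simp
    rw [e3]; linarith
  · intro Y a b
    obtain ⟨w, h1, h2, rfl⟩ := sjp Y a b
    simp only [WY_eq hγ h1.le]; exact Cw_pos hγ h1
  · intro Y a b
    obtain ⟨w, h1, h2, rfl⟩ := sjp Y a b
    refine ContinuousAt.comp (g := Cw γ) ?_ (WY_deriv hγ h1).continuousAt
    rw [WY_eq hγ h1.le]; exact (Cw_deriv hγ h1).continuousAt
  · intro a b h0 hab h1
    obtain ⟨u, a1, a2, rfl⟩ := sjp a h0 (hab.trans h1)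
    obtain ⟨v, b1, b2, rfl⟩ := sjp b (h0.trans_le hab) h1
    simp only [WY_eq hγ a1.le, WY_eq hγ b1.le]
    exact Cw_anti hγ a1 b1 ((GY_mono hγ).le_iff_le a1.le b1.le |>.mp hab)
  · intro t ht h
    obtain ⟨w, h1, h2, e⟩ := sjp _ (by positivity) h
    have e2 : WY γ (t ^ 3) = w := by rw [← e, WY_eq hγ h1.le]
    simp only [e2]
    have hw := w_t hγ h1.le (h2.trans hw1) ht.le (by rw [e])
    have r := rw_bd hγ h1.le (h2.trans hw1)
    unfold Cw
    rw [div_div]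
    exact div_le_div₀ (hr0.le.trans r.1) r.1 h1 hw
  · intro t ht h
    obtain ⟨w, h1, h2, e⟩ := sjp _ (by positivity) h
    have e2 : WY γ (t ^ 3) = w := by rw [← e, WY_eq hγ h1.le]
    simp only [e2]
    have hw := t_w hγ h1.le (h2.trans hw1) (by rw [e])
    have r := rw_bd hγ h1.le (h2.trans hw1)
    unfold Cw
    gcongr
    exact r.2
  · intro t a b ht hta hab h1
    have h0 : 0 < a := lt_of_lt_of_le (by positivity) hta
    obtain ⟨u, a1, a2, rfl⟩ := sjp a h0 (hab.trans h1)
    obtain ⟨v, b1, b2, rfl⟩ := sjp b (h0.trans_le hab) h1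
    simp only [WY_eq hγ a1.le, WY_eq hγ b1.le]
    refine (Cw_lip hγ a1 ((GY_mono hγ).le_iff_le a1.le b1.le |>.mp hab) (b2.trans hw1)).trans ?_
    have := t_w hγ a1.le (a2.trans hw1) hta
    have : 0 ≤ GY γ v - GY γ u := by linarith
    gcongr
  · simp only [W0, qw_zero]; simp [Afun]
  · intro Y a b
    simp only [neg_neg]
    exact Ainv_eq hγ (qw_ge hγ _) (qw_lt hγ _)
  · have : Continuous (fun w => -Afun γ (qw γ w)) := continuous_iff_continuousAt.mpr fun w => (yw_deriv hγ w).continuousAt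
    exact this.comp_continuousOn Wc
  · intro Y a b
    obtain ⟨w, h1, h2, rfl⟩ := sjp Y a b
    have d := yw_deriv hγ w
    rw [← WY_eq hγ h1.le] at d
    have := HasDerivAt.comp (GY γ w) d (WY_deriv hγ h1)
    refine this.congr_deriv ?_
    simp only [WY_eq hγ h1.le]
    have hd := dw_pos hγ w
    have hr := Real.rpow_pos_of_pos hd (-(1 / (γ - 1)))
    unfold gY Cw
    field_simp
  · intro t ht h
    obtain ⟨w, h1, h2, e⟩ := sj _ (by positivity) h
    have e2 : WY γ (t ^ 3) = w := by rw [← e, WY_eq hγ h1]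
    simp only [e2]
    have hw := t_w hγ h1 (h2.trans hw1) (by rw [e])
    refine le_trans ?_ (yw_bd hγ h1 (h2.trans hw1)).1
    gcongr
  · intro t ht h
    obtain ⟨w, h1, h2, e⟩ := sj _ (by positivity) h
    have e2 : WY γ (t ^ 3) = w := by rw [← e, WY_eq hγ h1]
    simp only [e2]
    have hw := w_t hγ h1 (h2.trans hw1) ht (by rw [e])
    refine (yw_bd hγ h1 (h2.trans hw1)).2.trans ?_
    rw [mul_assoc, ← mul_pow]
    gcongr
  · intro Y a b
    obtain ⟨w, h1, h2, rfl⟩ := sjp Y a b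
    simp only [WY_eq hγ h1.le, neg_neg]
    exact b_qw hγ h1
end gas
end

section
open Real Set Filter Topology

lemma exists_small (S : SC) : ∃ δ0 > 0, ∀ x, 0 < x → x ≤ δ0 → SmallPt S x (x ^ S.μ) := by
  have hμ := S.hμ
  have hA := S.hA; have hr := S.r0_pos; have hG := S.Gc_pos; have hb := S.hb
  have hv := S.v1_pos; have hcs := S.hcs; have hc1 := S.c1_pos; have hd := S.hd; have hY := S.hY0
  have T : Tendsto (fun x : ℝ => x ^ (S.μ - 1)) (𝓝[>] 0) (𝓝 0) := by
    have := (Real.continuous_rpow_const (q := S.μ - 1) (by linarith)).tendsto 0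
    rw [Real.zero_rpow (by linarith)] at this
    exact this.mono_left nhdsWithin_le_nhds
  have ev : ∀ k c : ℝ, 0 < c → ∀ᶠ x : ℝ in 𝓝[>] 0, k * x ^ (S.μ - 1) ≤ c := by
    intro k c hc
    have := T.const_mul k
    rw [mul_zero] at this
    exact this.eventually_le_const hc
  have e1 : ∀ᶠ x : ℝ in 𝓝[>] 0, x ≤ 1 := by
    have : Tendsto (fun x : ℝ => x) (𝓝[>] 0) (𝓝 0) := nhdsWithin_le_nhds
    exact this.eventually_le_const one_pos
  have hW : 0 < (S.d + 1) / (S.cs * S.c1) := by positivity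
  have all := (e1.and (ev S.A (1/2) (by norm_num))).and ((ev S.r0 (1/2) (by norm_num)).and ((ev S.Gc S.v1 hv).and
    ((ev (S.b ^ 3) S.Y0 hY).and (ev ((S.d + 1) / (S.cs * S.c1)) 1 one_pos))))
  obtain ⟨δ, hδ, H⟩ := (mem_nhdsGT_iff_exists_Ioc_subset (a := (0:ℝ))).1 all
  refine ⟨δ, hδ, fun x hx hxδ => ?_⟩
  obtain ⟨⟨h1, h2⟩, h3, h4, h5, h6⟩ := H ⟨hx, hxδ⟩
  have eX : x ^ S.μ = x * x ^ (S.μ - 1) := by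
    rw [← Real.rpow_one_add' hx.le (by linarith)]; congr 1; ring
  have ed : x ^ S.μ / x = x ^ (S.μ - 1) := by rw [eX]; field_simp
  have hp : 0 < x ^ (S.μ - 1) := Real.rpow_pos_of_pos hx _
  have hp1 : x ^ (S.μ - 1) ≤ 1 := Real.rpow_le_one hx.le h1 (by linarith)
  have hXp : 0 < x ^ S.μ := Real.rpow_pos_of_pos hx _
  have hX1 : x ^ S.μ ≤ x ^ (S.μ - 1) := by rw [eX]; nlinarith
  refine ⟨hx, h1, hXp, by rw [eX]; nlinarith, ?_, by rw [ed]; exact h3, by rw [ed]; exact h4, ?_, by rw [ed]; exact h6⟩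
  · exact (mul_le_mul_of_nonneg_left hX1 hA.le).trans h2
  · rw [mul_pow]
    refine le_trans ?_ h5
    apply mul_le_mul_of_nonneg_left _ (by positivity)
    refine (pow_le_of_le_one hXp.le (hX1.trans hp1) (by norm_num)).trans hX1

/-- choice of constants -/
lemma exists_SC {γ Y0 ca cb L Lq ya yb m lamp δ1 δ2 : ℝ} {q C y : ℝ → ℝ} (hγ : 1 < γ) (G : GasD γ Y0 ca cb L Lq ya yb q C y)
    (hm : 0 < m) (hlam : 2 < lamp) (hδ1 : 0 < δ1) (hδ12 : δ1 ≤ δ2) :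
    ∃ S : SC, S.m = m ∧ S.μ = (lamp + 2) / 4 ∧ S.cs = cstar γ ∧ S.ca = ca ∧ S.cb = cb ∧ S.L = L ∧ S.Y0 = Y0 ∧ S.d = δ2 ∧
      S.t1 = δ1 / (2 * (lamp + 1)) ∧ S.t2 = δ2 / (lamp + 1) ∧
      S.A = Lq * S.b + S.t2 + Lq * S.b * S.t2 + S.t2 * 2 ^ S.μ := by
  have hc := cstar_pos hγ
  have hca := G.hca; have hcb := G.hcb; have hLq := G.hLq
  have hδ2 : 0 < δ2 := by linarith
  have hl1 : 0 < lamp + 1 := by linarith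
  set t1 := δ1 / (2 * (lamp + 1)) with ht1
  set t2 := δ2 / (lamp + 1) with ht2
  have t1p : 0 < t1 := by positivity
  have t2p : 0 < t2 := by positivity
  have hμ : 0 < (lamp + 2) / 4 := by linarith
  set a := min 1 (cstar γ * (t1 / (2 * m)) * ca / (6 * ((lamp + 2) / 4))) with hadef
  have ap : 0 < a := by
    apply lt_min one_pos; positivity
  have a1 : a ≤ 1 := min_le_left _ _
  set b := max 1 (2 * cstar γ * (2 * t2 / m + 1) * cb / 3) with hbdef
  have b1 : 1 ≤ b := le_max_left _ _
  refine ⟨⟨m, (lamp + 2) / 4, cstar γ, Lq * b + t2 + Lq * b * t2 + t2 * 2 ^ ((lamp + 2) / 4), ca, cb, L, Y0, δ2, t1, t2, a, b, hm,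
    by linarith, hc, by positivity, hca, hcb, G.hL, G.hY0, hδ2, t1p, ?_, ap, a1.trans b1, ?_, ?_⟩, rfl, rfl, rfl, rfl, rfl, rfl, rfl, rfl, rfl,
    rfl, rfl⟩
  · rw [ht1, ht2]
    apply div_le_div₀ hδ2.le hδ12 hl1; linarith
  · have h1 : a ^ 4 ≤ a := pow_le_of_le_one ap.le a1 (by norm_num)
    have h2 : a ≤ _ := min_le_right _ _
    rw [le_div_iff₀ (by positivity)] at h2
    nlinarith
  · have h1 : b ≤ b ^ 4 := le_self_pow₀ b1 (by norm_num)
    have h2 : _ ≤ b := le_max_right _ _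
    rw [div_le_iff₀ (by norm_num)] at h2
    linarith

section wall
variable {lamp δ1 δ2 l : ℝ} {f : ℝ → ℝ}

/-- the wall is C² with arctan derivative -/
lemma wall_deriv (N : NozzlePlus lamp δ1 δ2 l f) (x : ℝ) :
    HasDerivAt (deriv f) (deriv (deriv f) x) x := by
  have h : ContDiff ℝ 2 (deriv f) := (N.1.iterate_deriv' 2 1)
  exact (h.differentiable (by norm_num) x).hasDerivAt

lemma wall_cont (N : NozzlePlus lamp δ1 δ2 l f) : Continuous (deriv (deriv f)) := by
  have h : ContDiff ℝ 1 (deriv (deriv f)) := (N.1.iterate_deriv' 1 2)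
  exact h.continuous

lemma wall_deriv2 (N : NozzlePlus lamp δ1 δ2 l f) (x : ℝ) :
    HasDerivAt (deriv (deriv f)) (deriv (deriv (deriv f)) x) x := by
  have h : ContDiff ℝ 1 (deriv (deriv f)) := (N.1.iterate_deriv' 1 2)
  exact (h.differentiable (by norm_num) x).hasDerivAt

lemma Th_deriv (N : NozzlePlus lamp δ1 δ2 l f) (x : ℝ) :
    HasDerivAt (ThP f) (deriv (deriv f) x / (1 + deriv f x ^ 2)) x := by
  have := (wall_deriv N x).arctan
  refine this.congr_deriv ?_
  ring

lemma Th_cont (N : NozzlePlus lamp δ1 δ2 l f) : Continuous (ThP f) :=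
  continuous_iff_continuousAt.mpr fun x => (Th_deriv N x).continuousAt

lemma f2_mono (N : NozzlePlus lamp δ1 δ2 l f) : MonotoneOn (deriv (deriv f)) (Icc 0 l) := by
  apply monotoneOn_of_deriv_nonneg (convex_Icc 0 l) (wall_cont N).continuousOn
  · exact fun x _ => (wall_deriv2 N x).differentiableAt.differentiableWithinAt
  · intro x hx
    exact (N.2.2.2 x (interior_subset hx)).2.2

/-- integrate a derivative comparison -/
lemma int_cmp {u u' v v' : ℝ → ℝ} {a b : ℝ} (hab : a ≤ b) (hu : ∀ x ∈ Icc a b, HasDerivAt u (u' x) x)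
    (hv : ∀ x ∈ Icc a b, HasDerivAt v (v' x) x) (h : ∀ x ∈ Icc a b, u' x ≤ v' x) : u b - u a ≤ v b - v a := by
  have M : MonotoneOn (fun x => v x - u x) (Icc a b) := by
    have D : ∀ x ∈ Icc a b, HasDerivAt (fun x => v x - u x) (v' x - u' x) x := fun x hx => (hv x hx).sub (hu x hx)
    apply monotoneOn_of_deriv_nonneg (convex_Icc a b)
    · exact fun x hx => (D x hx).continuousAt.continuousWithinAt
    · exact fun x hx => (D x (interior_subset hx)).differentiableAt.differentiableWithinAt
    · intro x hx
      rw [(D x (interior_subset hx)).deriv]; linarith [h x (interior_subset hx)]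
  have := M ⟨le_rfl, hab⟩ ⟨hab, le_rfl⟩ hab
  simp only at this; linarith

lemma pw_deriv (hlam : 2 < lamp) (c x : ℝ) :
    HasDerivAt (fun x : ℝ => c / (lamp + 1) * x ^ (lamp + 1)) (c * x ^ lamp) x := by
  have := (Real.hasDerivAt_rpow_const (x := x) (p := lamp + 1) (Or.inr (by linarith))).const_mul (c / (lamp + 1))
  refine this.congr_deriv ?_
  have : lamp + 1 ≠ 0 := by linarith
  rw [add_sub_cancel_right]; field_simp

lemma g_bd (N : NozzlePlus lamp δ1 δ2 l f) (hlam : 2 < lamp) (hδ1 : 0 < δ1) {x : ℝ} (h0 : 0 ≤ x) (h1 : x ≤ l) :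
    0 ≤ deriv f x ∧ deriv f x ≤ δ2 / (lamp + 1) * x ^ (lamp + 1) := by
  have z : (0:ℝ) ^ (lamp + 1) = 0 := Real.zero_rpow (by linarith)
  constructor
  · have := int_cmp h0 (u := fun _ => 0) (u' := fun _ => 0) (v := deriv f) (fun x _ => hasDerivAt_const x 0)
      (fun x _ => wall_deriv N x) (fun s hs => by
        refine le_trans ?_ (N.2.2.2 s ⟨hs.1, hs.2.trans h1⟩).1
        have := Real.rpow_nonneg hs.1 lamp; positivity)
    rw [N.2.2.1] at this; linarith
  · have := int_cmp h0 (u := deriv f) (fun x _ => wall_deriv N x) (fun x _ => pw_deriv hlam δ2 x) (fun s hs =>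
        (N.2.2.2 s ⟨hs.1, hs.2.trans h1⟩).2.1)
    rw [N.2.2.1, z] at this; linarith

lemma Th_bd (N : NozzlePlus lamp δ1 δ2 l f) (hlam : 2 < lamp) (hδ1 : 0 < δ1) (hg : ∀ x, 0 ≤ x → x ≤ l → deriv f x ≤ 1)
    {x : ℝ} (h0 : 0 ≤ x) (h1 : x ≤ l) :
    δ1 / (2 * (lamp + 1)) * x ^ (lamp + 1) ≤ ThP f x ∧ ThP f x ≤ δ2 / (lamp + 1) * x ^ (lamp + 1) := by
  have z : (0:ℝ) ^ (lamp + 1) = 0 := Real.zero_rpow (by linarith)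
  have T0 : ThP f 0 = 0 := by simp [ThP, N.2.2.1]
  have pos : ∀ s ∈ Icc 0 x, 0 ≤ deriv (deriv f) s := fun s hs => by
    refine le_trans ?_ (N.2.2.2 s ⟨hs.1, hs.2.trans h1⟩).1
    have := Real.rpow_nonneg hs.1 lamp; positivity
  constructor
  · have := int_cmp h0 (v := ThP f) (fun x _ => pw_deriv hlam (δ1 / 2) x) (fun x _ => Th_deriv N x) (fun s hs => by
      have a := (N.2.2.2 s ⟨hs.1, hs.2.trans h1⟩).1
      have b := g_bd N hlam hδ1 hs.1 (hs.2.trans h1)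
      have c := hg s hs.1 (hs.2.trans h1)
      have hsq : deriv f s ^ 2 ≤ 1 := by nlinarith
      have := pos s hs
      rw [le_div_iff₀ (by positivity)]
      have := Real.rpow_nonneg hs.1 lamp
      have h5 : 0 ≤ δ1 / 2 * s ^ lamp := by positivity
      nlinarith)
    rw [T0, z] at this
    have e : δ1 / (2 * (lamp + 1)) = δ1 / 2 / (lamp + 1) := by rw [div_div]
    rw [e]; linarith
  · have := int_cmp h0 (u := ThP f) (fun x _ => Th_deriv N x) (fun x _ => pw_deriv hlam δ2 x) (fun s hs => by
      refine le_trans ?_ (N.2.2.2 s ⟨hs.1, hs.2.trans h1⟩).2.1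
      apply div_le_self (pos s hs); nlinarith [sq_nonneg (deriv f s)])
    rw [T0, z] at this; linarith

lemma inv_cos (N : NozzlePlus lamp δ1 δ2 l f) (hlam : 2 < lamp) (hδ1 : 0 < δ1) (hg : ∀ x, 0 ≤ x → x ≤ l → deriv f x ≤ 1)
    {x : ℝ} (h0 : 0 ≤ x) (h1 : x ≤ l) : 0 < cos (ThP f x) ∧ cos (ThP f x) ≤ 1 ∧ 1 / cos (ThP f x) ≤ 1 + deriv f x := by
  have b := g_bd N hlam hδ1 h0 h1
  have c := hg x h0 h1
  refine ⟨Real.cos_arctan_pos _, Real.cos_le_one _, ?_⟩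
  unfold ThP
  rw [Real.cos_arctan, one_div_one_div]
  rw [Real.sqrt_le_left (by linarith)]
  nlinarith

end wall
end

section
open Real Set Filter Topology

section wall
variable {lamp δ1 δ2 l : ℝ} {f : ℝ → ℝ}

lemma pow_conv {S : SC} (hS : S.μ = (lamp + 2) / 4) {x : ℝ} (hx : 0 < x) :
    (x ^ S.μ) ^ 4 = x ^ (lamp + 2) ∧ (x ^ S.μ) ^ 4 / x = x ^ (lamp + 1) ∧ (x ^ S.μ) ^ 4 / x ^ 2 = x ^ lamp := by
  have e : (x ^ S.μ) ^ 4 = x ^ (lamp + 2) := by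
    rw [← Real.rpow_natCast, ← Real.rpow_mul hx.le, hS]; congr 1; push_cast; ring
  refine ⟨e, ?_, ?_⟩
  · rw [e, div_eq_iff hx.ne', ← Real.rpow_add_one hx.ne']; congr 1; ring
  · rw [e, div_eq_iff (by positivity), ← Real.rpow_add_natCast hx.ne']; norm_num

lemma kw_aux {k w : ℝ} (h0 : 0 ≤ w) (h : w ≤ k) : (1 - k) * (1 + w) ≤ 1 := by nlinarith [mul_nonneg h0 (h0.trans h)]

set_option maxHeartbeats 800000 in
theorem exists_wall {γ Y0 ca cb L Lq ya yb m : ℝ} {q C y : ℝ → ℝ} (G : GasD γ Y0 ca cb L Lq ya yb q C y)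
    (hlam : 2 < lamp) (hδ1 : 0 < δ1) (hδ12 : δ1 ≤ δ2) (hγ : 1 < γ)
    {S : SC} (eμ : S.μ = (lamp + 2) / 4) (ecs : S.cs = cstar γ) (eca : S.ca = ca) (ecb : S.cb = cb) (eL : S.L = L)
    (eY : S.Y0 = Y0) (ed : S.d = δ2) (et1 : S.t1 = δ1 / (2 * (lamp + 1))) (et2 : S.t2 = δ2 / (lamp + 1))
    (eA : S.A = Lq * S.b + S.t2 + Lq * S.b * S.t2 + S.t2 * 2 ^ S.μ)
    (hl : 0 < l) (small : ∀ x, 0 < x → x ≤ l → SmallPt S x (x ^ S.μ))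
    (N : NozzlePlus lamp δ1 δ2 l f) :
    Wall S l (ThP f) (fun x => deriv (deriv f) (projIcc 0 l hl.le x)) C (fun x Y => q Y / cos (ThP f x)) ∧
    (∀ x, 0 ≤ x → x ≤ l → deriv f x ≤ 1) := by
  have hLq := G.hLq; have hb := S.hb; have ht2 := S.ht2; have hcs := S.hcs
  have hA1 : S.t2 ≤ S.A := by
    rw [eA]
    have : 0 ≤ Lq * S.b + Lq * S.b * S.t2 + S.t2 * 2 ^ S.μ := by positivity
    linarith
  have hA2 : S.t2 * 2 ^ S.μ ≤ S.A := by
    rw [eA]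
    have : 0 ≤ Lq * S.b + S.t2 + Lq * S.b * S.t2 := by positivity
    linarith
  have hA3 : Lq * S.b + S.t2 + Lq * S.b * S.t2 ≤ S.A := by
    rw [eA]
    have : 0 ≤ S.t2 * 2 ^ S.μ := by positivity
    linarith
  have gX : ∀ x, 0 < x → x ≤ l → deriv f x ≤ S.t2 * x ^ S.μ := by
    intro x h0 h1
    refine (g_bd N hlam hδ1 h0.le h1).2.trans ?_
    rw [← et2]
    apply mul_le_mul_of_nonneg_left _ ht2.le
    apply Real.rpow_le_rpow_of_exponent_ge h0 (small x h0 h1).hx1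
    rw [eμ]; linarith
  have hg : ∀ x, 0 ≤ x → x ≤ l → deriv f x ≤ 1 := by
    intro x h0 h1
    rcases eq_or_lt_of_le h0 with h | h
    · rw [← h, N.2.2.1]; norm_num
    · have s := small x h h1
      have := mul_le_mul_of_nonneg_right hA1 s.hX.le
      linarith [gX x h h1, s.hAX]
  refine ⟨?_, hg⟩
  have pj : ∀ x, 0 < x → x ≤ l → (projIcc 0 l hl.le x : ℝ) = x := fun x a b => by
    rw [projIcc_of_mem hl.le ⟨a.le, b⟩]
  have f2pos : ∀ s, s ∈ Icc 0 l → 0 ≤ deriv (deriv f) s := fun s hs => by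
    refine le_trans ?_ (N.2.2.2 s hs).1
    have := Real.rpow_nonneg hs.1 lamp; positivity
  constructor
  · constructor
    · intro a b; rw [eY]; exact G.anti a b
    · intro t; rw [eY, eca]; exact G.lo t
    · intro t; rw [eY, ecb]; exact G.hi t
    · intro t a b; rw [eY, eL]; exact G.lip t a b
  · exact hl
  · exact small
  · intro x y hxy
    exact f2_mono N (projIcc 0 l hl.le x).2 (projIcc 0 l hl.le y).2 (monotone_projIcc hl.le hxy)
  · have h1 : UniformContinuous (fun z : Icc (0:ℝ) l => deriv (deriv f) z) :=
      CompactSpace.uniformContinuous_of_continuous ((wall_cont N).comp continuous_subtype_val)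
    have h2 : UniformContinuous (projIcc 0 l hl.le) := by
      apply LipschitzWith.uniformContinuous (K := 1)
      exact LipschitzWith.projIcc hl.le
    exact h1.comp h2
  · intro x _; exact f2pos _ (projIcc 0 l hl.le x).2
  · intro x h0 h1
    simp only [pj x h0 h1]
    rw [(pow_conv eμ h0).2.2, ed]; exact (N.2.2.2 x ⟨h0.le, h1⟩).2.1
  · intro x h0 h1
    rw [(pow_conv eμ h0).2.1, et1]; exact (Th_bd N hlam hδ1 hg h0.le h1).1
  · intro x h0 h1
    rw [(pow_conv eμ h0).2.1, et2]; exact (Th_bd N hlam hδ1 hg h0.le h1).2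
  · intro x h0 h1 Y hY hY2
    obtain ⟨c0, c1, c2⟩ := inv_cos N hlam hδ1 hg h0.le h1
    have hq := G.qlo Y hY (hY2.trans (by rw [← eY]; exact (small x h0 h1).hY))
    rw [ecs]
    have : 0 < cstar γ := cstar_pos hγ
    rw [le_div_iff₀ c0]; nlinarith
  · intro x h0 h1 Y hY hY2
    obtain ⟨c0, c1, c2⟩ := inv_cos N hlam hδ1 hg h0.le h1
    have s := small x h0 h1
    have hX := s.hX
    have hq := G.qL (S.b * x ^ S.μ) Y (by positivity) hY hY2 (by rw [← eY]; exact s.hY)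
    have hc : 0 < cstar γ := cstar_pos hγ
    have gx := gX x h0 h1
    rw [ecs, div_eq_mul_one_div]
    have hX1 : x ^ S.μ ≤ 1 := s.hXx.trans s.hx1
    have hk : 0 ≤ Lq * S.b := by positivity
    calc q Y * (1 / cos (ThP f x)) ≤ (cstar γ * (1 + Lq * (S.b * x ^ S.μ))) * (1 + S.t2 * x ^ S.μ) := by
          apply mul_le_mul hq (by linarith) (by positivity) (by positivity)
      _ = cstar γ * ((1 + Lq * (S.b * x ^ S.μ)) * (1 + S.t2 * x ^ S.μ)) := by ring
      _ ≤ _ := by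
        apply mul_le_mul_of_nonneg_left _ hc.le
        generalize x ^ S.μ = X at *
        have h5 : X * X ≤ 1 * X := mul_le_mul_of_nonneg_right hX1 hX.le
        have h6 : 0 ≤ Lq * S.b * S.t2 := by positivity
        have h7 := mul_le_mul_of_nonneg_left h5 h6
        have h8 := mul_le_mul_of_nonneg_right hA3 hX.le
        nlinarith
  · intro x σ h0 hσ hσx h1
    simp only [pj x h0 (by linarith)]
    have := int_cmp (a := x) (b := x + σ) (by linarith) (u := fun s => (1 - S.A * x ^ S.μ) * deriv (deriv f) x * s) (u' := fun s => (1 - S.A * x ^ S.μ) * deriv (deriv f) x)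
      (fun s _ => by simpa using (hasDerivAt_id s).const_mul ((1 - S.A * x ^ S.μ) * deriv (deriv f) x)) (fun s _ => Th_deriv N s) (fun s hs => by
        have s0 : 0 < s := h0.trans_le hs.1
        have s1 : s ≤ l := hs.2.trans h1
        have m1 : deriv (deriv f) x ≤ deriv (deriv f) s := f2_mono N ⟨h0.le, by linarith⟩ ⟨s0.le, s1⟩ hs.1
        have b := g_bd N hlam hδ1 s0.le s1
        have p := f2pos x ⟨h0.le, by linarith⟩
        have gs := gX s s0 s1
        have : s ^ S.μ ≤ 2 ^ S.μ * x ^ S.μ := by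
          rw [← Real.mul_rpow (by norm_num) h0.le]
          have := S.hμ
          exact Real.rpow_le_rpow s0.le (by linarith [hs.2]) (by linarith)
        have gs2 : deriv f s ≤ S.A * x ^ S.μ := by
          calc deriv f s ≤ S.t2 * (2 ^ S.μ * x ^ S.μ) := gs.trans (mul_le_mul_of_nonneg_left this ht2.le)
            _ = S.t2 * 2 ^ S.μ * x ^ S.μ := by ring
            _ ≤ _ := mul_le_mul_of_nonneg_right hA2 (Real.rpow_nonneg h0.le _)
        have hsq : deriv f s ^ 2 ≤ S.A * x ^ S.μ := by nlinarith [hg s s0.le s1]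
        rw [le_div_iff₀ (by positivity)]
        have hw0 := sq_nonneg (deriv f s)
        generalize S.A * x ^ S.μ = k at *
        generalize deriv f s ^ 2 = w at *
        calc (1 - k) * deriv (deriv f) x * (1 + w) = ((1 - k) * (1 + w)) * deriv (deriv f) x := by ring
          _ ≤ 1 * deriv (deriv f) x := by
            apply mul_le_mul_of_nonneg_right _ p
            exact kw_aux hw0 hsq
          _ ≤ _ := by rw [one_mul]; exact m1)
    linarith
  · intro x σ h0 hσ hσx h1
    simp only [pj (x + σ) (by linarith) h1]
    have := int_cmp (a := x) (b := x + σ) (by linarith) (v := fun s => deriv (deriv f) (x + σ) * s) (v' := fun s => deriv (deriv f) (x + σ)) (fun s _ => Th_deriv N s)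
      (fun s _ => by simpa using (hasDerivAt_id s).const_mul (deriv (deriv f) (x + σ))) (fun s hs => by
        have s0 : 0 < s := h0.trans_le hs.1
        have s1 : s ≤ l := hs.2.trans h1
        refine le_trans ?_ (f2_mono N ⟨s0.le, s1⟩ ⟨by linarith, h1⟩ hs.2)
        apply div_le_self (f2pos s ⟨s0.le, s1⟩); nlinarith [sq_nonneg (deriv f s)])
    linarith

end wall
end

section
open Real Set MeasureTheory Filter Topology

section weak

lemma pd_xi {ξ : ℝ × ℝ → ℝ} (h : ContDiff ℝ 1 ξ) :
    (∀ x y, HasDerivAt (fun x => ξ (x, y)) (pdx ξ (x, y)) x) ∧ (∀ x y, HasDerivAt (fun y => ξ (x, y)) (pdy ξ (x, y)) y) ∧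
    Continuous (pdx ξ) ∧ Continuous (pdy ξ) := by
  have hd : Differentiable ℝ ξ := h.differentiable (by norm_num)
  have hc : Continuous (fderiv ℝ ξ) := h.continuous_fderiv (by norm_num)
  have e1 : ∀ x y, HasDerivAt (fun x => ξ (x, y)) (fderiv ℝ ξ (x, y) (1, 0)) x := by
    intro x y
    have := (hd (x, y)).hasFDerivAt.comp_hasDerivAt x ((hasDerivAt_id x).prodMk (hasDerivAt_const x y))
    exact this
  have e2 : ∀ x y, HasDerivAt (fun y => ξ (x, y)) (fderiv ℝ ξ (x, y) (0, 1)) y := by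
    intro x y
    have := (hd (x, y)).hasFDerivAt.comp_hasDerivAt y ((hasDerivAt_const y x).prodMk (hasDerivAt_id y))
    exact this
  have f1 : pdx ξ = fun p => fderiv ℝ ξ p (1, 0) := by
    funext p; exact (e1 p.1 p.2).deriv
  have f2 : pdy ξ = fun p => fderiv ℝ ξ p (0, 1) := by
    funext p; exact (e2 p.1 p.2).deriv
  refine ⟨fun x y => by rw [f1]; exact e1 x y, fun x y => by rw [f2]; exact e2 x y, ?_, ?_⟩
  · rw [f1]; exact hc.clm_apply continuous_const
  · rw [f2]; exact hc.clm_apply continuous_const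

variable {T : ℝ × ℝ → ℝ} {K : NNReal}

lemma lip_x (h : LipschitzWith K T) (y : ℝ) : LipschitzWith K (fun x => T (x, y)) := by
  have := h.comp (LipschitzWith.prodMk_right (β := ℝ) (α := ℝ) y)
  rw [mul_one] at this; exact this

lemma lip_y (h : LipschitzWith K T) (x : ℝ) : LipschitzWith K (fun y => T (x, y)) := by
  have := h.comp (LipschitzWith.prodMk_left (β := ℝ) (α := ℝ) x)
  rw [mul_one] at this; exact this

lemma pdx_bd (h : LipschitzWith K T) (p : ℝ × ℝ) : ‖pdx T p‖ ≤ K := norm_deriv_le_of_lipschitz (lip_x h p.2)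
lemma pdy_bd (h : LipschitzWith K T) (p : ℝ × ℝ) : ‖pdy T p‖ ≤ K := norm_deriv_le_of_lipschitz (lip_y h p.1)

lemma pdy_meas (h : Continuous T) : Measurable (pdy T) :=
  measurable_deriv_with_param (f := fun x y => T (x, y)) (by simp only [Function.uncurry_def]; exact h)

lemma pdx_meas (h : Continuous T) : Measurable (pdx T) := by
  have := measurable_deriv_with_param (f := fun y x => T (x, y)) (by
    simp only [Function.uncurry_def]; exact h.comp continuous_swap)
  exact this.comp measurable_swap

lemma rect_int {ζ m : ℝ} {g : ℝ × ℝ → ℝ} {B : ℝ} (hm : Measurable g) (hb : ∀ p ∈ Ioo 0 ζ ×ˢ Ioo 0 m, ‖g p‖ ≤ B) :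
    IntegrableOn g (Ioo 0 ζ ×ˢ Ioo 0 m) := by
  refine Measure.integrableOn_of_bounded (M := B) ?_ hm.aestronglyMeasurable ?_
  · rw [Measure.volume_eq_prod, Measure.prod_prod]
    simp [ENNReal.mul_eq_top]
  · rw [ae_restrict_iff' (measurableSet_Ioo.prod measurableSet_Ioo)]
    exact Eventually.of_forall hb

lemma rect_fub1 {ζ m : ℝ} (hζ : 0 < ζ) (hm : 0 < m) {g : ℝ × ℝ → ℝ} (h : IntegrableOn g (Ioo 0 ζ ×ˢ Ioo 0 m)) :
    ∫ p in Ioo 0 ζ ×ˢ Ioo 0 m, g p = ∫ x in (0:ℝ)..ζ, ∫ y in (0:ℝ)..m, g (x, y) := by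
  rw [Measure.volume_eq_prod] at h ⊢
  rw [setIntegral_prod g h, intervalIntegral.integral_of_le hζ.le, integral_Ioc_eq_integral_Ioo]
  congr 1; funext x
  rw [intervalIntegral.integral_of_le hm.le, integral_Ioc_eq_integral_Ioo]

lemma rect_fub2 {ζ m : ℝ} (hζ : 0 < ζ) (hm : 0 < m) {g : ℝ × ℝ → ℝ} (h : IntegrableOn g (Ioo 0 ζ ×ˢ Ioo 0 m)) :
    ∫ p in Ioo 0 ζ ×ˢ Ioo 0 m, g p = ∫ y in (0:ℝ)..m, ∫ x in (0:ℝ)..ζ, g (x, y) := by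
  rw [IntegrableOn, Measure.volume_eq_prod, ← Measure.prod_restrict] at h
  rw [Measure.volume_eq_prod, ← Measure.prod_restrict]
  rw [integral_prod_symm g h, intervalIntegral.integral_of_le hm.le, integral_Ioc_eq_integral_Ioo]
  congr 1; funext x
  rw [intervalIntegral.integral_of_le hζ.le, integral_Ioc_eq_integral_Ioo]

lemma cont_bd {g : ℝ × ℝ → ℝ} (hg : Continuous g) (a b : ℝ) :
    ∃ B, 0 ≤ B ∧ ∀ p ∈ Icc 0 a ×ˢ Icc 0 b, ‖g p‖ ≤ B := by
  obtain ⟨B, hB⟩ := (isCompact_Icc.prod isCompact_Icc).exists_bound_of_continuousOn (s := Icc 0 a ×ˢ Icc 0 b) hg.continuousOn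
  exact ⟨max B 0, le_max_right _ _, fun p hp => (hB p hp).trans (le_max_left _ _)⟩

/-- integration by parts in the first variable -/
lemma ibp_x {T : ℝ → ℝ} (h : LipschitzWith K T) {ζ : ℝ} (T0 : T 0 = 0) {g g' : ℝ → ℝ} (hg : ∀ x, HasDerivAt g (g' x) x)
    (hg' : Continuous g') (gz : g ζ = 0) : ∫ x in (0:ℝ)..ζ, deriv T x * g x = - ∫ x in (0:ℝ)..ζ, T x * g' x := by
  have e : deriv g = g' := funext fun x => (hg x).deriv
  have c1 : ContDiff ℝ 1 g := by
    rw [contDiff_one_iff_deriv, e]; exact ⟨fun x => (hg x).differentiableAt, hg'⟩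
  have := AbsolutelyContinuousOnInterval.integral_mul_deriv_eq_deriv_mul (f := T) (g := g) (a := 0) (b := ζ)
    (h.lipschitzOnWith.absolutelyContinuousOnInterval) (c1.contDiffOn.absolutelyContinuousOnInterval)
  rw [T0, gz, e] at this
  linarith

/-- shift in ψ -/
lemma shift_psi {T a : ℝ → ℝ} (hT : Continuous T) (ha : Continuous a) {m ε : ℝ} (hε : 0 < ε) (T0 : ∀ y, y ≤ 0 → T y = 0) :
    ∫ y in (0:ℝ)..m, T y * ((a (y + ε) - a y) / ε) =
      (∫ s in (0:ℝ)..1, T (m + ε * s - ε) * a (m + ε * s)) - ∫ y in (0:ℝ)..m, (T y - T (y - ε)) / ε * a y := by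
  have ii : ∀ {g : ℝ → ℝ}, Continuous g → ∀ u v, IntervalIntegrable g volume u v := fun h u v => h.intervalIntegrable u v
  have e1 : ∫ y in (0:ℝ)..m, T y * a (y + ε) = ∫ y in ε..(m + ε), T (y - ε) * a y := by
    have := intervalIntegral.integral_comp_add_right (a := 0) (b := m) (fun y => T (y - ε) * a y) ε
    simp only [add_sub_cancel_right, zero_add] at this
    exact this
  have e2 : ∫ y in (0:ℝ)..ε, T (y - ε) * a y = 0 := by
    rw [intervalIntegral.integral_congr (g := fun _ => 0)]
    · simp
    · intro y hy
      rw [uIcc_of_le hε.le] at hy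
      simp [T0 (y - ε) (by linarith [hy.2])]
  have e3 : ∫ y in m..(m + ε), T (y - ε) * a y = ε * ∫ s in (0:ℝ)..1, T (m + ε * s - ε) * a (m + ε * s) := by
    have := intervalIntegral.mul_integral_comp_add_mul (a := 0) (b := 1) (f := fun y => T (y - ε) * a y) ε m
    simp only [mul_zero, add_zero, mul_one] at this
    exact this.symm
  have c1 : Continuous (fun y => T (y - ε) * a y) := by fun_prop
  have e4 := intervalIntegral.integral_add_adjacent_intervals (ii c1 0 ε) (ii c1 ε (m + ε))
  have e5 := intervalIntegral.integral_add_adjacent_intervals (ii c1 0 m) (ii c1 m (m + ε))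
  have e6 : ∫ y in (0:ℝ)..m, T y * ((a (y + ε) - a y) / ε) =
      ε⁻¹ * ((∫ y in (0:ℝ)..m, T y * a (y + ε)) - ∫ y in (0:ℝ)..m, T y * a y) := by
    rw [← intervalIntegral.integral_sub (ii (by fun_prop) _ _) (ii (by fun_prop) _ _), ← intervalIntegral.integral_const_mul]
    congr 1; funext y; field_simp
  have e7 : ∫ y in (0:ℝ)..m, (T y - T (y - ε)) / ε * a y =
      ε⁻¹ * ((∫ y in (0:ℝ)..m, T y * a y) - ∫ y in (0:ℝ)..m, T (y - ε) * a y) := by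
    rw [← intervalIntegral.integral_sub (ii (by fun_prop) _ _) (ii (by fun_prop) _ _), ← intervalIntegral.integral_const_mul]
    congr 1; funext y; field_simp
  rw [e6, e7, e1]
  have e8 : ∫ s in (0:ℝ)..1, T (m + ε * s - ε) * a (m + ε * s) = ε⁻¹ * ∫ y in m..(m + ε), T (y - ε) * a y := by
    rw [e3]; field_simp
  rw [e8, ← mul_sub]
  congr 1
  linarith

theorem weakform {T : ℝ × ℝ → ℝ} {K : NNReal} (h : LipschitzWith K T) {ζ m : ℝ} (hζ : 0 < ζ) (hm : 0 < m)
    (T0 : ∀ y, T (0, y) = 0) (Tn : ∀ x y, y ≤ 0 → T (x, y) = 0) {ξ : ℝ × ℝ → ℝ} (hξ : ContDiff ℝ 1 ξ) (ξz : ∀ y, ξ (ζ, y) = 0) :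
    ∫ p in Ioo 0 ζ ×ˢ Ioo 0 m, (pdx T p * pdy ξ p - pdy T p * pdx ξ p) =
      ∫ x in (0:ℝ)..ζ, deriv (fun x => T (x, m)) x * ξ (x, m) := by
  obtain ⟨d1, d2, c1, c2⟩ := pd_xi hξ
  have Tc := h.continuous
  have hK : (0:ℝ) ≤ K := K.2
  obtain ⟨B1, hB1, b1⟩ := cont_bd c1 ζ (m + 1)
  obtain ⟨B2, hB2, b2⟩ := cont_bd c2 ζ (m + 1)
  have sub : ∀ p ∈ Ioo 0 ζ ×ˢ Ioo 0 m, p ∈ Icc 0 ζ ×ˢ Icc 0 (m + 1) := fun p hp =>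
    ⟨⟨hp.1.1.le, hp.1.2.le⟩, ⟨hp.2.1.le, by linarith [hp.2.2]⟩⟩
  have rm : MeasurableSet (Ioo 0 ζ ×ˢ Ioo 0 m : Set (ℝ × ℝ)) := measurableSet_Ioo.prod measurableSet_Ioo
  have mx := pdx_meas Tc
  have my := pdy_meas Tc
  -- difference quotient of ξ
  have dq : ∀ ε, 0 < ε → ε ≤ 1 → ∀ p ∈ Ioo 0 ζ ×ˢ Ioo 0 m, ‖(ξ (p.1, p.2 + ε) - ξ p) / ε‖ ≤ B2 := by
    intro ε hε hε1 p hp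
    have := Convex.norm_image_sub_le_of_norm_hasDerivWithin_le (f := fun y => ξ (p.1, y)) (f' := fun y => pdy ξ (p.1, y))
      (s := Icc 0 (m + 1)) (C := B2) (x := p.2) (y := p.2 + ε) (fun y _ => (d2 p.1 y).hasDerivWithinAt)
      (fun y hy => b2 (p.1, y) ⟨⟨hp.1.1.le, hp.1.2.le⟩, hy⟩) (convex_Icc _ _) ⟨hp.2.1.le, by linarith [hp.2.2]⟩
      ⟨by linarith [hp.2.1], by linarith [hp.2.2]⟩
    rw [norm_div, Real.norm_of_nonneg hε.le, div_le_iff₀ hε]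
    simpa [abs_of_pos hε] using this
  have dT : ∀ ε, 0 < ε → ∀ p : ℝ × ℝ, ‖(T p - T (p.1, p.2 - ε)) / ε‖ ≤ K := by
    intro ε hε p
    rw [norm_div, Real.norm_of_nonneg hε.le, div_le_iff₀ hε]
    have := (lip_y h p.1).norm_sub_le p.2 (p.2 - ε)
    simpa [abs_of_pos hε] using this
  have lim1 : Tendsto (fun ε : ℝ => ∫ p in Ioo 0 ζ ×ˢ Ioo 0 m, pdx T p * ((ξ (p.1, p.2 + ε) - ξ p) / ε)) (𝓝[>] 0)
      (𝓝 (∫ p in Ioo 0 ζ ×ˢ Ioo 0 m, pdx T p * pdy ξ p)) := by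
    refine tendsto_integral_filter_of_dominated_convergence (fun _ => K * B2) ?_ ?_ ?_ ?_
    · refine Eventually.of_forall fun ε => (mx.mul ?_).aestronglyMeasurable
      have := hξ.continuous
      have : Continuous fun p : ℝ × ℝ => (ξ (p.1, p.2 + ε) - ξ p) / ε := by fun_prop
      exact this.measurable
    · filter_upwards [Ioc_mem_nhdsGT (zero_lt_one' ℝ)] with ε hε
      rw [ae_restrict_iff' rm]
      refine Eventually.of_forall fun p hp => ?_
      rw [norm_mul]
      exact mul_le_mul (pdx_bd h p) (dq ε hε.1 hε.2 p hp) (norm_nonneg _) hK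
    · exact rect_int (B := K * B2) measurable_const (fun p _ => by rw [Real.norm_of_nonneg (by positivity)])
    · refine Eventually.of_forall fun p => ?_
      refine Tendsto.const_mul _ ?_
      have := (d2 p.1 p.2).tendsto_slope_zero_right
      simpa [div_eq_inv_mul] using this
  have lim2 : Tendsto (fun ε : ℝ => ∫ p in Ioo 0 ζ ×ˢ Ioo 0 m, (T p - T (p.1, p.2 - ε)) / ε * pdx ξ p) (𝓝[>] 0)
      (𝓝 (∫ p in Ioo 0 ζ ×ˢ Ioo 0 m, pdy T p * pdx ξ p)) := by
    refine tendsto_integral_filter_of_dominated_convergence (fun _ => K * B1) ?_ ?_ ?_ ?_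
    · refine Eventually.of_forall fun ε => ?_
      have : Continuous fun p : ℝ × ℝ => (T p - T (p.1, p.2 - ε)) / ε * pdx ξ p := by fun_prop
      exact this.measurable.aestronglyMeasurable
    · filter_upwards [self_mem_nhdsWithin] with ε hε
      rw [ae_restrict_iff' rm]
      refine Eventually.of_forall fun p hp => ?_
      rw [norm_mul]
      exact mul_le_mul (dT ε hε p) (b1 p (sub p hp)) (norm_nonneg _) hK
    · exact rect_int (B := K * B1) measurable_const (fun p _ => by rw [Real.norm_of_nonneg (by positivity)])
    · have := h.ae_differentiableAt (μ := (volume : Measure (ℝ × ℝ)))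
      refine ae_restrict_of_ae ?_
      filter_upwards [this] with p hp
      refine Tendsto.mul_const _ ?_
      have hd : HasDerivAt (fun y => T (p.1, y)) (pdy T p) p.2 := by
        have := hp.hasFDerivAt.comp_hasDerivAt p.2 ((hasDerivAt_const p.2 p.1).prodMk (hasDerivAt_id p.2))
        exact this.differentiableAt.hasDerivAt
      have := hd.tendsto_slope_zero
      have nt : Tendsto (fun ε : ℝ => -ε) (𝓝[>] 0) (𝓝[≠] 0) := by
        apply tendsto_nhdsWithin_iff.mpr
        refine ⟨?_, ?_⟩
        · have := (continuous_neg (G := ℝ)).tendsto 0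
          rw [neg_zero] at this
          exact this.mono_left nhdsWithin_le_nhds
        · filter_upwards [self_mem_nhdsWithin] with ε hε
          have : (0:ℝ) < ε := hε
          simp [this.ne']
      have := this.comp nt
      refine this.congr fun ε => ?_
      simp only [Function.comp, smul_eq_mul]
      rw [inv_neg, div_eq_inv_mul, ← sub_eq_add_neg]; ring
  have lim3 : Tendsto (fun ε : ℝ => ∫ x in (0:ℝ)..ζ, ∫ s in (0:ℝ)..1, T (x, m + ε * s - ε) * pdx ξ (x, m + ε * s)) (𝓝[>] 0)
      (𝓝 (∫ x in (0:ℝ)..ζ, T (x, m) * pdx ξ (x, m))) := by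
    have cc : Continuous (fun ε : ℝ => ∫ x in (0:ℝ)..ζ, ∫ s in (0:ℝ)..1, T (x, m + ε * s - ε) * pdx ξ (x, m + ε * s)) := by
      apply intervalIntegral.continuous_parametric_intervalIntegral_of_continuous'
      simp only [Function.uncurry_def]
      apply intervalIntegral.continuous_parametric_intervalIntegral_of_continuous'
        (f := fun (p : ℝ × ℝ) s => T (p.2, m + p.1 * s - p.1) * pdx ξ (p.2, m + p.1 * s))
      simp only [Function.uncurry_def]
      fun_prop
    have := cc.tendsto 0
    simp only [zero_mul, add_zero, sub_zero, intervalIntegral.integral_const, one_smul] at this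
    exact this.mono_left nhdsWithin_le_nhds
  have key : ∀ ε : ℝ, 0 < ε → ε ≤ 1 → ∫ p in Ioo 0 ζ ×ˢ Ioo 0 m, pdx T p * ((ξ (p.1, p.2 + ε) - ξ p) / ε) =
      (∫ p in Ioo 0 ζ ×ˢ Ioo 0 m, (T p - T (p.1, p.2 - ε)) / ε * pdx ξ p) -
      ∫ x in (0:ℝ)..ζ, ∫ s in (0:ℝ)..1, T (x, m + ε * s - ε) * pdx ξ (x, m + ε * s) := by
    intro ε hε hε1
    have cξ : Continuous fun p : ℝ × ℝ => (ξ (p.1, p.2 + ε) - ξ p) / ε := by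
      have := hξ.continuous
      fun_prop
    have i1 : IntegrableOn (fun p => pdx T p * ((ξ (p.1, p.2 + ε) - ξ p) / ε)) (Ioo 0 ζ ×ˢ Ioo 0 m) := by
      refine rect_int (B := K * B2) (mx.mul cξ.measurable) fun p hp => ?_
      rw [norm_mul]
      exact mul_le_mul (pdx_bd h p) (dq ε hε hε1 p hp) (norm_nonneg _) hK
    have ci : ∀ g : ℝ × ℝ → ℝ, Continuous g → IntegrableOn g (Ioo 0 ζ ×ˢ Ioo 0 m) := fun g hg => by
      obtain ⟨B, _, hB⟩ := cont_bd hg ζ (m + 1)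
      exact rect_int hg.measurable fun p hp => hB p (sub p hp)
    have i2 : IntegrableOn (fun p => T p * ((pdx ξ (p.1, p.2 + ε) - pdx ξ p) / ε)) (Ioo 0 ζ ×ˢ Ioo 0 m) :=
      ci _ (by fun_prop)
    have i3 : IntegrableOn (fun p => (T p - T (p.1, p.2 - ε)) / ε * pdx ξ p) (Ioo 0 ζ ×ˢ Ioo 0 m) :=
      ci _ (by fun_prop)
    rw [rect_fub2 hζ hm i1]
    have s1 : ∀ y, ∫ x in (0:ℝ)..ζ, pdx T (x, y) * ((ξ (x, y + ε) - ξ (x, y)) / ε) =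
        - ∫ x in (0:ℝ)..ζ, T (x, y) * ((pdx ξ (x, y + ε) - pdx ξ (x, y)) / ε) := by
      intro y
      refine ibp_x (T := fun x => T (x, y)) (lip_x h y) (T0 y) (g := fun x => (ξ (x, y + ε) - ξ (x, y)) / ε)
        (fun x => ((d1 x (y + ε)).sub (d1 x y)).div_const ε) (by fun_prop) (by simp [ξz])
    simp only [s1]
    rw [intervalIntegral.integral_neg]
    have s2 := (rect_fub2 hζ hm i2).symm.trans (rect_fub1 hζ hm i2)
    simp only at s2
    rw [s2]
    have s3 : ∀ x, ∫ y in (0:ℝ)..m, T (x, y) * ((pdx ξ (x, y + ε) - pdx ξ (x, y)) / ε) =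
        (∫ s in (0:ℝ)..1, T (x, m + ε * s - ε) * pdx ξ (x, m + ε * s)) -
          ∫ y in (0:ℝ)..m, (T (x, y) - T (x, y - ε)) / ε * pdx ξ (x, y) := by
      intro x
      exact shift_psi (T := fun y => T (x, y)) (a := fun y => pdx ξ (x, y)) (by fun_prop) (by fun_prop) hε (Tn x)
    simp only [s3]
    rw [intervalIntegral.integral_sub, rect_fub1 hζ hm i3]
    · ring
    · apply Continuous.intervalIntegrable
      apply intervalIntegral.continuous_parametric_intervalIntegral_of_continuous'
      simp only [Function.uncurry_def]; fun_prop
    · apply Continuous.intervalIntegrable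
      apply intervalIntegral.continuous_parametric_intervalIntegral_of_continuous'
      simp only [Function.uncurry_def]; fun_prop
  have lim4 := (lim2.sub lim3).congr' (by
    filter_upwards [Ioc_mem_nhdsGT (zero_lt_one' ℝ)] with ε hε
    exact (key ε hε.1 hε.2).symm)
  have fin := tendsto_nhds_unique lim1 lim4
  have i4 : IntegrableOn (fun p => pdx T p * pdy ξ p) (Ioo 0 ζ ×ˢ Ioo 0 m) := by
    refine rect_int (B := K * B2) (mx.mul c2.measurable) fun p hp => ?_
    rw [norm_mul]
    exact mul_le_mul (pdx_bd h p) (b2 p (sub p hp)) (norm_nonneg _) hK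
  have i5 : IntegrableOn (fun p => pdy T p * pdx ξ p) (Ioo 0 ζ ×ˢ Ioo 0 m) := by
    refine rect_int (B := K * B1) (my.mul c1.measurable) fun p hp => ?_
    rw [norm_mul]
    exact mul_le_mul (pdy_bd h p) (b1 p (sub p hp)) (norm_nonneg _) hK
  rw [integral_sub i4 i5, fin]
  rw [ibp_x (T := fun x => T (x, m)) (lip_x h m) (T0 m) (g := fun x => ξ (x, m)) (fun x => d1 x m) (by fun_prop) (ξz m)]
  ring
end weak
end

section
open Real Set MeasureTheory Filter Topology

structure Cov (Φ k X : ℝ → ℝ) (l cs M : ℝ) : Prop where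
  hl : 0 < l
  hcs : 0 < cs
  Φ0 : Φ 0 = 0
  dΦ : ∀ x, HasDerivAt Φ (k x) x
  ζ0 : 0 < Φ l
  Xm : ∀ φ ∈ Icc 0 (Φ l), X φ ∈ Icc 0 l ∧ Φ (X φ) = φ
  XΦ : ∀ x ∈ Icc 0 l, X (Φ x) = x
  Xl : ∀ φ ∈ Icc 0 (Φ l), ∀ φ' ∈ Icc 0 (Φ l), |X φ - X φ'| ≤ cs⁻¹ * |φ - φ'|
  Xo : ∀ φ ∈ Ioo 0 (Φ l), X φ ∈ Ioo 0 l
  Xlo : ∀ φ ∈ Icc 0 (Φ l), φ / M ≤ X φ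
  Xhi : ∀ φ ∈ Icc 0 (Φ l), X φ ≤ φ / cs
  dX : ∀ φ ∈ Ioo 0 (Φ l), HasDerivAt X (k (X φ))⁻¹ φ
  Φm : ∀ x ∈ Icc 0 l, Φ x ∈ Icc 0 (Φ l)

theorem cov_mk {Φ k : ℝ → ℝ} {l cs M : ℝ} (hl : 0 < l) (hcs : 0 < cs) (hM : 0 < M) (Φ0 : Φ 0 = 0)
    (dΦ : ∀ x, HasStrictDerivAt Φ (k x) x) (klo : ∀ x, 0 ≤ x → x ≤ l → cs ≤ k x) (khi : ∀ x, 0 ≤ x → x ≤ l → k x ≤ M) :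
    Cov Φ k (Function.invFunOn Φ (Icc 0 l)) l cs M := by
  have up : ∀ a b, 0 ≤ a → a ≤ b → b ≤ l → cs * (b - a) ≤ Φ b - Φ a := by
    intro a b h0 hab h1
    have := int_cmp hab (u := fun x => cs * x) (u' := fun _ => cs) (fun x _ => by simpa using (hasDerivAt_id x).const_mul cs)
      (fun x _ => (dΦ x).hasDerivAt) (fun x hx => klo x (h0.trans hx.1) (hx.2.trans h1))
    linarith
  have dn : ∀ a b, 0 ≤ a → a ≤ b → b ≤ l → Φ b - Φ a ≤ M * (b - a) := by
    intro a b h0 hab h1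
    have := int_cmp hab (v := fun x => M * x) (v' := fun _ => M)
      (fun x _ => (dΦ x).hasDerivAt) (fun x _ => by simpa using (hasDerivAt_id x).const_mul M) (fun x hx => khi x (h0.trans hx.1) (hx.2.trans h1))
    linarith
  have sm : StrictMonoOn Φ (Icc 0 l) := by
    intro a ha b hb hab
    have := up a b ha.1 hab.le hb.2
    have : 0 < cs * (b - a) := mul_pos hcs (by linarith)
    linarith
  have ζ0 : 0 < Φ l := by
    have := sm ⟨le_rfl, hl.le⟩ ⟨hl.le, le_rfl⟩ hl
    rwa [Φ0] at this
  have sj : ∀ φ ∈ Icc 0 (Φ l), ∃ x ∈ Icc 0 l, Φ x = φ := by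
    intro φ hφ
    have := intermediate_value_Icc hl.le (f := Φ) (fun x _ => (dΦ x).hasDerivAt.continuousAt.continuousWithinAt)
    rw [Φ0] at this
    obtain ⟨w, a, b⟩ := this hφ
    exact ⟨w, a, b⟩
  have XΦ : ∀ x ∈ Icc 0 l, Function.invFunOn Φ (Icc 0 l) (Φ x) = x := fun x hx => invFunOn_eq' sm.injOn hx
  have Xm : ∀ φ ∈ Icc 0 (Φ l), Function.invFunOn Φ (Icc 0 l) φ ∈ Icc 0 l ∧ Φ (Function.invFunOn Φ (Icc 0 l) φ) = φ := by
    intro φ hφ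
    obtain ⟨x, hx, rfl⟩ := sj φ hφ
    rw [XΦ x hx]; exact ⟨hx, rfl⟩
  have Xo : ∀ φ ∈ Ioo 0 (Φ l), Function.invFunOn Φ (Icc 0 l) φ ∈ Ioo 0 l := by
    intro φ hφ
    obtain ⟨h1, h2⟩ := Xm φ ⟨hφ.1.le, hφ.2.le⟩
    constructor
    · refine lt_of_le_of_ne h1.1 fun h => ?_
      rw [← h, Φ0] at h2; linarith [hφ.1]
    · refine lt_of_le_of_ne h1.2 fun h => ?_
      rw [h] at h2; linarith [hφ.2]
  refine ⟨hl, hcs, Φ0, fun x => (dΦ x).hasDerivAt, ζ0, Xm, XΦ, ?_, Xo, ?_, ?_, ?_, ?_⟩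
  · intro φ hφ φ' hφ'
    obtain ⟨x, hx, rfl⟩ := sj φ hφ
    obtain ⟨x', hx', rfl⟩ := sj φ' hφ'
    rw [XΦ x hx, XΦ x' hx', inv_mul_eq_div, le_div_iff₀ hcs]
    rcases le_total x x' with h | h
    · have := up x x' hx.1 h hx'.2
      rw [abs_sub_comm, abs_of_nonneg (by linarith), abs_sub_comm]
      exact le_trans (by linarith) (le_abs_self _)
    · have := up x' x hx'.1 h hx.2
      rw [abs_of_nonneg (by linarith)]
      exact le_trans (by linarith) (le_abs_self _)
  · intro φ hφ
    obtain ⟨x, hx, rfl⟩ := sj φ hφ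
    rw [XΦ x hx, div_le_iff₀ hM]
    have := dn 0 x le_rfl hx.1 hx.2
    rw [Φ0] at this; linarith
  · intro φ hφ
    obtain ⟨x, hx, rfl⟩ := sj φ hφ
    rw [XΦ x hx, le_div_iff₀ hcs]
    have := up 0 x le_rfl hx.1 hx.2
    rw [Φ0] at this; linarith
  · intro φ hφ
    have ho := Xo φ hφ
    obtain ⟨x, hx, rfl⟩ := sj φ ⟨hφ.1.le, hφ.2.le⟩
    rw [XΦ x hx] at ho ⊢
    exact invFunOn_deriv sm.injOn (Icc_mem_nhds ho.1 ho.2) (dΦ x) (by linarith [klo x ho.1.le ho.2.le] : (0:ℝ) < k x).ne'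
  · intro x hx
    refine ⟨?_, sm.monotoneOn hx ⟨hl.le, le_rfl⟩ hx.2⟩
    have := sm.monotoneOn ⟨le_rfl, hl.le⟩ hx hx.1
    rwa [Φ0] at this
end

section
open Real Set MeasureTheory Filter Topology

noncomputable section

def cl (a x : ℝ) : ℝ := max 0 (min a x)

lemma cl_mem {a : ℝ} (ha : 0 ≤ a) (x : ℝ) : cl a x ∈ Icc 0 a :=
  ⟨le_max_left _ _, max_le ha (min_le_left _ _)⟩

lemma cl_eq {a x : ℝ} (h : x ∈ Icc 0 a) : cl a x = x := by
  unfold cl; rw [min_eq_right h.2, max_eq_right h.1]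

lemma cl_neg {a x : ℝ} (ha : 0 ≤ a) (h : x ≤ 0) : cl a x = 0 := by
  unfold cl; rw [min_eq_right (h.trans ha), max_eq_left h]

lemma cl_lip (a x y : ℝ) : |cl a x - cl a y| ≤ |x - y| := by
  unfold cl
  refine (abs_max_sub_max_le_max 0 _ 0 _).trans ?_
  refine max_le (by simp) ?_
  refine (abs_min_sub_min_le_max a _ a _).trans ?_
  exact max_le (by simp) le_rfl

/-- angle and Riemann variable in the potential plane -/
def Tf (R : ℝ → ℝ → ℝ) (X : ℝ → ℝ) (ζ m : ℝ) (p : ℝ × ℝ) : ℝ :=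
  (R (X (cl ζ p.1)) (cl m p.2) - R (X (cl ζ p.1)) (-cl m p.2)) / 2

def Yf (R : ℝ → ℝ → ℝ) (X : ℝ → ℝ) (ζ m : ℝ) (p : ℝ × ℝ) : ℝ :=
  YR R (X (cl ζ p.1)) (cl m p.2)

lemma fd_eps {R : ℝ → ℝ → ℝ} {x0 ψ0 : ℝ} {D : ℝ × ℝ →L[ℝ] ℝ} (h : HasFDerivAt (fun p : ℝ × ℝ => R p.1 p.2) D (x0, ψ0)) :
    ∀ δ > 0, ∃ r > 0, ∀ x ψ, |x - x0| ≤ r → |ψ - ψ0| ≤ r →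
      |R x ψ - R x0 ψ0 - D (1, 0) * (x - x0) - D (0, 1) * (ψ - ψ0)| ≤ δ * max |x - x0| |ψ - ψ0| := by
  intro δ hδ
  have h1 := (hasFDerivAt_iff_isLittleO.1 h).bound hδ
  rw [Metric.eventually_nhds_iff] at h1
  obtain ⟨r, hr, h2⟩ := h1
  refine ⟨r / 2, by positivity, fun x ψ hx hψ => ?_⟩
  have d : dist (x, ψ) (x0, ψ0) < r := by
    rw [Prod.dist_eq, Real.dist_eq, Real.dist_eq]
    exact max_lt (by simp only []; linarith) (by simp only []; linarith)
  have h3 := h2 d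
  have e : D ((x, ψ) - (x0, ψ0)) = D (1, 0) * (x - x0) + D (0, 1) * (ψ - ψ0) := by
    have : ((x, ψ) - (x0, ψ0) : ℝ × ℝ) = (x - x0) • ((1 : ℝ), (0 : ℝ)) + (ψ - ψ0) • ((0 : ℝ), (1 : ℝ)) := by
      ext <;> simp
    rw [this, map_add, map_smul, map_smul]; simp only [smul_eq_mul]; ring
  rw [e, Prod.norm_def] at h3
  simp only [Real.norm_eq_abs, Prod.fst_sub, Prod.snd_sub] at h3
  rw [sub_add_eq_sub_sub] at h3
  exact h3

lemma pd_of_fd {T : ℝ × ℝ → ℝ} {D : ℝ × ℝ →L[ℝ] ℝ} {p : ℝ × ℝ} (h : HasFDerivAt T D p) :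
    HasDerivAt (fun x => T (x, p.2)) (D (1, 0)) p.1 ∧ HasDerivAt (fun y => T (p.1, y)) (D (0, 1)) p.2 := by
  constructor
  · have := HasFDerivAt.comp_hasDerivAt p.1 (f := fun x => (x, p.2)) (l := T) (l' := D) (by simpa using h) ((hasDerivAt_id p.1).prodMk (hasDerivAt_const p.1 p.2))
    exact this
  · have := HasFDerivAt.comp_hasDerivAt p.2 (f := fun y => (p.1, y)) (l := T) (l' := D) (by simpa using h) ((hasDerivAt_const p.2 p.1).prodMk (hasDerivAt_id p.2))
    exact this

section lim
variable {S : SC} {l : ℝ} {Θ F C : ℝ → ℝ} {P : ℝ → ℝ → ℝ} {R : ℝ → ℝ → ℝ} {Φ k X : ℝ → ℝ} {cs M : ℝ}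

lemma Tf_lip (L : LimR S l Θ C P R) (V : Cov Φ k X l cs M) :
    LipschitzWith (Real.toNNReal (S.K1 * cs⁻¹ + S.v2)) (Tf R X (Φ l) S.m) ∧
    LipschitzWith (Real.toNNReal (S.K1 * cs⁻¹ + S.v2)) (Yf R X (Φ l) S.m) := by
  have hm := S.hm; have hK := S.K1_pos; have hv := S.v2_pos; have hcs := V.hcs
  have pos : 0 ≤ S.K1 * cs⁻¹ + S.v2 := by positivity
  have key : ∀ p p' : ℝ × ℝ, S.K1 * |X (cl (Φ l) p.1) - X (cl (Φ l) p'.1)| + S.v2 * |cl S.m p.2 - cl S.m p'.2|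
      ≤ (S.K1 * cs⁻¹ + S.v2) * dist p p' := by
    intro p p'
    have a := V.Xl _ (cl_mem V.ζ0.le p.1) _ (cl_mem V.ζ0.le p'.1)
    have b := cl_lip (Φ l) p.1 p'.1
    have c := cl_lip S.m p.2 p'.2
    have d1 : |p.1 - p'.1| ≤ dist p p' := le_max_left _ _
    have d2 : |p.2 - p'.2| ≤ dist p p' := le_max_right _ _
    calc _ ≤ S.K1 * (cs⁻¹ * dist p p') + S.v2 * dist p p' := by
          gcongr
          · exact a.trans (by gcongr; exact b.trans d1)
          · exact c.trans d2
      _ = _ := by ring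
  have e1 : ∀ p p' : ℝ × ℝ, |R (X (cl (Φ l) p.1)) (cl S.m p.2) - R (X (cl (Φ l) p'.1)) (cl S.m p'.2)| ≤ (S.K1 * cs⁻¹ + S.v2) * dist p p' := by
    intro p p'
    refine le_trans ?_ (key p p')
    have x1 := (V.Xm _ (cl_mem V.ζ0.le p.1)).1
    have x2 := (V.Xm _ (cl_mem V.ζ0.le p'.1)).1
    have s1 := cl_mem hm.le p.2
    have s2 := cl_mem hm.le p'.2
    exact L.lip _ _ _ _ x2.1 x2.2 x1.1 x1.2 (by linarith [s2.1]) s2.2 (by linarith [s1.1]) s1.2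
  have e2 : ∀ p p' : ℝ × ℝ, |R (X (cl (Φ l) p.1)) (-cl S.m p.2) - R (X (cl (Φ l) p'.1)) (-cl S.m p'.2)| ≤ (S.K1 * cs⁻¹ + S.v2) * dist p p' := by
    intro p p'
    refine le_trans ?_ (key p p')
    have x1 := (V.Xm _ (cl_mem V.ζ0.le p.1)).1
    have x2 := (V.Xm _ (cl_mem V.ζ0.le p'.1)).1
    have s1 := cl_mem hm.le p.2
    have s2 := cl_mem hm.le p'.2
    have := L.lip _ _ (-cl S.m p'.2) (-cl S.m p.2) x2.1 x2.2 x1.1 x1.2 (by linarith [s2.2]) (by linarith [s2.1]) (by linarith [s1.2]) (by linarith [s1.1])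
    refine this.trans (le_of_eq ?_)
    rw [neg_sub_neg, abs_sub_comm (cl S.m p'.2)]
  constructor
  · refine LipschitzWith.of_dist_le_mul fun p p' => ?_
    rw [Real.coe_toNNReal _ pos, Real.dist_eq]
    have a := abs_le.1 (e1 p p'); have b := abs_le.1 (e2 p p')
    unfold Tf
    rw [abs_le]; constructor <;> linarith [a.1, a.2, b.1, b.2]
  · refine LipschitzWith.of_dist_le_mul fun p p' => ?_
    rw [Real.coe_toNNReal _ pos, Real.dist_eq]
    have a := abs_le.1 (e1 p p'); have b := abs_le.1 (e2 p p')
    unfold Yf YR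
    rw [abs_le]; constructor <;> linarith [a.1, a.2, b.1, b.2]

lemma pde_pt (L : LimR S l Θ C P R) (V : Cov Φ k X l cs M)
    (hk : ∀ x, 0 < x → x < l → P x (YR R x S.m) = k x ∧ 0 < k x) {p : ℝ × ℝ}
    (h1 : p.1 ∈ Ioo 0 (Φ l)) (h2 : p.2 ∈ Ioo 0 S.m)
    {DT DY : ℝ × ℝ →L[ℝ] ℝ} (hT : HasFDerivAt (Tf R X (Φ l) S.m) DT p) (hY : HasFDerivAt (Yf R X (Φ l) S.m) DY p) :
    DY (1, 0) = C (Yf R X (Φ l) S.m p) * DT (0, 1) ∧ DT (1, 0) = C (Yf R X (Φ l) S.m p) * DY (0, 1) := by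
  obtain ⟨φ0, ψ0⟩ := p
  simp only at h1 h2
  have x0 := V.Xo φ0 h1
  have Xφ := (V.Xm φ0 ⟨h1.1.le, h1.2.le⟩).2
  set x := X φ0 with hx
  obtain ⟨k1, k2⟩ := hk x x0.1 x0.2
  have eY : Yf R X (Φ l) S.m (φ0, ψ0) = YR R x ψ0 := by
    simp only [Yf, cl_eq ⟨h1.1.le, h1.2.le⟩, cl_eq (⟨h2.1.le, h2.2.le⟩ : ψ0 ∈ Icc 0 S.m), ← hx]
  have eY' : YR R x (-ψ0) = YR R x ψ0 := by unfold YR; rw [neg_neg]; ring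
  have m1 : HasFDerivAt (𝕜 := ℝ) (fun p : ℝ × ℝ => (Φ p.1, p.2))
      (((k x) • ContinuousLinearMap.fst ℝ ℝ ℝ).prod (ContinuousLinearMap.snd ℝ ℝ ℝ)) (x, ψ0) := by
    refine HasFDerivAt.prodMk ?_ hasFDerivAt_snd
    exact (V.dΦ x).comp_hasFDerivAt (x, ψ0) hasFDerivAt_fst
  have m2 : HasFDerivAt (𝕜 := ℝ) (fun p : ℝ × ℝ => (Φ p.1, -p.2))
      (((k x) • ContinuousLinearMap.fst ℝ ℝ ℝ).prod (-ContinuousLinearMap.snd ℝ ℝ ℝ)) (x, -ψ0) := by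
    refine HasFDerivAt.prodMk ?_ (hasFDerivAt_snd (𝕜 := ℝ)).neg
    exact (V.dΦ x).comp_hasFDerivAt (x, -ψ0) hasFDerivAt_fst
  have f1 := HasFDerivAt.comp (x, ψ0) (g := fun p => Tf R X (Φ l) S.m p - Yf R X (Φ l) S.m p) (g' := DT - DY) (by simp only [Xφ]; exact hT.sub hY) m1
  have f2 := HasFDerivAt.comp (x, -ψ0) (g := fun p => -Tf R X (Φ l) S.m p - Yf R X (Φ l) S.m p) (g' := -DT - DY) (by simp only [Xφ, neg_neg]; exact hT.neg.sub hY) m2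
  have g1 := f1.congr_of_eventuallyEq (f₁ := fun p : ℝ × ℝ => R p.1 p.2) <| by
    filter_upwards [prod_mem_nhds (Ioo_mem_nhds x0.1 x0.2) (Ioo_mem_nhds h2.1 h2.2)] with p hp
    have b1 := V.Φm p.1 ⟨hp.1.1.le, hp.1.2.le⟩
    simp only [Function.comp, Tf, Yf, YR, cl_eq b1, V.XΦ p.1 ⟨hp.1.1.le, hp.1.2.le⟩, cl_eq (⟨hp.2.1.le, hp.2.2.le⟩ : p.2 ∈ Icc 0 S.m)]
    ring
  have g2 := f2.congr_of_eventuallyEq (f₁ := fun p : ℝ × ℝ => R p.1 p.2) <| by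
    filter_upwards [prod_mem_nhds (Ioo_mem_nhds x0.1 x0.2) (Ioo_mem_nhds (neg_lt_neg h2.2) (neg_lt_neg h2.1))] with p hp
    have b1 := V.Φm p.1 ⟨hp.1.1.le, hp.1.2.le⟩
    have b2 : -p.2 ∈ Icc 0 S.m := ⟨by linarith [hp.2.2], by linarith [hp.2.1]⟩
    simp only [Function.comp, Tf, Yf, YR, cl_eq b1, V.XΦ p.1 ⟨hp.1.1.le, hp.1.2.le⟩, cl_eq b2, neg_neg]
    ring
  have q1 := L.pde x ψ0 _ _ x0.1 x0.2 (by linarith [h2.1, S.hm]) h2.2 (fd_eps g1)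
  have q2 := L.pde x (-ψ0) _ _ x0.1 x0.2 (by linarith [h2.2]) (by linarith [h2.1, S.hm]) (fd_eps g2)
  have v1 : DT (k x, 0) = k x * DT (1, 0) := by
    rw [show ((k x, 0) : ℝ × ℝ) = k x • ((1 : ℝ), (0 : ℝ)) by simp, map_smul, smul_eq_mul]
  have v2 : DY (k x, 0) = k x * DY (1, 0) := by
    rw [show ((k x, 0) : ℝ × ℝ) = k x • ((1 : ℝ), (0 : ℝ)) by simp, map_smul, smul_eq_mul]
  have v3 : DT (0, -1) = - DT (0, 1) := by
    rw [show ((0, -1) : ℝ × ℝ) = - ((0 : ℝ), (1 : ℝ)) by simp, map_neg]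
  have v4 : DY (0, -1) = - DY (0, 1) := by
    rw [show ((0, -1) : ℝ × ℝ) = - ((0 : ℝ), (1 : ℝ)) by simp, map_neg]
  rw [eY', k1] at q2
  rw [k1] at q1
  rw [eY]
  simp at q1 q2
  simp only [v1, v2, v3, v4] at q1 q2
  generalize DT (1, 0) = a at *
  generalize DT (0, 1) = b at *
  generalize DY (1, 0) = c at *
  generalize DY (0, 1) = d at *
  generalize C (YR R x ψ0) = e at *
  have r1 : k x * (c - e * b) = 0 := by linarith
  have r2 : k x * (a - e * d) = 0 := by linarith
  have r3 := (mul_eq_zero.1 r1).resolve_left k2.ne'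
  have r4 := (mul_eq_zero.1 r2).resolve_left k2.ne'
  constructor <;> linarith

end lim
end
end

section
open Real Set MeasureTheory Filter Topology

noncomputable section

lemma der_ge {g : ℝ → ℝ} {d c x : ℝ} (h : HasDerivAt g d x) (h1 : ∀ᶠ s in 𝓝[>] x, c * (s - x) ≤ g s - g x) : c ≤ d := by
  have t := (hasDerivWithinAt_iff_tendsto_slope' (self_notMem_Ioi)).1 h.hasDerivWithinAt
  refine ge_of_tendsto t ?_
  filter_upwards [h1, self_mem_nhdsWithin] with s a b
  have : 0 < s - x := sub_pos.2 b
  rw [slope_def_field, le_div_iff₀ this]; exact a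

lemma der_le {g : ℝ → ℝ} {d c x : ℝ} (h : HasDerivAt g d x) (h1 : ∀ᶠ s in 𝓝[>] x, g s - g x ≤ c * (s - x)) : d ≤ c := by
  have := der_ge h.neg (c := -c) (h1.mono fun s a => by simp only [Pi.neg_apply]; linarith)
  linarith

lemma y_inc {γ Y0 ca cb L Lq ya yb : ℝ} {q C y : ℝ → ℝ} (G : GasD γ Y0 ca cb L Lq ya yb q C y) {a b : ℝ}
    (h0 : 0 ≤ a) (h1 : a ≤ b) (h2 : b ≤ Y0) : y a ≤ y b ∧ y b - y a ≤ (C Y0)⁻¹ * (b - a) := by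
  rcases h1.eq_or_lt with rfl | h
  · simp
  obtain ⟨c, hc, e⟩ := exists_hasDerivAt_eq_slope y (fun Y => 1 / C Y) h (G.yc.mono (Icc_subset_Icc h0 h2))
    (fun x hx => G.yd x (h0.trans_lt hx.1) (hx.2.le.trans h2))
  have c0 := h0.trans_lt hc.1
  have c1 := hc.2.le.trans h2
  have p := G.Cpos c c0 c1
  have p0 := G.Cpos Y0 G.hY0 le_rfl
  have an := G.anti c Y0 c0 c1 le_rfl
  have hba : 0 < b - a := by linarith
  have e' : y b - y a = 1 / C c * (b - a) := by rw [e]; field_simp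
  constructor
  · have : 0 < 1 / C c * (b - a) := by positivity
    linarith
  · rw [e']
    gcongr
    rw [one_div]
    exact inv_anti₀ p0 an

lemma y_lip {γ Y0 ca cb L Lq ya yb : ℝ} {q C y : ℝ → ℝ} (G : GasD γ Y0 ca cb L Lq ya yb q C y) {a b : ℝ}
    (h0 : 0 ≤ a) (h1 : a ≤ Y0) (h2 : 0 ≤ b) (h3 : b ≤ Y0) : |y b - y a| ≤ (C Y0)⁻¹ * |b - a| := by
  rcases le_total a b with h | h
  · obtain ⟨u, v⟩ := y_inc G h0 h h3
    rwa [abs_of_nonneg (by linarith), abs_of_nonneg (by linarith)]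
  · obtain ⟨u, v⟩ := y_inc G h2 h h1
    rw [abs_sub_comm, abs_sub_comm b]
    rwa [abs_of_nonneg (by linarith), abs_of_nonneg (by linarith)]

section lim
variable {S : SC} {l : ℝ} {Θ F C : ℝ → ℝ} {P : ℝ → ℝ → ℝ} {R : ℝ → ℝ → ℝ} {Φ k X : ℝ → ℝ} {cs M : ℝ}
variable {γ ca cb Lc Lq ya yb : ℝ} {q y : ℝ → ℝ}

lemma YR_range (W : Wall S l Θ F C P) (L : LimR S l Θ C P R) {x ψ : ℝ} (h0 : 0 ≤ x) (h1 : x ≤ l) (h2 : -S.m ≤ ψ) (h3 : ψ ≤ S.m) :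
    0 ≤ YR R x ψ ∧ YR R x ψ ≤ S.Y0 := by
  obtain ⟨a, b⟩ := L.Ybd x ψ h0 h1 h2 h3
  have ha := S.ha; have hb := S.hb; have hμ := S.hμ
  have : 0 ≤ x ^ S.μ := Real.rpow_nonneg h0 _
  refine ⟨le_trans (by positivity) a, b.trans ?_⟩
  have : x ^ S.μ ≤ l ^ S.μ := Real.rpow_le_rpow h0 h1 (by linarith)
  refine le_trans ?_ (W.small l W.hl le_rfl).hY
  gcongr

lemma Yf_range (W : Wall S l Θ F C P) (L : LimR S l Θ C P R) (V : Cov Φ k X l cs M) (p : ℝ × ℝ) :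
    0 ≤ Yf R X (Φ l) S.m p ∧ Yf R X (Φ l) S.m p ≤ S.Y0 := by
  have hm := S.hm
  have x1 := (V.Xm _ (cl_mem V.ζ0.le p.1)).1
  have s1 := cl_mem hm.le p.2
  exact YR_range W L x1.1 x1.2 (by linarith [s1.1]) s1.2

lemma T_slope (L : LimR S l Θ C P R) (V : Cov Φ k X l cs M) {p : ℝ × ℝ}
    (h1 : p.1 ∈ Ioo 0 (Φ l)) (h2 : p.2 ∈ Ioo 0 S.m) {d : ℝ}
    (h : HasDerivAt (fun s => Tf R X (Φ l) S.m (p.1, s)) d p.2) :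
    S.v1 * ((X p.1 ^ S.μ) ^ 4 / X p.1) ≤ d ∧ d ≤ S.v2 * ((X p.1 ^ S.μ) ^ 4 / X p.1) := by
  have x0 := V.Xo _ h1
  have ev : ∀ᶠ s in 𝓝[>] p.2, s ∈ Ioo p.2 S.m := Ioo_mem_nhdsGT h2.2
  have key : ∀ s ∈ Ioo p.2 S.m, Tf R X (Φ l) S.m (p.1, s) - Tf R X (Φ l) S.m (p.1, p.2) =
      ((R (X p.1) s - R (X p.1) p.2) + (R (X p.1) (-p.2) - R (X p.1) (-s))) / 2 := by
    intro s hs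
    simp only [Tf, cl_eq (⟨h1.1.le, h1.2.le⟩ : p.1 ∈ Icc 0 (Φ l)), cl_eq (⟨h2.1.le, h2.2.le⟩ : p.2 ∈ Icc 0 S.m),
      cl_eq (⟨(h2.1.trans hs.1).le, hs.2.le⟩ : s ∈ Icc 0 S.m)]
    ring
  constructor
  · refine der_ge h (ev.mono fun s hs => ?_)
    rw [key s hs]
    have a := (L.slope (X p.1) p.2 s x0.1 x0.2.le (by linarith [h2.1, h2.2]) hs.1.le hs.2.le).1
    have b := (L.slope (X p.1) (-s) (-p.2) x0.1 x0.2.le (by linarith [hs.2]) (by linarith [hs.1]) (by linarith [h2.1, h2.2])).1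
    linarith
  · refine der_le h (ev.mono fun s hs => ?_)
    rw [key s hs]
    have a := (L.slope (X p.1) p.2 s x0.1 x0.2.le (by linarith [h2.1, h2.2]) hs.1.le hs.2.le).2
    have b := (L.slope (X p.1) (-s) (-p.2) x0.1 x0.2.le (by linarith [hs.2]) (by linarith [hs.1]) (by linarith [h2.1, h2.2])).2
    linarith

lemma Y_slope (L : LimR S l Θ C P R) (V : Cov Φ k X l cs M) {p : ℝ × ℝ}
    (h1 : p.1 ∈ Ioo 0 (Φ l)) (h2 : p.2 ∈ Ioo 0 S.m) {d : ℝ}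
    (h : HasDerivAt (fun s => Yf R X (Φ l) S.m (p.1, s)) d p.2) :
    |d| ≤ S.Gc * ((X p.1 ^ S.μ) ^ 5 / X p.1 ^ 2) := by
  have x0 := V.Xo _ h1
  have ev : ∀ᶠ s in 𝓝[>] p.2, s ∈ Ioo p.2 S.m := Ioo_mem_nhdsGT h2.2
  have key : ∀ s ∈ Ioo p.2 S.m, |Yf R X (Φ l) S.m (p.1, s) - Yf R X (Φ l) S.m (p.1, p.2)| ≤
      (s - p.2) * (S.Gc * ((X p.1 ^ S.μ) ^ 5 / X p.1 ^ 2)) := by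
    intro s hs
    simp only [Yf, cl_eq (⟨h1.1.le, h1.2.le⟩ : p.1 ∈ Icc 0 (Φ l)), cl_eq (⟨h2.1.le, h2.2.le⟩ : p.2 ∈ Icc 0 S.m),
      cl_eq (⟨(h2.1.trans hs.1).le, hs.2.le⟩ : s ∈ Icc 0 S.m)]
    exact L.Yslope (X p.1) p.2 s x0.1 x0.2.le (by linarith [h2.1, h2.2]) hs.1.le hs.2.le
  rw [abs_le]
  constructor
  · refine der_ge h (ev.mono fun s hs => ?_)
    have := (abs_le.1 (key s hs)).1
    linarith
  · refine der_le h (ev.mono fun s hs => ?_)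
    have := (abs_le.1 (key s hs)).2
    linarith

lemma ae_pt (G : GasD γ S.Y0 ca cb Lc Lq ya yb q C y) (W : Wall S l Θ F C P) (L : LimR S l Θ C P R) (V : Cov Φ k X l cs M)
    (hk : ∀ x, 0 < x → x < l → P x (YR R x S.m) = k x ∧ 0 < k x) {p : ℝ × ℝ}
    (h1 : p.1 ∈ Ioo 0 (Φ l)) (h2 : p.2 ∈ Ioo 0 S.m)
    (hT : DifferentiableAt ℝ (Tf R X (Φ l) S.m) p) (hY : DifferentiableAt ℝ (Yf R X (Φ l) S.m) p) :
    pdx (fun p => -y (Yf R X (Φ l) S.m p)) p = - pdy (Tf R X (Φ l) S.m) p ∧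
    bfun γ (-y (Yf R X (Φ l) S.m p)) * pdy (fun p => -y (Yf R X (Φ l) S.m p)) p = - pdx (Tf R X (Φ l) S.m) p ∧
    (S.v1 * ((X p.1 ^ S.μ) ^ 4 / X p.1) ≤ pdy (Tf R X (Φ l) S.m) p ∧ pdy (Tf R X (Φ l) S.m) p ≤ S.v2 * ((X p.1 ^ S.μ) ^ 4 / X p.1)) ∧
    |pdy (fun p => -y (Yf R X (Φ l) S.m p)) p| ≤ S.Gc / S.c1 * ((X p.1 ^ S.μ) ^ 6 / X p.1 ^ 2) := by
  obtain ⟨t1, t2⟩ := pd_of_fd hT.hasFDerivAt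
  obtain ⟨y1, y2⟩ := pd_of_fd hY.hasFDerivAt
  obtain ⟨r1, r2⟩ := pde_pt L V hk h1 h2 hT.hasFDerivAt hY.hasFDerivAt
  have x0 := V.Xo _ h1
  have eY : Yf R X (Φ l) S.m p = YR R (X p.1) p.2 := by
    simp only [Yf, cl_eq (⟨h1.1.le, h1.2.le⟩ : p.1 ∈ Icc 0 (Φ l)), cl_eq (⟨h2.1.le, h2.2.le⟩ : p.2 ∈ Icc 0 S.m)]
  have bd := L.Ybd (X p.1) p.2 x0.1.le x0.2.le (by linarith [h2.1, S.hm]) h2.2.le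
  have yl := LimR.Ylt W x0.1 x0.2 bd.1 bd.2
  have sm := W.small _ x0.1 x0.2.le
  have clo := C_lo W.G sm bd.1 bd.2
  rw [← eY] at yl clo
  have sl := T_slope L V h1 h2 t2
  have ys := Y_slope L V h1 h2 y2
  have bc := G.bC _ yl.1 yl.2.le
  have cp := G.Cpos _ yl.1 yl.2.le
  have yd := G.yd _ yl.1 yl.2.le
  have ex : pdx (fun p => -y (Yf R X (Φ l) S.m p)) p = -(1 / C (Yf R X (Φ l) S.m p) * fderiv ℝ (Yf R X (Φ l) S.m) p (1, 0)) := by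
    exact (HasDerivAt.comp p.1 (h₂ := y) yd y1).neg.deriv
  have ey : pdy (fun p => -y (Yf R X (Φ l) S.m p)) p = -(1 / C (Yf R X (Φ l) S.m p) * fderiv ℝ (Yf R X (Φ l) S.m) p (0, 1)) := by
    exact (HasDerivAt.comp p.2 (h₂ := y) yd y2).neg.deriv
  have fx : pdx (Tf R X (Φ l) S.m) p = fderiv ℝ (Tf R X (Φ l) S.m) p (1, 0) := t1.deriv
  have fy : pdy (Tf R X (Φ l) S.m) p = fderiv ℝ (Tf R X (Φ l) S.m) p (0, 1) := t2.deriv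
  have hX := sm.hX
  have c1 := S.c1_pos
  rw [ex, ey, fx, fy, bc, r1, r2]
  refine ⟨by field_simp, by field_simp, sl, ?_⟩
  rw [abs_neg, abs_mul, abs_of_pos (by positivity)]
  have u : 1 / C (Yf R X (Φ l) S.m p) ≤ X p.1 ^ S.μ / S.c1 := by
    rw [div_le_div_iff₀ cp c1]
    rw [div_le_iff₀ hX] at clo
    linarith
  calc _ ≤ X p.1 ^ S.μ / S.c1 * (S.Gc * ((X p.1 ^ S.μ) ^ 5 / X p.1 ^ 2)) := by gcongr
    _ = _ := by ring

lemma Q_bd (G : GasD γ S.Y0 ca cb Lc Lq ya yb q C y) (W : Wall S l Θ F C P) (L : LimR S l Θ C P R) (V : Cov Φ k X l cs M)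
    {p : ℝ × ℝ} (h1 : p.1 ∈ Ioo 0 (Φ l)) (h2 : p.2 ∈ Ioo 0 S.m) :
    ya * S.a ^ 4 * (X p.1 ^ S.μ) ^ 4 ≤ y (Yf R X (Φ l) S.m p) ∧ y (Yf R X (Φ l) S.m p) ≤ yb * S.b ^ 4 * (X p.1 ^ S.μ) ^ 4 := by
  have x0 := V.Xo _ h1
  have eY : Yf R X (Φ l) S.m p = YR R (X p.1) p.2 := by
    simp only [Yf, cl_eq (⟨h1.1.le, h1.2.le⟩ : p.1 ∈ Icc 0 (Φ l)), cl_eq (⟨h2.1.le, h2.2.le⟩ : p.2 ∈ Icc 0 S.m)]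
  have bd := L.Ybd (X p.1) p.2 x0.1.le x0.2.le (by linarith [h2.1, S.hm]) h2.2.le
  have yl := LimR.Ylt W x0.1 x0.2 bd.1 bd.2
  have sm := W.small _ x0.1 x0.2.le
  have hX := sm.hX; have ha := S.ha; have hb := S.hb
  rw [eY]
  have a1 := G.ylo (S.a * X p.1 ^ S.μ) (by positivity) (bd.1.trans yl.2.le)
  have a2 := G.yhi (S.b * X p.1 ^ S.μ) (by positivity) sm.hY
  have b1 := (y_inc G (by positivity) bd.1 yl.2.le).1
  have b2 := (y_inc G yl.1.le bd.2 sm.hY).1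
  constructor
  · calc _ = ya * (S.a * X p.1 ^ S.μ) ^ 4 := by ring
      _ ≤ _ := a1.trans b1
  · calc _ ≤ yb * (S.b * X p.1 ^ S.μ) ^ 4 := b2.trans a2
      _ = _ := by ring

end lim
end
end

section
open Real Set MeasureTheory Filter Topology

noncomputable section

lemma xi_shift {ξ : ℝ × ℝ → ℝ} (h : ContDiff ℝ 1 ξ) (ζ m : ℝ) (hz : ∀ ψ ∈ Ioo 0 m, ξ (ζ, ψ) = 0) :
    ContDiff ℝ 1 (fun p : ℝ × ℝ => ξ p - ξ (ζ, p.2)) ∧ (∀ y, ξ (ζ, y) - ξ (ζ, y) = 0) ∧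
    (∀ p : ℝ × ℝ, pdx (fun p : ℝ × ℝ => ξ p - ξ (ζ, p.2)) p = pdx ξ p) ∧
    (∀ p : ℝ × ℝ, p.2 ∈ Ioo 0 m → pdy (fun p : ℝ × ℝ => ξ p - ξ (ζ, p.2)) p = pdy ξ p) := by
  refine ⟨?_, fun y => sub_self _, fun p => ?_, fun p hp => ?_⟩
  · exact h.sub (h.comp (contDiff_const.prodMk contDiff_snd))
  · simp only [pdx, deriv_sub_const]
  · unfold pdy
    refine Filter.EventuallyEq.deriv_eq ?_
    filter_upwards [Ioo_mem_nhds hp.1 hp.2] with s hs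
    simp only [hz s hs, sub_zero]

section lim
variable {S : SC} {l : ℝ} {Θ F C : ℝ → ℝ} {P : ℝ → ℝ → ℝ} {R : ℝ → ℝ → ℝ} {Φ k X : ℝ → ℝ} {cs M : ℝ}
variable {γ ca cb Lc Lq ya yb : ℝ} {q y : ℝ → ℝ}

lemma weak_Q (G : GasD γ S.Y0 ca cb Lc Lq ya yb q C y) (W : Wall S l Θ F C P) (L : LimR S l Θ C P R) (V : Cov Φ k X l cs M)
    (hk : ∀ x, 0 < x → x < l → P x (YR R x S.m) = k x ∧ 0 < k x)
    (hkq : ∀ x, 0 < x → x < l → k x = q (YR R x S.m) / cos (Θ x))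
    (hΘ : ∀ x, HasDerivAt Θ (deriv Θ x) x) {ξ : ℝ × ℝ → ℝ} (h : ContDiff ℝ 1 ξ)
    (hz : ∀ ψ ∈ Ioo 0 S.m, ξ (Φ l, ψ) = 0) :
    (∫ p in Ioo (0 : ℝ) (Φ l) ×ˢ Ioo (0 : ℝ) S.m,
        (pdx (fun p => -y (Yf R X (Φ l) S.m p)) p * pdx ξ p
          - bfun γ (-y (Yf R X (Φ l) S.m p)) * pdy (fun p => -y (Yf R X (Φ l) S.m p)) p * pdy ξ p))
    - (∫ φ in Ioo (0 : ℝ) (Φ l),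
        deriv Θ (X φ) * Real.cos (Θ (X φ)) / AplusInv γ (-y (Yf R X (Φ l) S.m (φ, S.m))) * ξ (φ, S.m)) = 0 := by
  have hm := S.hm
  have hζ := V.ζ0
  obtain ⟨s1, s2, s3, s4⟩ := xi_shift h (Φ l) S.m hz
  obtain ⟨lT, lY⟩ := Tf_lip L V
  have T0 : ∀ s, Tf R X (Φ l) S.m (0, s) = 0 := by
    intro s
    have X0 : X 0 = 0 := by have := V.XΦ 0 ⟨le_rfl, V.hl.le⟩; rwa [V.Φ0] at this
    have c := cl_mem hm.le s
    simp only [Tf, cl_neg hζ.le le_rfl, X0]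
    rw [L.R0 _ (by linarith [c.1]) c.2, L.R0 _ (by linarith [c.2]) (by linarith [c.1])]; simp
  have Tn : ∀ x s, s ≤ 0 → Tf R X (Φ l) S.m (x, s) = 0 := by
    intro x s hs
    simp only [Tf, cl_neg hm.le hs]; simp
  have wf := weakform lT hζ hm T0 Tn s1 (fun y => s2 y)
  have i1 : (∫ p in Ioo (0 : ℝ) (Φ l) ×ˢ Ioo (0 : ℝ) S.m,
        (pdx (fun p => -y (Yf R X (Φ l) S.m p)) p * pdx ξ p
          - bfun γ (-y (Yf R X (Φ l) S.m p)) * pdy (fun p => -y (Yf R X (Φ l) S.m p)) p * pdy ξ p)) =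
      ∫ p in Ioo 0 (Φ l) ×ˢ Ioo 0 S.m, (pdx (Tf R X (Φ l) S.m) p * pdy (fun p : ℝ × ℝ => ξ p - ξ (Φ l, p.2)) p
        - pdy (Tf R X (Φ l) S.m) p * pdx (fun p : ℝ × ℝ => ξ p - ξ (Φ l, p.2)) p) := by
    refine integral_congr_ae ?_
    filter_upwards [ae_restrict_of_ae lT.ae_differentiableAt, ae_restrict_of_ae lY.ae_differentiableAt,
      ae_restrict_mem (measurableSet_Ioo.prod measurableSet_Ioo)] with p a b c
    obtain ⟨e1, e2, -, -⟩ := ae_pt G W L V hk c.1 c.2 a b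
    rw [e1, e2, s3, s4 p c.2]; ring
  have hzm : ξ (Φ l, S.m) = 0 := by
    have ct : Continuous fun s => ξ (Φ l, s) := h.continuous.comp (by fun_prop)
    have t1 : Tendsto (fun s => ξ (Φ l, s)) (𝓝[<] S.m) (𝓝 (ξ (Φ l, S.m))) := ct.continuousAt.mono_left nhdsWithin_le_nhds
    refine tendsto_nhds_unique t1 ?_
    refine tendsto_const_nhds.congr' ?_
    filter_upwards [Ioo_mem_nhdsLT hm] with s hs
    exact (hz s hs).symm
  rw [i1, wf, intervalIntegral.integral_of_le hζ.le, integral_Ioc_eq_integral_Ioo, sub_eq_zero]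
  refine setIntegral_congr_fun measurableSet_Ioo fun φ hφ => ?_
  have x0 := V.Xo φ hφ
  have em : cl S.m S.m = S.m := cl_eq ⟨hm.le, le_rfl⟩
  have d : HasDerivAt (fun x => Tf R X (Φ l) S.m (x, S.m)) (deriv Θ (X φ) * (k (X φ))⁻¹) φ := by
    have := (hΘ (X φ)).comp φ (V.dX φ hφ)
    refine this.congr_of_eventuallyEq ?_
    filter_upwards [Ioo_mem_nhds hφ.1 hφ.2] with s hs
    have xs := V.Xo s hs
    have e := L.bc (X s) xs.1.le xs.2.le
    simp only [Tf, em, cl_eq (⟨hs.1.le, hs.2.le⟩ : s ∈ Icc 0 (Φ l)), Function.comp]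
    linarith
  have eY : Yf R X (Φ l) S.m (φ, S.m) = YR R (X φ) S.m := by
    simp only [Yf, em, cl_eq (⟨hφ.1.le, hφ.2.le⟩ : φ ∈ Icc 0 (Φ l))]
  have yr := YR_range W L x0.1.le x0.2.le (ψ := S.m) (by linarith) le_rfl
  simp only
  rw [d.deriv, eY, G.yinv _ yr.1 yr.2, hkq _ x0.1 x0.2, hzm, inv_div, sub_zero]
  ring

end lim

lemma six_pow {S : SC} {lamp x : ℝ} (hS : S.μ = (lamp + 2) / 4) (hx : 0 < x) : (x ^ S.μ) ^ 6 / x ^ 2 = x ^ (3 * lamp / 2 + 1) := by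
  rw [← Real.rpow_natCast, ← Real.rpow_mul hx.le, ← Real.rpow_natCast x 2, ← Real.rpow_sub hx, hS]
  congr 1; push_cast; ring

lemma pw_lo {e M x φ c w : ℝ} (he : 0 ≤ e) (hM : 0 < M) (hφ : 0 < φ) (hx : φ / M ≤ x) (hc : 0 ≤ c) (hw : w ≤ c / M ^ e) :
    w * φ ^ e ≤ c * x ^ e := by
  have h1 : (φ / M) ^ e ≤ x ^ e := Real.rpow_le_rpow (by positivity) hx he
  rw [Real.div_rpow hφ.le hM.le] at h1
  have hp : 0 < φ ^ e := Real.rpow_pos_of_pos hφ _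
  calc w * φ ^ e ≤ c / M ^ e * φ ^ e := by gcongr
    _ = c * (φ ^ e / M ^ e) := by ring
    _ ≤ _ := by gcongr

lemma pw_hi {e M x φ c w : ℝ} (he : 0 ≤ e) (hM : 0 < M) (hφ : 0 < φ) (hx0 : 0 ≤ x) (hx : x ≤ φ / M) (hc : 0 ≤ c) (hw : c / M ^ e ≤ w) :
    c * x ^ e ≤ w * φ ^ e := by
  have h1 : x ^ e ≤ (φ / M) ^ e := Real.rpow_le_rpow hx0 hx he
  rw [Real.div_rpow hφ.le hM.le] at h1
  have hp : 0 < φ ^ e := Real.rpow_pos_of_pos hφ _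
  calc c * x ^ e ≤ c * (φ ^ e / M ^ e) := by gcongr
    _ = c / M ^ e * φ ^ e := by ring
    _ ≤ _ := by gcongr
end
end

section
open Real Set MeasureTheory Filter Topology

noncomputable section

theorem main_l {γ : ℝ} (hγ : 1 < γ) {lamp δ1 δ2 ca cb Lc Lq ya yb l : ℝ} {q C y : ℝ → ℝ} {S : SC}
    (hlam : 2 < lamp) (hδ1 : 0 < δ1) {F : ℝ → ℝ}
    (G : GasD γ S.Y0 ca cb Lc Lq ya yb q C y) (eμ : S.μ = (lamp + 2) / 4)
    {f : ℝ → ℝ} (N : NozzlePlus lamp δ1 δ2 l f)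
    (W : Wall S l (ThP f) F C (fun x Y => q Y / cos (ThP f x))) (hg : ∀ x, 0 ≤ x → x ≤ l → deriv f x ≤ 1)
    {C1 C2 : ℝ} (k1 : C1 ≤ ya * S.a ^ 4 / (cstar γ + qmaxF γ) ^ (lamp + 2)) (k2 : C1 ≤ S.v1 / (cstar γ + qmaxF γ) ^ (lamp + 1))
    (k3 : yb * S.b ^ 4 / cstar γ ^ (lamp + 2) ≤ C2) (k4 : S.v2 / cstar γ ^ (lamp + 1) ≤ C2)
    (k5 : S.Gc / S.c1 / cstar γ ^ (3 * lamp / 2 + 1) ≤ C2) :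
    ∃ Qp : ℝ → ℝ, ∃ Q : ℝ × ℝ → ℝ,
      ContinuousOn Qp (Icc 0 l) ∧
      (∀ x ∈ Icc (0 : ℝ) l, cstar γ ≤ Qp x ∧ Qp x ≤ (cstar γ + qmaxF γ) / 2) ∧
      SupersonicWeakSol γ S.m l f Qp Q ∧
      (∀ x ∈ Icc (0 : ℝ) l, Qp x = AplusInv γ (Q (PhiP f Qp x, S.m))) ∧
      (∀ p ∈ Ioo (0 : ℝ) (zetaP f Qp l) ×ˢ Ioo (0 : ℝ) S.m,
        -C2 * p.1 ^ (lamp + 2) ≤ Q p ∧ Q p ≤ -C1 * p.1 ^ (lamp + 2)) ∧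
      (∀ᵐ p ∂(volume.restrict (Ioo (0 : ℝ) (zetaP f Qp l) ×ˢ Ioo (0 : ℝ) S.m)),
        (-C2 * p.1 ^ (lamp + 1) ≤ pdx Q p ∧ pdx Q p ≤ -C1 * p.1 ^ (lamp + 1)) ∧
        |pdy Q p| ≤ C2 * p.1 ^ (3 * lamp / 2 + 1)) := by
  have hl := W.hl; have hm := S.hm
  have hc := cstar_pos hγ; have hqm := qmax_pos hγ
  have cc : ∀ x, 0 < cos (ThP f x) := fun x => Real.cos_arctan_pos _
  have tc : Continuous (ThP f) := Th_cont N
  obtain ⟨R, L⟩ := exists_limR W tc.continuousOn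
    (by
      intro x Y _ _ h1 h2
      have a : ContinuousAt (fun p : ℝ × ℝ => q p.2) (x, Y) := ContinuousAt.comp (f := fun p : ℝ × ℝ => p.2) (g := q) (G.qca Y h1 h2.le) continuousAt_snd
      have b : ContinuousAt (fun p : ℝ × ℝ => cos (ThP f p.1)) (x, Y) := (Real.continuous_cos.comp (tc.comp continuous_fst)).continuousAt
      exact a.div b (cc x).ne')
    (fun Y h1 h2 => G.Cc Y h1 h2.le)
  have yr : ∀ x, 0 ≤ x → x ≤ l → 0 ≤ YR R x S.m ∧ YR R x S.m ≤ S.Y0 := fun x a b => YR_range W L a b (by linarith) le_rfl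
  set Qp : ℝ → ℝ := fun x => q (YR R (cl l x) S.m) with hQp
  have clc : Continuous (cl l) := by unfold cl; fun_prop
  have Rc : ∀ ψ, -S.m ≤ ψ → ψ ≤ S.m → Continuous fun x => R (cl l x) ψ := by
    intro ψ h1 h2
    refine (LipschitzWith.of_dist_le_mul (K := Real.toNNReal S.K1) fun a b => ?_).continuous
    rw [Real.coe_toNNReal _ S.K1_pos.le, Real.dist_eq, Real.dist_eq]
    have ha := cl_mem hl.le a; have hb := cl_mem hl.le b
    have := L.lip _ _ ψ ψ hb.1 hb.2 ha.1 ha.2 h1 h2 h1 h2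
    rw [sub_self, abs_zero, mul_zero, add_zero] at this
    refine this.trans ?_
    have hK := S.K1_pos
    exact mul_le_mul_of_nonneg_left (cl_lip l a b) hK.le
  have Yc : Continuous fun x => YR R (cl l x) S.m := by
    unfold YR
    exact ((Rc S.m (by linarith) le_rfl).add (Rc (-S.m) le_rfl (by linarith))).neg.div_const 2
  have Qc : Continuous Qp := by
    refine G.qc.comp_continuous Yc fun x => ?_
    have := cl_mem hl.le x
    exact yr _ this.1 this.2
  have Qe : ∀ x ∈ Icc 0 l, Qp x = q (YR R x S.m) := fun x hx => by simp only [hQp, cl_eq hx]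
  have Qb : ∀ x ∈ Icc (0 : ℝ) l, cstar γ ≤ Qp x ∧ Qp x ≤ (cstar γ + qmaxF γ) / 2 := by
    intro x hx
    rw [Qe x hx]
    have := yr x hx.1 hx.2
    exact ⟨G.qlo _ this.1 this.2, G.qhi _ this.1 this.2⟩
  have kc : Continuous fun x => Qp x / cos (ThP f x) :=
    Qc.div (Real.continuous_cos.comp tc) fun x => (cc x).ne'
  have V : Cov (PhiP f Qp) (fun x => Qp x / cos (ThP f x)) (Function.invFunOn (PhiP f Qp) (Icc 0 l)) l (cstar γ) (cstar γ + qmaxF γ) := by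
    refine cov_mk hl hc (by linarith) (by simp [PhiP]) (fun x => ?_) (fun x h0 h1 => ?_) (fun x h0 h1 => ?_)
    · exact intervalIntegral.integral_hasStrictDerivAt_right (kc.intervalIntegrable _ _) kc.stronglyMeasurable.stronglyMeasurableAtFilter kc.continuousAt
    · have := (Qb x ⟨h0, h1⟩).1
      rw [le_div_iff₀ (cc x)]
      nlinarith [Real.cos_le_one (ThP f x)]
    · have b := Qb x ⟨h0, h1⟩
      have := (inv_cos N hlam hδ1 hg h0 h1).2.2
      have h2 : 1 / cos (ThP f x) ≤ 2 := by linarith [hg x h0 h1]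
      have h3 : 0 < 1 / cos (ThP f x) := by have := cc x; positivity
      calc Qp x / cos (ThP f x) = Qp x * (1 / cos (ThP f x)) := by ring
        _ ≤ (cstar γ + qmaxF γ) / 2 * 2 := by gcongr; exact b.2
        _ = _ := by ring
  set Φ := PhiP f Qp with hΦ
  set X := Function.invFunOn Φ (Icc 0 l) with hX
  have hk : ∀ x, 0 < x → x < l → (q (YR R x S.m) / cos (ThP f x) = Qp x / cos (ThP f x) ∧ 0 < Qp x / cos (ThP f x)) := by
    intro x h0 h1
    rw [Qe x ⟨h0.le, h1.le⟩]
    refine ⟨rfl, div_pos ?_ (cc x)⟩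
    have := (Qb x ⟨h0.le, h1.le⟩).1
    rw [Qe x ⟨h0.le, h1.le⟩] at this; linarith
  obtain ⟨lT, lY⟩ := Tf_lip L V
  have X0 : X 0 = 0 := by have := V.XΦ 0 ⟨le_rfl, V.hl.le⟩; rwa [V.Φ0] at this
  have xlo : ∀ φ ∈ Ioo 0 (Φ l), φ / (cstar γ + qmaxF γ) ≤ X φ ∧ X φ ≤ φ / cstar γ ∧ 0 < X φ := fun φ h =>
    ⟨V.Xlo φ ⟨h.1.le, h.2.le⟩, V.Xhi φ ⟨h.1.le, h.2.le⟩, (V.Xo φ h).1⟩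
  have hsum : 0 < cstar γ + qmaxF γ := by linarith
  have hya := G.hya; have hyb := G.hyb; have ha := S.ha; have hb := S.hb
  have hv1 := S.v1_pos; have hv2 := S.v2_pos; have hGc := S.Gc_pos; have hc1 := S.c1_pos
  refine ⟨Qp, fun p => -y (Yf R X (Φ l) S.m p), Qc.continuousOn, Qb, ⟨?_, ?_, ?_, ?_⟩, ?_, ?_, ?_⟩
  · refine ⟨Real.toNNReal ((C S.Y0)⁻¹ * (S.K1 * (cstar γ)⁻¹ + S.v2)), LipschitzWith.lipschitzOnWith ?_⟩
    have cp := G.Cpos S.Y0 G.hY0 le_rfl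
    have kp := S.K1_pos
    refine LipschitzWith.of_dist_le_mul fun p p' => ?_
    rw [Real.coe_toNNReal _ (by positivity), Real.dist_eq, neg_sub_neg]
    have r1 := Yf_range W L V p; have r2 := Yf_range W L V p'
    have d := lY.dist_le_mul p p'
    rw [Real.coe_toNNReal _ (by positivity), Real.dist_eq] at d
    refine (y_lip G r1.1 r1.2 r2.1 r2.2).trans ?_
    rw [abs_sub_comm, mul_assoc]
    gcongr
  · intro p _
    have r1 := Yf_range W L V p
    have := (y_inc G le_rfl r1.1 r1.2).1
    rw [G.y0] at this
    simp only []
    linarith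
  · intro ψ hψ
    have b := L.Ybd 0 ψ le_rfl hl.le (by linarith [hψ.1]) hψ.2.le
    have e : Yf R X (Φ l) S.m (0, ψ) = 0 := by
      simp only [Yf, YR, cl_neg V.ζ0.le le_rfl, X0, cl_eq (⟨hψ.1.le, hψ.2.le⟩ : ψ ∈ Icc 0 S.m)]
      rw [L.R0 _ (by linarith [hψ.1]) hψ.2.le, L.R0 _ (by linarith [hψ.2]) (by linarith [hψ.1])]; simp
    simp only [e, G.y0, neg_zero]
  · intro ξ h hz
    exact weak_Q G W L V hk (fun x h0 h1 => (hk x h0 h1).1.symm) (fun x => (Th_deriv N x).differentiableAt.hasDerivAt) h hz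
  · intro x hx
    have e : Yf R X (Φ l) S.m (Φ x, S.m) = YR R x S.m := by
      simp only [Yf, cl_eq (V.Φm x hx), V.XΦ x hx, cl_eq (⟨hm.le, le_rfl⟩ : S.m ∈ Icc 0 S.m)]
    have := yr x hx.1 hx.2
    change Qp x = AplusInv γ (-y (Yf R X (Φ l) S.m (Φ x, S.m)))
    rw [e, G.yinv _ this.1 this.2, Qe x hx]
  · intro p hp
    obtain ⟨a, b, c⟩ := xlo p.1 hp.1
    have q1 := Q_bd G W L V hp.1 hp.2
    rw [(pow_conv eμ c).1] at q1
    have u1 := pw_lo (e := lamp + 2) (by linarith) hsum hp.1.1 a (by positivity) k1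
    have u2 := pw_hi (e := lamp + 2) (by linarith) hc hp.1.1 c.le b (by positivity) k3
    simp only []
    constructor <;> linarith [q1.1, q1.2]
  · filter_upwards [ae_restrict_of_ae lT.ae_differentiableAt, ae_restrict_of_ae lY.ae_differentiableAt,
      ae_restrict_mem (measurableSet_Ioo.prod measurableSet_Ioo)] with p hT hY hp
    obtain ⟨a, b, c⟩ := xlo p.1 hp.1
    obtain ⟨e1, -, e3, e4⟩ := ae_pt G W L V hk hp.1 hp.2 hT hY
    rw [(pow_conv eμ c).2.1] at e3
    rw [six_pow eμ c] at e4
    rw [e1]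
    have u1 := pw_lo (e := lamp + 1) (by linarith) hsum hp.1.1 a hv1.le k2
    have u2 := pw_hi (e := lamp + 1) (by linarith) hc hp.1.1 c.le b hv2.le k4
    have u3 := pw_hi (e := 3 * lamp / 2 + 1) (by linarith) hc hp.1.1 c.le b (by positivity) k5
    exact ⟨⟨by linarith [e3.2], by linarith [e3.1]⟩, e4.trans u3⟩

theorem stmt_5x (γ : ℝ) (hγ : 1 < γ) (m lamp δ1 δ2 : ℝ)
    (hm : 0 < m) (hlam : 2 < lamp) (hδ1 : 0 < δ1) (hδ12 : δ1 ≤ δ2) :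
    ∃ δ0 > 0, ∃ C1 C2 : ℝ, 0 < C1 ∧ C1 ≤ C2 ∧
    ∀ l : ℝ, 0 < l → l ≤ δ0 → l ≤ 1 →
    ∀ f : ℝ → ℝ, NozzlePlus lamp δ1 δ2 l f →
      f 0 * cstar γ ^ (1 + 2 / (γ - 1) : ℝ) = m →
    ∃ Qp : ℝ → ℝ, ∃ Q : ℝ × ℝ → ℝ,
      ContinuousOn Qp (Icc 0 l) ∧
      (∀ x ∈ Icc (0 : ℝ) l, cstar γ ≤ Qp x ∧ Qp x ≤ (cstar γ + qmaxF γ) / 2) ∧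
      SupersonicWeakSol γ m l f Qp Q ∧
      (∀ x ∈ Icc (0 : ℝ) l, Qp x = AplusInv γ (Q (PhiP f Qp x, m))) ∧
      (∀ p ∈ Ioo (0 : ℝ) (zetaP f Qp l) ×ˢ Ioo (0 : ℝ) m,
        -C2 * p.1 ^ (lamp + 2) ≤ Q p ∧ Q p ≤ -C1 * p.1 ^ (lamp + 2)) ∧
      (∀ᵐ p ∂(volume.restrict (Ioo (0 : ℝ) (zetaP f Qp l) ×ˢ Ioo (0 : ℝ) m)),
        (-C2 * p.1 ^ (lamp + 1) ≤ pdx Q p ∧ pdx Q p ≤ -C1 * p.1 ^ (lamp + 1)) ∧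
        |pdy Q p| ≤ C2 * p.1 ^ (3 * lamp / 2 + 1)) := by
  obtain ⟨Y0, ca, cb, Lc, Lq, ya, yb, q, C, y, G⟩ := exists_gas hγ
  obtain ⟨S, em, eμ, ecs, eca, ecb, eL, eY, ed, et1, et2, eA⟩ := exists_SC hγ G hm hlam hδ1 hδ12
  obtain ⟨δ0, hδ0, small⟩ := exists_small S
  subst em
  subst eY
  have hc := cstar_pos hγ; have hqm := qmax_pos hγ
  have hya := G.hya; have ha := S.ha; have hv1 := S.v1_pos
  refine ⟨δ0, hδ0, min (ya * S.a ^ 4 / (cstar γ + qmaxF γ) ^ (lamp + 2)) (S.v1 / (cstar γ + qmaxF γ) ^ (lamp + 1)),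
    max (min (ya * S.a ^ 4 / (cstar γ + qmaxF γ) ^ (lamp + 2)) (S.v1 / (cstar γ + qmaxF γ) ^ (lamp + 1)))
      (max (yb * S.b ^ 4 / cstar γ ^ (lamp + 2)) (max (S.v2 / cstar γ ^ (lamp + 1)) (S.Gc / S.c1 / cstar γ ^ (3 * lamp / 2 + 1)))),
    lt_min (by positivity) (by positivity), le_max_left _ _, ?_⟩
  intro l hl hl0 hl1 f N _
  obtain ⟨W, hg⟩ := exists_wall (m := S.m) G hlam hδ1 hδ12 hγ eμ ecs eca ecb eL rfl ed et1 et2 eA hl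
    (fun x h0 h1 => small x h0 (h1.trans hl0)) N
  exact main_l hγ hlam hδ1 G eμ N W hg (min_le_left _ _) (min_le_right _ _)
    ((le_max_left _ _).trans (le_max_right _ _))
    (((le_max_left _ _).trans (le_max_right _ _)).trans (le_max_right _ _))
    (((le_max_right _ _).trans (le_max_right _ _)).trans (le_max_right _ _))
end
end

/-- existence of a weak sonic–supersonic flow in the divergent part
of the nozzle (Theorem `theoremsuper` / `theoremm3`). -/
theorem stmt_5 (γ : ℝ) (hγ : 1 < γ) (m lamp δ1 δ2 : ℝ)
    (hm : 0 < m) (hlam : 2 < lamp) (hδ1 : 0 < δ1) (hδ12 : δ1 ≤ δ2) :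
    ∃ δ0 > 0, ∃ C1 C2 : ℝ, 0 < C1 ∧ C1 ≤ C2 ∧
    ∀ l : ℝ, 0 < l → l ≤ δ0 → l ≤ 1 →
    ∀ f : ℝ → ℝ, NozzlePlus lamp δ1 δ2 l f →
      f 0 * cstar γ ^ (1 + 2 / (γ - 1) : ℝ) = m →
    ∃ Qp : ℝ → ℝ, ∃ Q : ℝ × ℝ → ℝ,
      ContinuousOn Qp (Icc 0 l) ∧
      (∀ x ∈ Icc (0 : ℝ) l, cstar γ ≤ Qp x ∧ Qp x ≤ (cstar γ + qmaxF γ) / 2) ∧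
      SupersonicWeakSol γ m l f Qp Q ∧
      (∀ x ∈ Icc (0 : ℝ) l, Qp x = AplusInv γ (Q (PhiP f Qp x, m))) ∧
      (∀ p ∈ Ioo (0 : ℝ) (zetaP f Qp l) ×ˢ Ioo (0 : ℝ) m,
        -C2 * p.1 ^ (lamp + 2) ≤ Q p ∧ Q p ≤ -C1 * p.1 ^ (lamp + 2)) ∧
      (∀ᵐ p ∂(volume.restrict (Ioo (0 : ℝ) (zetaP f Qp l) ×ˢ Ioo (0 : ℝ) m)),
        (-C2 * p.1 ^ (lamp + 1) ≤ pdx Q p ∧ pdx Q p ≤ -C1 * p.1 ^ (lamp + 1)) ∧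
        |pdy Q p| ≤ C2 * p.1 ^ (3 * lamp / 2 + 1)) :=
  stmt_5x γ hγ m lamp δ1 δ2 hm hlam hδ1 hδ12
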